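/- For t > 0, define C(t) := (1/(4π)) · ∫_0^{π/2} ∫_{-π}^{π} [((∂_r p_t(r,z))² + tan²(r)·(∂_z p_t(r,z))²) / p_t(r,z)] · sin(2r) dz dr. Then: (i) C is decreasing on (0, ∞); (ii) lim_{t→0⁺} t·C(t) = 1; (iii) lim_{t→+∞} e^{4t}·C(t) = 4. -/

import Mathlib

open Real

/-- The Jacobi polynomial `P_k^{0,m}` defined by the Rodrigues-type formula. -/
noncomputable def jacobiP (k m : ℕ) (x : ℝ) : ℝ :=
  ((-1 : ℝ) ^ k / (2 ^ k * (Nat.factorial k : ℝ) * (1 + x) ^ m)) *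
    iteratedDeriv k (fun y : ℝ => (1 + y) ^ m * (1 - y ^ 2) ^ k) x

/-- The general term of the double series defining the subelliptic heat kernel on `SU(2)`. -/
noncomputable def heatTerm (t r z : ℝ) (n : ℤ) (k : ℕ) : ℂ :=
  (((2 * (k : ℝ) + (n.natAbs : ℝ) + 1) *
      Real.exp (-(4 * (k : ℝ) * ((k : ℝ) + (n.natAbs : ℝ) + 1) + 2 * (n.natAbs : ℝ)) * t) *
      (Real.cos r) ^ n.natAbs * jacobiP k n.natAbs (Real.cos (2 * r)) : ℝ) : ℂ) *
    Complex.exp ((n : ℂ) * (z : ℂ) * Complex.I)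

/-- The subelliptic heat kernel `p_t(r,z)` on `SU(2)` in cylindric coordinates
(the double series is real-valued). -/
noncomputable def heatP (t r z : ℝ) : ℝ := (∑' n : ℤ, ∑' k : ℕ, heatTerm t r z n k).re

/-- The sharp constant of the reverse Poincaré inequality:
`C(t) = (1/(4π)) ∫₀^{π/2} ∫_{-π}^{π} (Γ(p_t)/p_t)(r,z) sin(2r) dz dr`. -/
noncomputable def Cconst (t : ℝ) : ℝ :=
  (1 / (4 * Real.pi)) *
    ∫ r in (0 : ℝ)..(Real.pi / 2), ∫ z in (-Real.pi)..Real.pi,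
      ((deriv (fun r' => heatP t r' z) r) ^ 2 +
          Real.tan r ^ 2 * (deriv (fun z' => heatP t r z') z) ^ 2) / heatP t r z *
        Real.sin (2 * r)

section
open Real

/-- coefficients of the powers of the generating function, indices shifted by one -/
noncomputable def gc (w v : ℂ) : ℕ → ℕ → ℕ → ℂ
  | 0, A, B => if A = 1 ∧ B = 1 then 1 else 0
  | _ + 1, 0, _ => 0
  | _ + 1, _ + 1, 0 => 0
  | k + 1, A + 1, B + 1 => w * gc w v (k + 1) A (B + 1) + v * gc w v (k + 1) (A + 1) B
      - gc w v (k + 1) A B + gc w v k (A + 1) (B + 1)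
termination_by k A B => (k, A, B)

lemma gc_zero_left (w v : ℂ) (k B : ℕ) : gc w v k 0 B = 0 := by
  cases k <;> simp [gc]

lemma gc_zero_right (w v : ℂ) (k A : ℕ) : gc w v k A 0 = 0 := by
  cases k <;> cases A <;> simp [gc]

lemma gc_rec (w v : ℂ) (k A B : ℕ) : gc w v (k + 1) (A + 1) (B + 1) =
    w * gc w v (k + 1) A (B + 1) + v * gc w v (k + 1) (A + 1) B
      - gc w v (k + 1) A B + gc w v k (A + 1) (B + 1) := by
  rw [gc]

lemma gc_unique (w v : ℂ) (d : ℕ → ℕ → ℂ) (h0 : ∀ B, d 0 B = 0) (h1 : ∀ A, d A 0 = 0)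
    (h : ∀ A B, d (A + 1) (B + 1) = w * d A (B + 1) + v * d (A + 1) B - d A B) :
    ∀ A B, d A B = 0 := by
  intro A
  induction A with
  | zero => exact h0
  | succ A ihA =>
    intro B
    induction B with
    | zero => exact h1 _
    | succ B ihB => rw [h, ihA, ihA, ihB]; ring

lemma gc_deriv (w v : ℝ → ℂ) (w' v' : ℂ) (τ : ℝ) (hw : HasDerivAt w w' τ) (hv : HasDerivAt v v' τ) :
    ∀ k A B : ℕ, HasDerivAt (fun x => gc (w x) (v x) k A B)
      (k * (w' * gc (w τ) (v τ) (k + 1) (A - 1) B + v' * gc (w τ) (v τ) (k + 1) A (B - 1))) τ := by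
  intro k
  induction k with
  | zero =>
    intro A B
    simp only [gc]
    simpa using hasDerivAt_const τ ((if A = 1 ∧ B = 1 then 1 else 0 : ℂ))
  | succ k ihk =>
    intro A
    induction A with
    | zero =>
      intro B
      simp only [gc_zero_left]
      simpa [gc_zero_left] using hasDerivAt_const τ (0 : ℂ)
    | succ A ihA =>
      intro B
      induction B with
      | zero =>
        simp only [gc_zero_right]
        simpa [gc_zero_right] using hasDerivAt_const τ (0 : ℂ)
      | succ B ihB =>
        simp only [gc_rec]
        have := (((hw.mul (ihA (B+1))).add (hv.mul ihB)).sub (ihA B)).add (ihk (A+1) (B+1))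
        refine this.congr_deriv ?_
        simp only [Nat.add_sub_cancel]
        rcases A with _ | A
        · rcases B with _ | B
          · simp [gc_zero_left, gc_zero_right]
          · simp only [gc_zero_left, gc_zero_right, zero_add, Nat.add_sub_cancel, Nat.zero_sub]
            push_cast
            have e := gc_rec (w τ) (v τ) (k+1) 0 B
            simp only [gc_zero_left, zero_add] at e
            rw [e]; ring
        · rcases B with _ | B
          · simp only [gc_zero_left, gc_zero_right, zero_add, Nat.add_sub_cancel, Nat.zero_sub]
            push_cast
            have e := gc_rec (w τ) (v τ) (k+1) A 0
            simp only [gc_zero_right, zero_add] at e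
            rw [e]; ring
          · simp only [Nat.add_sub_cancel]
            push_cast
            have e := gc_rec (w τ) (v τ) (k+1) A (B+1)
            have e' := gc_rec (w τ) (v τ) (k+1) (A+1) B
            rw [e, e']; ring

lemma gc_E1 (w v : ℂ) : ∀ k A B : ℕ, ((A : ℂ) - 1) * gc w v k A B =
    k * (w * gc w v (k + 1) (A - 1) B - gc w v (k + 1) (A - 1) (B - 1)) := by
  intro k
  induction k with
  | zero =>
    intro A B
    simp only [gc]
    split_ifs with h
    · simp [h.1]
    · simp
  | succ k ih =>
    intro A B
    rw [← sub_eq_zero]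
    refine gc_unique w v (fun A B => ((A : ℂ) - 1) * gc w v (k+1) A B -
      (k + 1 : ℕ) * (w * gc w v (k + 1 + 1) (A - 1) B - gc w v (k + 1 + 1) (A - 1) (B - 1))) ?_ ?_ ?_ A B
    · intro B; simp [gc_zero_left]
    · intro B; simp [gc_zero_right]
    · intro A B
      have h := ih (A+1) (B+1)
      rw [gc_rec w v k A B]
      simp only [Nat.add_sub_cancel] at h ⊢
      rcases A with _ | A
      · simp only [gc_zero_left, Nat.zero_sub] at h ⊢; push_cast at h ⊢; linear_combination h
      · rcases B with _ | B
        · simp only [Nat.add_sub_cancel, gc_zero_right, Nat.zero_sub] at h ⊢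
          rw [gc_rec w v (k+1) A 0]
          simp only [gc_zero_right, zero_add] at h ⊢
          push_cast at h ⊢
          linear_combination h
        · simp only [Nat.add_sub_cancel] at h ⊢
          rw [gc_rec w v (k+1) A (B+1), gc_rec w v (k+1) A B]
          push_cast at h ⊢
          linear_combination h

lemma gc_swap (w v : ℂ) : ∀ k A B : ℕ, gc w v k A B = gc v w k B A := by
  intro k
  induction k with
  | zero => intro A B; simp only [gc, and_comm]
  | succ k ih =>
    intro A B
    rw [← sub_eq_zero]
    refine gc_unique w v (fun A B => gc w v (k+1) A B - gc v w (k+1) B A) ?_ ?_ ?_ A B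
    · intro B; simp [gc_zero_left, gc_zero_right]
    · intro B; simp [gc_zero_left, gc_zero_right]
    · intro A B
      rw [gc_rec w v k A B, gc_rec v w k B A, ih]; ring

lemma gc_E2 (w v : ℂ) (k A B : ℕ) : ((B : ℂ) - 1) * gc w v k A B =
    k * (v * gc w v (k + 1) A (B - 1) - gc w v (k + 1) (A - 1) (B - 1)) := by
  rw [gc_swap w v, gc_swap w v, gc_swap w v]; exact gc_E1 v w k B A

/-- disk polynomials -/
noncomputable def ph (a b : ℕ) (w v : ℂ) : ℂ := gc w v 1 (a + 1) (b + 1)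

lemma gc_eigen (w v : ℂ) (a b : ℕ) :
    4 * (1 - w * v) * (2 * gc w v 3 a b) - 2 * (w * gc w v 2 a (b + 1) + v * gc w v 2 (a + 1) b)
      = -(4 * a * b + 2 * a + 2 * b) * ph a b w v := by
  unfold ph
  have h1 := gc_E1 w v 1 (a+1) (b+1)
  have h2 := gc_E2 w v 1 (a+1) (b+1)
  have h3 := gc_E2 w v 2 a (b+1)
  have h4 := gc_E2 w v 2 a b
  simp only [Nat.add_sub_cancel] at h1 h2 h3
  push_cast at h1 h2 h3 h4
  rcases a with _ | a
  · simp only [gc_zero_left] at *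
    push_cast at *
    linear_combination 2 * h2
  · rcases b with _ | b
    · simp only [gc_zero_right] at *
      push_cast at *
      linear_combination 2 * h1
    · have h5 := gc_rec w v 2 a b
      simp only [Nat.add_sub_cancel] at *
      push_cast at *
      linear_combination (2 + 4*(b+1)) * h1 + 2 * h2 + 4 * w * h3 - 4 * h4 + 8 * h5

lemma gc_two_step (w v : ℂ) (a b : ℕ) :
    gc w v 2 (a + 1) (b + 1) - gc w v 2 a b = (a + b + 1) * ph a b w v := by
  unfold ph
  have h1 := gc_E1 w v 1 (a+1) (b+1)
  have h2 := gc_E2 w v 1 (a+1) (b+1)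
  have h3 := gc_rec w v 1 a b
  simp only [Nat.add_sub_cancel] at *
  push_cast at *
  linear_combination h3 - h1 - h2

lemma ph_R (w v : ℂ) (a b : ℕ) : (a + b + 1) * (w * ph a b w v) =
    (a + 1) * ph (a + 1) b w v + b * gc w v 1 (a + 1) b := by
  have h0 := gc_two_step w v a b
  unfold ph at *
  have h1 := gc_E1 w v 1 (a+1+1) (b+1)
  have h2 := gc_E2 w v 1 (a+1) b
  simp only [Nat.add_sub_cancel] at *
  push_cast at *
  rcases b with _ | b
  · simp only [gc_zero_right] at *
    push_cast at *
    linear_combination -w * h0 - h1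
  · have h3 := gc_rec w v 1 a b
    simp only [Nat.add_sub_cancel] at *
    push_cast at *
    linear_combination -w * h0 - h1 - h2 + h3

lemma ph_succ_succ (w v : ℂ) (a b : ℕ) : ph (a + 1) (b + 1) w v =
    w * ph a (b + 1) w v + v * ph (a + 1) b w v - ph a b w v := by
  unfold ph
  rw [gc_rec]
  simp [gc]

lemma ph_zero_right (w v : ℂ) (a : ℕ) : ph a 0 w v = w ^ a := by
  induction a with
  | zero => simp [ph, gc]
  | succ a ih =>
    unfold ph at *
    rw [gc_rec]
    simp only [gc_zero_right]
    rw [ih]; simp [gc]; ring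

lemma ph_swap (w v : ℂ) (a b : ℕ) : ph a b w v = ph b a v w := gc_swap w v 1 (a + 1) (b + 1)

lemma ph_zero_left (w v : ℂ) (b : ℕ) : ph 0 b w v = v ^ b := by
  rw [ph_swap, ph_zero_right]

lemma choose_mul_pow_aux (w : ℂ) (a i : ℕ) : (a.choose (i + 1) : ℂ) * (w * w ^ (a - (i + 1))) =
    (a.choose (i + 1) : ℂ) * w ^ (a - i) := by
  rcases Nat.lt_or_ge a (i + 1) with h | h
  · simp [Nat.choose_eq_zero_of_lt h]
  · rw [← pow_succ']; congr 2; omega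

/-- explicit disk polynomials -/
noncomputable def phE (a b N : ℕ) (w v : ℂ) : ℂ :=
    ∑ j ∈ Finset.range N, (a.choose j : ℂ) * (b.choose j : ℂ) * (-(1 - w * v)) ^ j *
      (w ^ (a - j) * v ^ (b - j))

lemma phE_stable (a b N : ℕ) (h : b + 1 ≤ N) (w v : ℂ) : phE a b N w v = phE a b (b + 1) w v := by
  unfold phE
  symm
  apply Finset.sum_subset
  · intro j; simp only [Finset.mem_range]; omega
  · intro j _ hj
    simp only [Finset.mem_range] at hj
    rw [Nat.choose_eq_zero_of_lt (show b < j by omega)]; simp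

lemma phE_rec (a b N : ℕ) (w v : ℂ) : phE (a + 1) (b + 1) (N + 1) w v =
    w * phE a (b + 1) (N + 1) w v + v * phE (a + 1) b (N + 1) w v - w * v * phE a b (N + 1) w v
      - (1 - w * v) * phE a b N w v := by
  unfold phE
  rw [Finset.sum_range_succ', Finset.sum_range_succ', Finset.sum_range_succ', Finset.sum_range_succ']
  simp only [mul_add, Finset.mul_sum]
  have key : ∀ i ∈ Finset.range N, ((a+1).choose (i+1) : ℂ) * ((b+1).choose (i+1) : ℂ) * (-(1 - w * v)) ^ (i+1) *
      (w ^ (a + 1 - (i+1)) * v ^ (b + 1 - (i+1))) =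
      w * ((a.choose (i+1) : ℂ) * ((b+1).choose (i+1) : ℂ) * (-(1 - w * v)) ^ (i+1) *
      (w ^ (a - (i+1)) * v ^ (b + 1 - (i+1)))) +
      v * (((a+1).choose (i+1) : ℂ) * (b.choose (i+1) : ℂ) * (-(1 - w * v)) ^ (i+1) *
      (w ^ (a + 1 - (i+1)) * v ^ (b - (i+1)))) -
      w * v * ((a.choose (i+1) : ℂ) * (b.choose (i+1) : ℂ) * (-(1 - w * v)) ^ (i+1) *
      (w ^ (a - (i+1)) * v ^ (b - (i+1)))) -
      (1 - w * v) * ((a.choose i : ℂ) * (b.choose i : ℂ) * (-(1 - w * v)) ^ i *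
      (w ^ (a - i) * v ^ (b - i))) := by
    intro i _
    have h1 := choose_mul_pow_aux w a i
    have h2 := choose_mul_pow_aux v b i
    have e1 : a + 1 - (i + 1) = a - i := by omega
    have e2 : b + 1 - (i + 1) = b - i := by omega
    rw [e1, e2, Nat.choose_succ_succ, Nat.choose_succ_succ b i]
    push_cast
    set ca := (a.choose i : ℂ)
    set cb := (b.choose i : ℂ)
    set da := (a.choose (i+1) : ℂ)
    set db := (b.choose (i+1) : ℂ)
    set S := (-(1 - w * v)) ^ i with hS
    have hS' : (-(1 - w * v)) ^ (i+1) = -(1 - w*v) * S := by rw [pow_succ]; ring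
    rw [hS']
    linear_combination (-(cb + db) * (-(1 - w*v) * S) * v ^ (b - i) + db * (-(1 - w*v) * S) * (v * v ^ (b - (i+1)))) * h1
      + (-(ca + da) * (-(1 - w*v) * S) * w ^ (a - i) + da * (-(1 - w*v) * S) * (w ^ (a - i))) * h2
  rw [Finset.sum_congr rfl key]
  simp only [Finset.sum_add_distrib, Finset.sum_sub_distrib]
  simp
  ring

lemma ph_explicit (a b : ℕ) (w v : ℂ) : ph a b w v = phE a b (b + 1) w v := by
  induction a generalizing b with
  | zero =>
    rw [ph_zero_left]
    unfold phE
    rw [Finset.sum_eq_single 0]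
    · simp
    · intro j _ hj
      rw [Nat.choose_eq_zero_of_lt (Nat.pos_of_ne_zero hj)]; simp
    · simp
  | succ a ih =>
    induction b with
    | zero => rw [ph_zero_right]; simp [phE]
    | succ b ihb =>
      rw [ph_succ_succ, ihb, ih (b+1), ih b, phE_rec, ← phE_stable (a+1) b (b+1+1) (by omega),
        ← phE_stable a b (b+1+1) (by omega)]
      have := phE_stable a b (b+1+1) (by omega) w v
      rw [this]; ring

lemma ph_one (a b : ℕ) : ph a b 1 1 = 1 := by
  rw [ph_explicit, phE, Finset.sum_eq_single 0]
  · simp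
  · intro j _ hj; simp [hj]
  · simp

lemma ph_rot (a b : ℕ) (w v e e' : ℂ) (he : e * e' = 1) :
    ph a b (w * e) (v * e') * e' ^ a * e ^ b = ph a b w v := by
  rw [ph_explicit, ph_explicit, phE, phE, Finset.sum_mul, Finset.sum_mul]
  apply Finset.sum_congr rfl
  intro j hj
  have hj' : j ≤ b := by simpa [Nat.lt_succ_iff] using hj
  rcases Nat.lt_or_ge a j with h | h
  · simp [Nat.choose_eq_zero_of_lt h]
  · have h1 : w * e * (v * e') = w * v := by linear_combination w * v * he
    rw [h1]
    obtain ⟨a, rfl⟩ := Nat.exists_eq_add_of_le h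
    obtain ⟨b, rfl⟩ := Nat.exists_eq_add_of_le hj'
    simp only [Nat.add_sub_cancel_left]
    have h2 : ∀ n : ℕ, e ^ n * e' ^ n = 1 := by intro n; rw [← mul_pow, he, one_pow]
    rw [mul_pow, mul_pow, pow_add e', pow_add e]
    have h3 : e ^ a * e' ^ b * (e' ^ j * e' ^ a) * (e ^ j * e ^ b) = 1 := by
      have := h2 a; have hb := h2 b; have hj := h2 j
      calc _ = (e^a*e'^a) * (e^b*e'^b) * (e^j*e'^j) := by ring
        _ = 1 := by rw [this, hb, hj]; ring
    linear_combination (((j+a).choose j : ℂ)) * (((j+b).choose j : ℂ)) * (-(1 - w * v)) ^ j * (w^a * v^b) * h3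

lemma ph_conj (a b : ℕ) (w v : ℂ) : (starRingEnd ℂ) (ph a b w v) =
    ph a b ((starRingEnd ℂ) w) ((starRingEnd ℂ) v) := by
  rw [ph_explicit, ph_explicit, phE, phE, map_sum]
  apply Finset.sum_congr rfl
  intro j _
  simp

lemma choose_le_pow_div' (a j : ℕ) : (a.choose j : ℝ) ≤ (a : ℝ) ^ j / (j.factorial : ℝ) := by
  exact Nat.choose_le_pow_div j a

/-- growth bound -/
lemma ph_bound (a b : ℕ) (w : ℂ) (hw : ‖w‖ ≤ 1) (τ : ℝ) (hτ : 0 < τ) :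
    ‖ph a b w ((starRingEnd ℂ) w)‖ ≤ Real.exp (2 * a * b * τ + (1 - ‖w‖ ^ 2) / (2 * τ)) := by
  have hs : 0 ≤ 1 - ‖w‖ ^ 2 := by nlinarith [norm_nonneg w]
  set s := 1 - ‖w‖ ^ 2 with hsdef
  have e1 : (1 - w * (starRingEnd ℂ) w) = ((s : ℝ) : ℂ) := by
    rw [Complex.mul_conj, Complex.normSq_eq_norm_sq]; push_cast; simp [hsdef]
  set q := Real.sqrt (a * b * s) with hq
  have hq2 : q ^ 2 = a * b * s := Real.sq_sqrt (by positivity)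
  have hq0 : 0 ≤ q := Real.sqrt_nonneg _
  have step : ‖ph a b w ((starRingEnd ℂ) w)‖ ≤ ∑ j ∈ Finset.range (b+1), (q ^ j / (j.factorial : ℝ)) * (q ^ j / (j.factorial : ℝ)) := by
    rw [ph_explicit, phE]
    refine (norm_sum_le _ _).trans (Finset.sum_le_sum fun j _ => ?_)
    rw [e1]
    simp only [norm_mul, norm_pow, norm_neg, Complex.norm_natCast, Complex.norm_real, Real.norm_of_nonneg hs, RCLike.norm_conj]
    have h1 : ‖w‖ ^ (a - j) * ‖w‖ ^ (b - j) ≤ 1 := by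
      have := pow_le_one₀ (n := a - j) (norm_nonneg w) hw
      have := pow_le_one₀ (n := b - j) (norm_nonneg w) hw
      exact mul_le_one₀ ‹_› (by positivity) ‹_›
    have h2 := choose_le_pow_div' a j
    have h3 := choose_le_pow_div' b j
    calc (a.choose j : ℝ) * (b.choose j : ℝ) * s ^ j * (‖w‖ ^ (a - j) * ‖w‖ ^ (b - j))
        ≤ ((a : ℝ) ^ j / (j.factorial : ℝ)) * ((b : ℝ) ^ j / (j.factorial : ℝ)) * s ^ j * 1 := by gcongr
      _ = (q^2) ^ j / (j.factorial : ℝ) / (j.factorial : ℝ) := by rw [hq2]; rw [mul_pow, mul_pow]; field_simp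
      _ = _ := by rw [← pow_mul, mul_comm 2 j, pow_mul]; rw [sq]; field_simp
  have h4 : ∑ j ∈ Finset.range (b+1), (q ^ j / (j.factorial : ℝ)) * (q ^ j / (j.factorial : ℝ)) ≤ Real.exp q * Real.exp q := by
    have h5 : ∀ j ∈ Finset.range (b+1), (q ^ j / (j.factorial : ℝ)) * (q ^ j / (j.factorial : ℝ)) ≤ (q ^ j / (j.factorial : ℝ)) * Real.exp q := by
      intro j _
      have := Real.pow_div_factorial_le_exp q hq0 j
      gcongr
    refine (Finset.sum_le_sum h5).trans ?_
    rw [← Finset.sum_mul]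
    have := Real.sum_le_exp_of_nonneg hq0 (b+1)
    gcongr
  refine (step.trans h4).trans ?_
  rw [← Real.exp_add]
  apply Real.exp_le_exp.mpr
  have : 0 ≤ (2 * (a*b : ℝ) * τ - s / (2 * τ)) ^ 2 := sq_nonneg _
  have hx : 0 ≤ 2 * (a*b : ℝ) * τ + s / (2 * τ) := by positivity
  have : (q + q) ^ 2 ≤ (2 * (a*b : ℝ) * τ + s / (2 * τ)) ^ 2 := by
    have e : (2 * (a*b : ℝ) * τ) * (s / (2 * τ)) = a * b * s := by field_simp
    nlinarith
  have := abs_le_of_sq_le_sq' this hx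
  nlinarith [this.2]
end

section
open Real

/-- closed unit disk -/
def DD : Set (ℝ × ℝ) := {p | p.1 ^ 2 + p.2 ^ 2 ≤ 1}

lemma DD_closed : IsClosed DD := isClosed_le (by fun_prop) (by fun_prop)

lemma DD_compact : IsCompact DD := by
  apply (isCompact_Icc (a := ((-1 : ℝ), (-1 : ℝ))) (b := ((1 : ℝ), (1 : ℝ)))).of_isClosed_subset DD_closed
  rintro ⟨x, y⟩ h
  simp only [DD, Set.mem_ofPred_eq] at h
  simp only [Set.mem_Icc, Prod.mk_le_mk]
  refine ⟨⟨?_, ?_⟩, ?_, ?_⟩ <;> nlinarith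

lemma DD_meas : MeasurableSet DD := DD_closed.measurableSet

lemma DD_fin : MeasureTheory.volume DD < ⊤ := DD_compact.measure_lt_top

section
variable {E : Type*} [NormedAddCommGroup E] [NormedSpace ℝ E] [CompleteSpace E]

lemma sec_int (y : ℝ) (k k' : ℝ → E) (hd : ∀ x, x ^ 2 + y ^ 2 ≤ 1 → HasDerivAt k (k' x) x)
    (h0 : ∀ x, x ^ 2 + y ^ 2 = 1 → k x = 0)
    (hc : ContinuousOn k' {x | x ^ 2 + y ^ 2 ≤ 1}) :
    ∫ x, Set.indicator {x : ℝ | x ^ 2 + y ^ 2 ≤ 1} k' x = 0 := by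
  have hm : MeasurableSet {x : ℝ | x ^ 2 + y ^ 2 ≤ 1} :=
    (isClosed_le (by fun_prop) (by fun_prop)).measurableSet
  rw [MeasureTheory.integral_indicator hm]
  by_cases hy : y ^ 2 ≤ 1
  · set c := √(1 - y ^ 2) with hcdef
    have hc0 : 0 ≤ c := Real.sqrt_nonneg _
    have hc2 : c ^ 2 = 1 - y ^ 2 := Real.sq_sqrt (by linarith)
    have hs : {x : ℝ | x ^ 2 + y ^ 2 ≤ 1} = Set.Icc (-c) c := by
      ext x
      simp only [Set.mem_ofPred_eq, Set.mem_Icc, ← abs_le]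
      rw [← abs_of_nonneg hc0, ← sq_le_sq]
      constructor <;> intro h <;> linarith
    rw [hs] at hc ⊢
    have hcc : -c ≤ c := by linarith
    rw [MeasureTheory.integral_Icc_eq_integral_Ioc, ← intervalIntegral.integral_of_le hcc]
    rw [intervalIntegral.integral_eq_sub_of_hasDerivAt (f := k) (f' := k')]
    · rw [h0 c (by linarith), h0 (-c) (by rw [neg_sq]; linarith), sub_zero]
    · intro x hx
      rw [Set.uIcc_of_le hcc, ← hs] at hx
      exact hd x hx
    · apply ContinuousOn.intervalIntegrable
      rwa [Set.uIcc_of_le hcc]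
  · have hs : {x : ℝ | x ^ 2 + y ^ 2 ≤ 1} = ∅ := by
      ext x
      simp only [Set.mem_ofPred_eq, Set.mem_empty_iff_false, iff_false]
      nlinarith [sq_nonneg x]
    rw [hs]; simp

lemma ibp_x (K K' : ℝ → ℝ → E)
    (hd : ∀ x y, x ^ 2 + y ^ 2 ≤ 1 → HasDerivAt (fun x => K x y) (K' x y) x)
    (h0 : ∀ x y, x ^ 2 + y ^ 2 = 1 → K x y = 0)
    (hc : ContinuousOn (fun p : ℝ × ℝ => K' p.1 p.2) DD) :
    ∫ p in DD, K' p.1 p.2 = 0 := by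
  have hi : MeasureTheory.IntegrableOn (fun p : ℝ × ℝ => K' p.1 p.2) DD :=
    hc.integrableOn_compact DD_compact
  rw [← MeasureTheory.integrable_indicator_iff DD_meas] at hi
  rw [← MeasureTheory.integral_indicator DD_meas]
  rw [MeasureTheory.Measure.volume_eq_prod] at hi ⊢
  rw [MeasureTheory.integral_prod_symm _ hi]
  rw [← MeasureTheory.integral_zero ℝ E]
  congr 1; ext y
  refine Eq.trans ?_ (sec_int y (fun x => K x y) (fun x => K' x y) (fun x => hd x y)
    (fun x => h0 x y) (hc.comp (by fun_prop : ContinuousOn (fun x : ℝ => (x, y)) _) (fun x hx => hx)))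
  rfl

lemma ibp_y (K K' : ℝ → ℝ → E)
    (hd : ∀ x y, x ^ 2 + y ^ 2 ≤ 1 → HasDerivAt (fun y => K x y) (K' x y) y)
    (h0 : ∀ x y, x ^ 2 + y ^ 2 = 1 → K x y = 0)
    (hc : ContinuousOn (fun p : ℝ × ℝ => K' p.1 p.2) DD) :
    ∫ p in DD, K' p.1 p.2 = 0 := by
  have h := ibp_x (fun x y => K y x) (fun x y => K' y x) (fun x y h => hd y x (by linarith))
    (fun x y h => h0 y x (by linarith))
    (hc.comp (by fun_prop : ContinuousOn (fun p : ℝ × ℝ => (p.2, p.1)) _)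
      (fun p hp => by simp only [DD, Set.mem_ofPred_eq] at *; linarith))
  rw [← h]
  have hmp : MeasureTheory.MeasurePreserving (Prod.swap : ℝ × ℝ → ℝ × ℝ) := by
    rw [MeasureTheory.Measure.volume_eq_prod]
    exact MeasureTheory.Measure.measurePreserving_swap
  have := hmp.setIntegral_preimage_emb (MeasurableEquiv.prodComm.measurableEmbedding)
    (fun p : ℝ × ℝ => K' p.1 p.2) DD
  rw [← this]
  have hs : (Prod.swap : ℝ × ℝ → ℝ × ℝ) ⁻¹' DD = DD := by
    ext p; simp only [DD, Set.mem_preimage, Set.mem_ofPred_eq, Prod.fst_swap, Prod.snd_swap]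
    rw [add_comm]
  rw [hs]; rfl

/-- time derivative under the disk integral, in integrated form -/
lemma time_fubini (U U' : ℝ → ℝ → ℝ → E) (t0 t1 : ℝ) (h01 : t0 ≤ t1)
    (hd : ∀ t x y, t ∈ Set.Icc t0 t1 → x ^ 2 + y ^ 2 ≤ 1 →
      HasDerivAt (fun t => U t x y) (U' t x y) t)
    (hU : ∀ t ∈ Set.Icc t0 t1, ContinuousOn (fun p : ℝ × ℝ => U t p.1 p.2) DD)
    (hc : ContinuousOn (fun q : ℝ × (ℝ × ℝ) => U' q.1 q.2.1 q.2.2) (Set.Icc t0 t1 ×ˢ DD)) :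
    (∫ p in DD, U t1 p.1 p.2) - (∫ p in DD, U t0 p.1 p.2) =
      ∫ t in t0..t1, ∫ p in DD, U' t p.1 p.2 := by
  rw [← MeasureTheory.integral_sub ((hU t1 ⟨h01, le_rfl⟩).integrableOn_compact DD_compact)
    ((hU t0 ⟨le_rfl, h01⟩).integrableOn_compact DD_compact)]
  have hi : MeasureTheory.IntegrableOn (fun q : ℝ × (ℝ × ℝ) => U' q.1 q.2.1 q.2.2)
      (Set.Icc t0 t1 ×ˢ DD) := hc.integrableOn_compact (isCompact_Icc.prod DD_compact)
  rw [intervalIntegral.integral_of_le h01, ← MeasureTheory.integral_Icc_eq_integral_Ioc]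
  rw [MeasureTheory.integral_integral_swap]
  · apply MeasureTheory.setIntegral_congr_fun DD_meas
    intro p hp
    simp only
    rw [MeasureTheory.integral_Icc_eq_integral_Ioc, ← intervalIntegral.integral_of_le h01]
    rw [intervalIntegral.integral_eq_sub_of_hasDerivAt (f := fun t => U t p.1 p.2)]
    · intro t ht
      rw [Set.uIcc_of_le h01] at ht
      exact hd t p.1 p.2 ht hp
    · apply ContinuousOn.intervalIntegrable
      rw [Set.uIcc_of_le h01]
      exact hc.comp (by fun_prop : ContinuousOn (fun t : ℝ => (t, p)) _) (fun t ht => ⟨ht, hp⟩)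
  · rw [MeasureTheory.Measure.prod_restrict]
    exact hi
end
end

section
open Real

lemma DD_sub_closure : DD ⊆ closure (interior DD) := by
  have hconv : Convex ℝ DD := by
    rintro ⟨x, y⟩ h ⟨x', y'⟩ h' a b ha hb hab
    simp only [DD, Set.mem_ofPred_eq, Prod.smul_mk, Prod.mk_add_mk, smul_eq_mul] at *
    have hb' : b = 1 - a := by linarith
    subst hb'
    have h1 : 0 ≤ a * (1 - a) := mul_nonneg ha hb
    nlinarith [mul_nonneg h1 (sq_nonneg (x - x')), mul_nonneg h1 (sq_nonneg (y - y')),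
      mul_le_mul_of_nonneg_left h ha, mul_le_mul_of_nonneg_left h' hb]
  have hne : (interior DD).Nonempty := by
    refine ⟨(0, 0), mem_interior.2 ⟨{p | p.1 ^ 2 + p.2 ^ 2 < 1}, ?_, ?_, ?_⟩⟩
    · intro p hp; exact (show p.1 ^ 2 + p.2 ^ 2 < 1 from hp).le
    · exact isOpen_lt (by fun_prop) (by fun_prop)
    · simp
  rw [hconv.closure_interior_eq_closure_of_nonempty_interior hne]
  exact subset_closure

lemma DD_eq_zero_of_integral (f : ℝ × ℝ → ℝ) (hc : ContinuousOn f DD) (h0 : ∀ p ∈ DD, 0 ≤ f p)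
    (hi : ∫ p in DD, f p ≤ 0) : ∀ p ∈ DD, f p = 0 := by
  have hInt : MeasureTheory.IntegrableOn f DD := hc.integrableOn_compact DD_compact
  have hnn : 0 ≤ᵐ[MeasureTheory.volume.restrict DD] f := by
    filter_upwards [MeasureTheory.self_mem_ae_restrict DD_meas] with p hp using h0 p hp
  have h00 : ∫ p in DD, f p = 0 :=
    le_antisymm hi (MeasureTheory.setIntegral_nonneg DD_meas h0)
  have := (MeasureTheory.integral_eq_zero_iff_of_nonneg_ae hnn hInt).1 h00
  intro p hp
  exact MeasureTheory.Measure.eqOn_of_ae_eq this hc continuousOn_const DD_sub_closure hp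

/-- smooth solution of the heat equation on the disk, with its jets -/
structure HJ (u ux uy uxx uxy uyy uxxx uxxy uxyy uyyy : ℝ → ℝ → ℝ → ℝ) : Prop where
  c : Continuous fun q : ℝ × (ℝ × ℝ) => u q.1 q.2.1 q.2.2
  cx : Continuous fun q : ℝ × (ℝ × ℝ) => ux q.1 q.2.1 q.2.2
  cy : Continuous fun q : ℝ × (ℝ × ℝ) => uy q.1 q.2.1 q.2.2
  cxx : Continuous fun q : ℝ × (ℝ × ℝ) => uxx q.1 q.2.1 q.2.2
  cxy : Continuous fun q : ℝ × (ℝ × ℝ) => uxy q.1 q.2.1 q.2.2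
  cyy : Continuous fun q : ℝ × (ℝ × ℝ) => uyy q.1 q.2.1 q.2.2
  cxxx : Continuous fun q : ℝ × (ℝ × ℝ) => uxxx q.1 q.2.1 q.2.2
  cxxy : Continuous fun q : ℝ × (ℝ × ℝ) => uxxy q.1 q.2.1 q.2.2
  cxyy : Continuous fun q : ℝ × (ℝ × ℝ) => uxyy q.1 q.2.1 q.2.2
  cyyy : Continuous fun q : ℝ × (ℝ × ℝ) => uyyy q.1 q.2.1 q.2.2
  dx : ∀ t x y, HasDerivAt (fun x => u t x y) (ux t x y) x
  dy : ∀ t x y, HasDerivAt (fun y => u t x y) (uy t x y) y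
  dxx : ∀ t x y, HasDerivAt (fun x => ux t x y) (uxx t x y) x
  dxy : ∀ t x y, HasDerivAt (fun y => ux t x y) (uxy t x y) y
  dyx : ∀ t x y, HasDerivAt (fun x => uy t x y) (uxy t x y) x
  dyy : ∀ t x y, HasDerivAt (fun y => uy t x y) (uyy t x y) y
  dxxx : ∀ t x y, HasDerivAt (fun x => uxx t x y) (uxxx t x y) x
  dxxy : ∀ t x y, HasDerivAt (fun y => uxx t x y) (uxxy t x y) y
  dxyx : ∀ t x y, HasDerivAt (fun x => uxy t x y) (uxxy t x y) x
  dxyy : ∀ t x y, HasDerivAt (fun y => uxy t x y) (uxyy t x y) y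
  dyyx : ∀ t x y, HasDerivAt (fun x => uyy t x y) (uxyy t x y) x
  dyyy : ∀ t x y, HasDerivAt (fun y => uyy t x y) (uyyy t x y) y
  dt : ∀ t x y, HasDerivAt (fun t => u t x y)
    ((1 - x ^ 2 - y ^ 2) * (uxx t x y + uyy t x y) - 2 * (x * ux t x y + y * uy t x y)) t
  dtx : ∀ t x y, HasDerivAt (fun t => ux t x y)
    (-2 * x * (uxx t x y + uyy t x y) + (1 - x ^ 2 - y ^ 2) * (uxxx t x y + uxyy t x y)
      - 2 * (ux t x y + x * uxx t x y + y * uxy t x y)) t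
  dty : ∀ t x y, HasDerivAt (fun t => uy t x y)
    (-2 * y * (uxx t x y + uyy t x y) + (1 - x ^ 2 - y ^ 2) * (uxxy t x y + uyyy t x y)
      - 2 * (x * uxy t x y + uy t x y + y * uyy t x y)) t

lemma hs_x (x y : ℝ) : HasDerivAt (fun x : ℝ => 1 - x ^ 2 - y ^ 2) (-2 * x) x := by
  have := (((hasDerivAt_id x).pow 2).const_sub 1).sub_const (y ^ 2)
  simpa using this

lemma hs_y (x y : ℝ) : HasDerivAt (fun y : ℝ => 1 - x ^ 2 - y ^ 2) (-2 * y) y := by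
  have := (((hasDerivAt_id y).pow 2).const_sub (1 - x ^ 2))
  simpa using this

section
variable {u ux uy uxx uxy uyy uxxx uxxy uxyy uyyy : ℝ → ℝ → ℝ → ℝ}

lemma beta_lemma (h : HJ u ux uy uxx uxy uyy uxxx uxxy uxyy uyyy) (t0 t1 : ℝ) (h01 : t0 ≤ t1)
    (I : Set ℝ) (b b' b'' : ℝ → ℝ)
    (hI : ∀ t x y, t ∈ Set.Icc t0 t1 → x ^ 2 + y ^ 2 ≤ 1 → u t x y ∈ I)
    (hb : ∀ v ∈ I, HasDerivAt b (b' v) v) (hb' : ∀ v ∈ I, HasDerivAt b' (b'' v) v)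
    (hb'' : ContinuousOn b'' I) :
    (∫ p in DD, b (u t1 p.1 p.2)) - (∫ p in DD, b (u t0 p.1 p.2)) =
      - ∫ t in t0..t1, ∫ p in DD, b'' (u t p.1 p.2) * ((1 - p.1 ^ 2 - p.2 ^ 2) *
        (ux t p.1 p.2 ^ 2 + uy t p.1 p.2 ^ 2)) := by
  have hbc : ContinuousOn b I := fun v hv => (hb v hv).continuousAt.continuousWithinAt
  have hbc' : ContinuousOn b' I := fun v hv => (hb' v hv).continuousAt.continuousWithinAt
  have hcu := h.c
  have hcx := h.cx
  have hcy := h.cy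
  have hcxx := h.cxx
  have hcyy := h.cyy
  have key : ∀ g : ℝ → ℝ, ContinuousOn g I → ContinuousOn
      (fun q : ℝ × (ℝ × ℝ) => g (u q.1 q.2.1 q.2.2)) (Set.Icc t0 t1 ×ˢ DD) := fun g hg =>
    hg.comp hcu.continuousOn (fun q hq => hI q.1 q.2.1 q.2.2 hq.1 hq.2)
  have key2 : ∀ g : ℝ → ℝ, ContinuousOn g I → ∀ t ∈ Set.Icc t0 t1, ContinuousOn
      (fun q : ℝ × ℝ => g (u t q.1 q.2)) DD := fun g hg t ht =>
    hg.comp (by fun_prop) (fun q hq => hI t q.1 q.2 ht hq)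
  rw [time_fubini (fun t x y => b (u t x y)) (fun t x y => b' (u t x y) *
    ((1 - x ^ 2 - y ^ 2) * (uxx t x y + uyy t x y) - 2 * (x * ux t x y + y * uy t x y))) t0 t1 h01]
  · rw [← intervalIntegral.integral_neg]
    apply intervalIntegral.integral_congr
    intro t ht
    rw [Set.uIcc_of_le h01] at ht
    simp only
    have c0 := key2 b' hbc' t ht
    have c1 := key2 b'' hb'' t ht
    have cc1 : ∀ B C : ℝ × ℝ → ℝ, ContinuousOn B DD → ContinuousOn C DD → ContinuousOn
        (fun p : ℝ × ℝ => (-2 * p.1 * ux t p.1 p.2 + (1 - p.1 ^ 2 - p.2 ^ 2) * uxx t p.1 p.2) * B p +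
        (1 - p.1 ^ 2 - p.2 ^ 2) * ux t p.1 p.2 * (C p * ux t p.1 p.2)) DD := by
      intro B C hB hC; fun_prop
    have cc2 : ∀ B C : ℝ × ℝ → ℝ, ContinuousOn B DD → ContinuousOn C DD → ContinuousOn
        (fun p : ℝ × ℝ => (-2 * p.2 * uy t p.1 p.2 + (1 - p.1 ^ 2 - p.2 ^ 2) * uyy t p.1 p.2) * B p +
        (1 - p.1 ^ 2 - p.2 ^ 2) * uy t p.1 p.2 * (C p * uy t p.1 p.2)) DD := by
      intro B C hB hC; fun_prop
    have cc3 : ∀ B : ℝ × ℝ → ℝ, ContinuousOn B DD → ContinuousOn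
        (fun p : ℝ × ℝ => B p * ((1 - p.1 ^ 2 - p.2 ^ 2) * (uxx t p.1 p.2 + uyy t p.1 p.2) -
          2 * (p.1 * ux t p.1 p.2 + p.2 * uy t p.1 p.2))) DD := by
      intro B hB; fun_prop
    have cc4 : ∀ B : ℝ × ℝ → ℝ, ContinuousOn B DD → ContinuousOn
        (fun p : ℝ × ℝ => B p * ((1 - p.1 ^ 2 - p.2 ^ 2) *
          (ux t p.1 p.2 ^ 2 + uy t p.1 p.2 ^ 2))) DD := by
      intro B hB; fun_prop
    have e1 := ibp_x (fun x y => (1 - x ^ 2 - y ^ 2) * ux t x y * b' (u t x y))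
      (fun x y => (-2 * x * ux t x y + (1 - x ^ 2 - y ^ 2) * uxx t x y) * b' (u t x y) +
        (1 - x ^ 2 - y ^ 2) * ux t x y * (b'' (u t x y) * ux t x y))
      (fun x y hxy => (((hs_x x y).mul (h.dxx t x y)).mul
        ((hb' _ (hI t x y ht hxy)).comp x (h.dx t x y))))
      (fun x y hxy => by
        have : 1 - x ^ 2 - y ^ 2 = 0 := by linarith
        simp [this]) (cc1 _ _ c0 c1)
    have e2 := ibp_y (fun x y => (1 - x ^ 2 - y ^ 2) * uy t x y * b' (u t x y))
      (fun x y => (-2 * y * uy t x y + (1 - x ^ 2 - y ^ 2) * uyy t x y) * b' (u t x y) +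
        (1 - x ^ 2 - y ^ 2) * uy t x y * (b'' (u t x y) * uy t x y))
      (fun x y hxy => (((hs_y x y).mul (h.dyy t x y)).mul
        ((hb' _ (hI t x y ht hxy)).comp y (h.dy t x y))))
      (fun x y hxy => by
        have : 1 - x ^ 2 - y ^ 2 = 0 := by linarith
        simp [this]) (cc2 _ _ c0 c1)
    rw [eq_neg_iff_add_eq_zero, ← MeasureTheory.integral_add]
    · rw [← add_zero (0 : ℝ)]
      nth_rewrite 1 [← e1]
      rw [← e2, ← MeasureTheory.integral_add]
      · congr 1; ext p; ring
      · exact (cc1 _ _ c0 c1).integrableOn_compact DD_compact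
      · exact (cc2 _ _ c0 c1).integrableOn_compact DD_compact
    · exact (cc3 _ c0).integrableOn_compact DD_compact
    · exact (cc4 _ c1).integrableOn_compact DD_compact
  · intro t x y ht hxy
    exact (hb _ (hI t x y ht hxy)).comp t (h.dt t x y)
  · exact fun t ht => key2 b hbc t ht
  · have cc : ∀ B : ℝ × (ℝ × ℝ) → ℝ, ContinuousOn B (Set.Icc t0 t1 ×ˢ DD) → ContinuousOn
        (fun q : ℝ × (ℝ × ℝ) => B q * ((1 - q.2.1 ^ 2 - q.2.2 ^ 2) *
          (uxx q.1 q.2.1 q.2.2 + uyy q.1 q.2.1 q.2.2) -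
          2 * (q.2.1 * ux q.1 q.2.1 q.2.2 + q.2.2 * uy q.1 q.2.1 q.2.2))) (Set.Icc t0 t1 ×ˢ DD) := by
      intro B hB; fun_prop
    exact cc _ (key b' hbc')

lemma hasDerivAt_negpart_pow (v : ℝ) :
    HasDerivAt (fun v : ℝ => (max (-v) 0) ^ 3) (-3 * (max (-v) 0) ^ 2) v ∧
    HasDerivAt (fun v : ℝ => -3 * (max (-v) 0) ^ 2) (6 * max (-v) 0) v := by
  have aux : ∀ n : ℕ, HasDerivAt (fun v : ℝ => (max (-v) 0) ^ (n + 2))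
      (-(n + 2) * (max (-v) 0) ^ (n + 1)) v := by
    intro n
    rcases lt_trichotomy v 0 with hv | hv | hv
    · have h1 : HasDerivAt (fun v : ℝ => (-v) ^ (n + 2)) (-(n + 2) * (-v) ^ (n + 1)) v := by
        have := (hasDerivAt_id v).neg.pow (n + 2)
        refine this.congr_deriv ?_
        push_cast; simp; ring
      rw [max_eq_left (by linarith)]
      apply h1.congr_of_eventuallyEq
      filter_upwards [Iio_mem_nhds hv] with x hx
      rw [max_eq_left (by linarith [Set.mem_Iio.1 hx])]
    · subst hv
      simp only [neg_zero, max_self, ne_eq, Nat.add_eq_zero_iff, one_ne_zero, and_false,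
        not_false_eq_true, zero_pow, mul_zero]
      rw [hasDerivAt_iff_isLittleO_nhds_zero]
      simp only [zero_add, neg_zero, max_self, ne_eq, Nat.add_eq_zero_iff, OfNat.ofNat_ne_zero, and_false,
        not_false_eq_true, zero_pow, sub_zero, smul_zero]
      have h2 : (fun h : ℝ => h ^ (n + 2)) =o[nhds 0] fun h => h := by
        have := Asymptotics.isLittleO_pow_pow (𝕜 := ℝ) (m := 1) (n := n + 2) (by omega)
        simpa using this
      apply Asymptotics.IsBigO.trans_isLittleO _ h2
      apply Asymptotics.IsBigO.of_bound 1
      filter_upwards with x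
      rw [norm_pow, norm_pow, one_mul]
      gcongr
      rw [Real.norm_eq_abs, Real.norm_eq_abs, abs_of_nonneg (le_max_right _ _)]
      exact max_le (neg_le_abs x) (abs_nonneg x)
    · rw [max_eq_right (by linarith)]
      simp only [ne_eq, Nat.add_eq_zero_iff, one_ne_zero, and_false,
        not_false_eq_true, zero_pow, mul_zero]
      apply (hasDerivAt_const v (0 : ℝ)).congr_of_eventuallyEq
      filter_upwards [Ioi_mem_nhds hv] with x hx
      rw [max_eq_right (by linarith [Set.mem_Ioi.1 hx])]
      simp
  constructor
  · convert aux 1 using 1; norm_num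
  · exact ((aux 0).const_mul (-3)).congr_deriv (by norm_num; ring)

lemma nonneg_pres (h : HJ u ux uy uxx uxy uyy uxxx uxxy uxyy uyyy) (t0 t1 : ℝ) (h01 : t0 ≤ t1)
    (h0 : ∀ x y, x ^ 2 + y ^ 2 ≤ 1 → 0 ≤ u t0 x y) :
    ∀ x y, x ^ 2 + y ^ 2 ≤ 1 → 0 ≤ u t1 x y := by
  have hb := beta_lemma h t0 t1 h01 Set.univ (fun v => (max (-v) 0) ^ 3)
    (fun v => -3 * (max (-v) 0) ^ 2) (fun v => 6 * max (-v) 0) (fun _ _ _ _ _ => trivial)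
    (fun v _ => (hasDerivAt_negpart_pow v).1) (fun v _ => (hasDerivAt_negpart_pow v).2)
    (by fun_prop)
  have hz : ∫ p in DD, (max (-(u t0 p.1 p.2)) 0) ^ 3 = 0 := by
    apply MeasureTheory.setIntegral_eq_zero_of_forall_eq_zero
    intro p hp
    rw [max_eq_right (by linarith [h0 p.1 p.2 hp])]; simp
  have hp : 0 ≤ ∫ t in t0..t1, ∫ p in DD, 6 * max (-(u t p.1 p.2)) 0 *
      ((1 - p.1 ^ 2 - p.2 ^ 2) * (ux t p.1 p.2 ^ 2 + uy t p.1 p.2 ^ 2)) := by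
    apply intervalIntegral.integral_nonneg h01
    intro t _
    apply MeasureTheory.setIntegral_nonneg DD_meas
    intro p hp
    have : 0 ≤ 1 - p.1 ^ 2 - p.2 ^ 2 := by
      have : p.1 ^ 2 + p.2 ^ 2 ≤ 1 := hp
      linarith
    have h2 : 0 ≤ max (-(u t p.1 p.2)) 0 := le_max_right _ _
    positivity
  have hcu := h.c
  have := DD_eq_zero_of_integral (fun p => (max (-(u t1 p.1 p.2)) 0) ^ 3)
    (by fun_prop) (fun p _ => by
      have h2 : 0 ≤ max (-(u t1 p.1 p.2)) 0 := le_max_right _ _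
      positivity) (by rw [hz] at hb; linarith)
  intro x y hxy
  have h3 := this (x, y) hxy
  simp only [ne_eq, OfNat.ofNat_ne_zero, not_false_eq_true, pow_eq_zero_iff, max_eq_right_iff] at h3
  linarith

lemma entropy_id (h : HJ u ux uy uxx uxy uyy uxxx uxxy uxyy uyyy) (t0 t1 : ℝ) (h01 : t0 ≤ t1)
    (hpos : ∀ t x y, t ∈ Set.Icc t0 t1 → x ^ 2 + y ^ 2 ≤ 1 → 0 < u t x y) :
    (∫ p in DD, u t1 p.1 p.2 * Real.log (u t1 p.1 p.2)) -
      (∫ p in DD, u t0 p.1 p.2 * Real.log (u t0 p.1 p.2)) =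
      - ∫ t in t0..t1, ∫ p in DD, (1 - p.1 ^ 2 - p.2 ^ 2) *
        (ux t p.1 p.2 ^ 2 + uy t p.1 p.2 ^ 2) / u t p.1 p.2 := by
  rw [beta_lemma h t0 t1 h01 (Set.Ioi 0) (fun v => v * Real.log v) (fun v => Real.log v + 1)
    (fun v => v⁻¹) hpos]
  · congr 2; ext t; congr 1; ext p; ring
  · intro v hv
    exact Real.hasDerivAt_mul_log (ne_of_gt hv)
  · intro v hv
    exact (Real.hasDerivAt_log (ne_of_gt hv)).add_const 1
  · exact continuousOn_inv₀.mono (fun v hv => ne_of_gt hv)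
end
end

section
open Real

section
variable {u ux uy uxx uxy uyy uxxx uxxy uxyy uyyy : ℝ → ℝ → ℝ → ℝ}

/-- `x`-derivative of `s ∂ₓ H` -/
noncomputable def kxf (x y w ux uy uxx uxy uxxx uxxy : ℝ) : ℝ :=
  -2 * x * (-2 * x * (ux ^ 2 + uy ^ 2) * w
    + 2 * (1 - x ^ 2 - y ^ 2) * (ux * uxx + uy * uxy) * w
    - (1 - x ^ 2 - y ^ 2) * (ux ^ 2 + uy ^ 2) * ux * w ^ 2) +
  (1 - x ^ 2 - y ^ 2) * (-2 * (ux ^ 2 + uy ^ 2) * w - 4 * x * (ux * uxx + uy * uxy) * w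
    + 2 * x * (ux ^ 2 + uy ^ 2) * ux * w ^ 2 - 4 * x * (ux * uxx + uy * uxy) * w
    + 2 * (1 - x ^ 2 - y ^ 2) * (uxx ^ 2 + ux * uxxx + uxy ^ 2 + uy * uxxy) * w
    - 2 * (1 - x ^ 2 - y ^ 2) * (ux * uxx + uy * uxy) * ux * w ^ 2
    + 2 * x * (ux ^ 2 + uy ^ 2) * ux * w ^ 2
    - 2 * (1 - x ^ 2 - y ^ 2) * (ux * uxx + uy * uxy) * ux * w ^ 2
    - (1 - x ^ 2 - y ^ 2) * (ux ^ 2 + uy ^ 2) * uxx * w ^ 2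
    + 2 * (1 - x ^ 2 - y ^ 2) * (ux ^ 2 + uy ^ 2) * ux ^ 2 * w ^ 3)

/-- the nonnegative remainder -/
noncomputable def rrf (x y w ux uy uxx uxy uyy : ℝ) : ℝ :=
  16 * w * (((1 - x ^ 2 - y ^ 2) * ((uxx - uyy) - (ux ^ 2 - uy ^ 2) * w) / 4 - (x * ux - y * uy) / 2) ^ 2
    + ((1 - x ^ 2 - y ^ 2) * (uxy - ux * uy * w) / 2 - (x * uy + y * ux) / 2) ^ 2
    + (1 - x ^ 2 - y ^ 2) ^ 2 * (uxx + uyy - (ux ^ 2 + uy ^ 2) * w) ^ 2 / 16)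

lemma rrf_nonneg (x y w ux uy uxx uxy uyy : ℝ) (hw : 0 ≤ w) : 0 ≤ rrf x y w ux uy uxx uxy uyy := by
  unfold rrf; positivity

noncomputable def htf (x y w ux uy uxx uxy uyy uxxx uxxy uxyy uyyy : ℝ) : ℝ :=
  (1 - x ^ 2 - y ^ 2) * (2 * ux * (-2 * x * (uxx + uyy) + (1 - x ^ 2 - y ^ 2) * (uxxx + uxyy)
      - 2 * (ux + x * uxx + y * uxy)) +
    2 * uy * (-2 * y * (uxx + uyy) + (1 - x ^ 2 - y ^ 2) * (uxxy + uyyy)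
      - 2 * (x * uxy + uy + y * uyy))) * w
  - (1 - x ^ 2 - y ^ 2) * (ux ^ 2 + uy ^ 2) * w ^ 2 *
    ((1 - x ^ 2 - y ^ 2) * (uxx + uyy) - 2 * (x * ux + y * uy))

lemma htf_eq (x y w ux uy uxx uxy uyy uxxx uxxy uxyy uyyy : ℝ) :
    htf x y w ux uy uxx uxy uyy uxxx uxxy uxyy uyyy =
      kxf x y w ux uy uxx uxy uxxx uxxy + kxf y x w uy ux uyy uxy uyyy uxyy
      - rrf x y w ux uy uxx uxy uyy := by
  unfold htf kxf rrf; ring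

lemma fisher_anti (h : HJ u ux uy uxx uxy uyy uxxx uxxy uxyy uyyy) (t0 t1 : ℝ) (h01 : t0 ≤ t1)
    (hpos : ∀ t x y, t ∈ Set.Icc t0 t1 → x ^ 2 + y ^ 2 ≤ 1 → 0 < u t x y) :
    (∫ p in DD, (1 - p.1 ^ 2 - p.2 ^ 2) * (ux t1 p.1 p.2 ^ 2 + uy t1 p.1 p.2 ^ 2) / u t1 p.1 p.2) ≤
    (∫ p in DD, (1 - p.1 ^ 2 - p.2 ^ 2) * (ux t0 p.1 p.2 ^ 2 + uy t0 p.1 p.2 ^ 2) / u t0 p.1 p.2) := by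
  have hcu := h.c
  have hcx := h.cx
  have hcy := h.cy
  have hcxx := h.cxx
  have hcxy := h.cxy
  have hcyy := h.cyy
  have hcxxx := h.cxxx
  have hcxxy := h.cxxy
  have hcxyy := h.cxyy
  have hcyyy := h.cyyy
  have key : ContinuousOn (fun q : ℝ × (ℝ × ℝ) => (u q.1 q.2.1 q.2.2)⁻¹) (Set.Icc t0 t1 ×ˢ DD) :=
    hcu.continuousOn.inv₀ (fun q hq => (hpos q.1 q.2.1 q.2.2 hq.1 hq.2).ne')
  have key2 : ∀ t ∈ Set.Icc t0 t1, ContinuousOn (fun q : ℝ × ℝ => (u t q.1 q.2)⁻¹) DD :=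
    fun t ht => key.comp (by fun_prop : ContinuousOn (fun q : ℝ × ℝ => (t, q)) DD)
      (fun q hq => ⟨ht, hq⟩)
  rw [← sub_nonpos]
  simp only [div_eq_mul_inv]
  rw [time_fubini (fun t x y => (1 - x ^ 2 - y ^ 2) * (ux t x y ^ 2 + uy t x y ^ 2) * (u t x y)⁻¹)
    (fun t x y => htf x y (u t x y)⁻¹ (ux t x y) (uy t x y) (uxx t x y) (uxy t x y) (uyy t x y)
      (uxxx t x y) (uxxy t x y) (uxyy t x y) (uyyy t x y)) t0 t1 h01]
  · rw [intervalIntegral.integral_of_le h01]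
    apply MeasureTheory.setIntegral_nonpos measurableSet_Ioc
    intro t ht'
    have ht : t ∈ Set.Icc t0 t1 := ⟨ht'.1.le, ht'.2⟩
    have c0 := key2 t ht
    have cc1 : ∀ W : ℝ × ℝ → ℝ, ContinuousOn W DD → ContinuousOn (fun p : ℝ × ℝ =>
        kxf p.1 p.2 (W p) (ux t p.1 p.2) (uy t p.1 p.2) (uxx t p.1 p.2) (uxy t p.1 p.2)
          (uxxx t p.1 p.2) (uxxy t p.1 p.2)) DD := by
      intro W hW; unfold kxf; fun_prop
    have cc2 : ∀ W : ℝ × ℝ → ℝ, ContinuousOn W DD → ContinuousOn (fun p : ℝ × ℝ =>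
        kxf p.2 p.1 (W p) (uy t p.1 p.2) (ux t p.1 p.2) (uyy t p.1 p.2) (uxy t p.1 p.2)
          (uyyy t p.1 p.2) (uxyy t p.1 p.2)) DD := by
      intro W hW; unfold kxf; fun_prop
    have cc3 : ∀ W : ℝ × ℝ → ℝ, ContinuousOn W DD → ContinuousOn (fun p : ℝ × ℝ =>
        rrf p.1 p.2 (W p) (ux t p.1 p.2) (uy t p.1 p.2) (uxx t p.1 p.2) (uxy t p.1 p.2)
          (uyy t p.1 p.2)) DD := by
      intro W hW; unfold rrf; fun_prop
    have e1 := ibp_x (fun x y => (1 - x ^ 2 - y ^ 2) *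
        (-2 * x * (ux t x y ^ 2 + uy t x y ^ 2) * (u t x y)⁻¹
        + 2 * (1 - x ^ 2 - y ^ 2) * (ux t x y * uxx t x y + uy t x y * uxy t x y) * (u t x y)⁻¹
        - (1 - x ^ 2 - y ^ 2) * (ux t x y ^ 2 + uy t x y ^ 2) * ux t x y * (u t x y)⁻¹ ^ 2))
      (fun x y => kxf x y (u t x y)⁻¹ (ux t x y) (uy t x y) (uxx t x y) (uxy t x y)
          (uxxx t x y) (uxxy t x y))
      (fun x y hxy => by
        have hne := (hpos t x y ht hxy).ne'
        have hN := ((h.dxx t x y).pow 2).add ((h.dyx t x y).pow 2)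
        have hM := ((h.dxx t x y).mul (h.dxxx t x y)).add ((h.dyx t x y).mul (h.dxyx t x y))
        have hW := (h.dx t x y).inv hne
        have hs := hs_x x y
        refine (hs.mul ((((((hasDerivAt_id x).const_mul (-2)).mul hN).mul hW).add
          (((hs.const_mul 2).mul hM).mul hW)).sub
          (((hs.mul hN).mul (h.dxx t x y)).mul (hW.pow 2)))).congr_deriv ?_
        simp only [kxf, Pi.add_apply, Pi.mul_apply, Pi.pow_apply, Pi.inv_apply, Pi.sub_apply,
          Pi.smul_apply, id, Nat.cast_ofNat, smul_eq_mul, div_eq_mul_inv, inv_pow]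
        ring)
      (fun x y hxy => by
        have : 1 - x ^ 2 - y ^ 2 = 0 := by linarith
        simp [this]) (cc1 _ c0)
    have e2 := ibp_y (fun x y => (1 - x ^ 2 - y ^ 2) *
        (-2 * y * (ux t x y ^ 2 + uy t x y ^ 2) * (u t x y)⁻¹
        + 2 * (1 - x ^ 2 - y ^ 2) * (ux t x y * uxy t x y + uy t x y * uyy t x y) * (u t x y)⁻¹
        - (1 - x ^ 2 - y ^ 2) * (ux t x y ^ 2 + uy t x y ^ 2) * uy t x y * (u t x y)⁻¹ ^ 2))
      (fun x y => kxf y x (u t x y)⁻¹ (uy t x y) (ux t x y) (uyy t x y) (uxy t x y)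
          (uyyy t x y) (uxyy t x y))
      (fun x y hxy => by
        have hne := (hpos t x y ht hxy).ne'
        have hN := ((h.dxy t x y).pow 2).add ((h.dyy t x y).pow 2)
        have hM := ((h.dxy t x y).mul (h.dxyy t x y)).add ((h.dyy t x y).mul (h.dyyy t x y))
        have hW := (h.dy t x y).inv hne
        have hs := hs_y x y
        refine (hs.mul ((((((hasDerivAt_id y).const_mul (-2)).mul hN).mul hW).add
          (((hs.const_mul 2).mul hM).mul hW)).sub
          (((hs.mul hN).mul (h.dyy t x y)).mul (hW.pow 2)))).congr_deriv ?_
        simp only [kxf, Pi.add_apply, Pi.mul_apply, Pi.pow_apply, Pi.inv_apply, Pi.sub_apply,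
          Pi.smul_apply, id, Nat.cast_ofNat, smul_eq_mul, div_eq_mul_inv, inv_pow]
        ring)
      (fun x y hxy => by
        have : 1 - x ^ 2 - y ^ 2 = 0 := by linarith
        simp [this]) (cc2 _ c0)
    simp only [htf_eq]
    rw [MeasureTheory.integral_sub, MeasureTheory.integral_add, e1, e2]
    · have : 0 ≤ ∫ p in DD, rrf p.1 p.2 (u t p.1 p.2)⁻¹ (ux t p.1 p.2) (uy t p.1 p.2)
          (uxx t p.1 p.2) (uxy t p.1 p.2) (uyy t p.1 p.2) := by
        apply MeasureTheory.setIntegral_nonneg DD_meas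
        intro p hp
        exact rrf_nonneg _ _ _ _ _ _ _ _ (inv_nonneg.2 (hpos t p.1 p.2 ht hp).le)
      linarith
    · exact (cc1 _ c0).integrableOn_compact DD_compact
    · exact (cc2 _ c0).integrableOn_compact DD_compact
    · exact ((cc1 _ c0).add (cc2 _ c0)).integrableOn_compact DD_compact
    · exact (cc3 _ c0).integrableOn_compact DD_compact
  · intro t x y ht hxy
    have hne := (hpos t x y ht hxy).ne'
    have hN := ((h.dtx t x y).pow 2).add ((h.dty t x y).pow 2)
    have hW := (h.dt t x y).inv hne
    refine ((hN.const_mul (1 - x ^ 2 - y ^ 2)).mul hW).congr_deriv ?_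
    simp only [htf, Pi.add_apply, Pi.mul_apply, Pi.pow_apply, Pi.inv_apply, Pi.sub_apply,
      Pi.smul_apply, id, Nat.cast_ofNat, smul_eq_mul, div_eq_mul_inv, inv_pow]
    ring
  · intro t ht
    have cc : ∀ W : ℝ × ℝ → ℝ, ContinuousOn W DD → ContinuousOn (fun p : ℝ × ℝ =>
        (1 - p.1 ^ 2 - p.2 ^ 2) * (ux t p.1 p.2 ^ 2 + uy t p.1 p.2 ^ 2) * W p) DD := by
      intro W hW; fun_prop
    exact cc _ (key2 t ht)
  · have cc : ∀ W : ℝ × (ℝ × ℝ) → ℝ, ContinuousOn W (Set.Icc t0 t1 ×ˢ DD) → ContinuousOn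
        (fun q : ℝ × (ℝ × ℝ) => htf q.2.1 q.2.2 (W q) (ux q.1 q.2.1 q.2.2) (uy q.1 q.2.1 q.2.2)
        (uxx q.1 q.2.1 q.2.2) (uxy q.1 q.2.1 q.2.2) (uyy q.1 q.2.1 q.2.2)
      (uxxx q.1 q.2.1 q.2.2) (uxxy q.1 q.2.1 q.2.2) (uxyy q.1 q.2.1 q.2.2) (uyyy q.1 q.2.1 q.2.2))
        (Set.Icc t0 t1 ×ˢ DD) := by
      intro W hW; unfold htf; fun_prop
    exact cc _ key
end
end

section
open Real

section
variable {u ux uy uxx uxy uyy uxxx uxxy uxyy uyyy : ℝ → ℝ → ℝ → ℝ}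

lemma entropy_sandwich (h : HJ u ux uy uxx uxy uyy uxxx uxxy uxyy uyyy) (t0 t1 : ℝ) (h01 : t0 ≤ t1)
    (hpos : ∀ t x y, t ∈ Set.Icc t0 t1 → x ^ 2 + y ^ 2 ≤ 1 → 0 < u t x y) :
    (t1 - t0) * (∫ p in DD, (1 - p.1 ^ 2 - p.2 ^ 2) *
        (ux t1 p.1 p.2 ^ 2 + uy t1 p.1 p.2 ^ 2) / u t1 p.1 p.2) ≤
      (∫ p in DD, u t0 p.1 p.2 * Real.log (u t0 p.1 p.2)) -
        (∫ p in DD, u t1 p.1 p.2 * Real.log (u t1 p.1 p.2)) ∧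
    (∫ p in DD, u t0 p.1 p.2 * Real.log (u t0 p.1 p.2)) -
        (∫ p in DD, u t1 p.1 p.2 * Real.log (u t1 p.1 p.2)) ≤
    (t1 - t0) * (∫ p in DD, (1 - p.1 ^ 2 - p.2 ^ 2) *
        (ux t0 p.1 p.2 ^ 2 + uy t0 p.1 p.2 ^ 2) / u t0 p.1 p.2) := by
  have hid := entropy_id h t0 t1 h01 hpos
  set F : ℝ → ℝ := fun t => ∫ p in DD, (1 - p.1 ^ 2 - p.2 ^ 2) *
        (ux t p.1 p.2 ^ 2 + uy t p.1 p.2 ^ 2) / u t p.1 p.2 with hF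
  have hanti : AntitoneOn F (Set.Icc t0 t1) := by
    intro a ha b hb hab
    exact fisher_anti h a b hab (fun t x y ht hxy => hpos t x y ⟨ha.1.trans ht.1, ht.2.trans hb.2⟩ hxy)
  have hii : IntervalIntegrable F MeasureTheory.volume t0 t1 := by
    apply AntitoneOn.intervalIntegrable
    rwa [Set.uIcc_of_le h01]
  have h1 : ∫ t in t0..t1, F t1 ≤ ∫ t in t0..t1, F t := by
    apply intervalIntegral.integral_mono_on h01 (by simp) hii
    intro t ht
    exact hanti ht ⟨h01, le_rfl⟩ ht.2
  have h2 : ∫ t in t0..t1, F t ≤ ∫ t in t0..t1, F t0 := by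
    apply intervalIntegral.integral_mono_on h01 hii (by simp)
    intro t ht
    exact hanti ⟨le_rfl, h01⟩ ht ht.1
  simp only [intervalIntegral.integral_const, smul_eq_mul] at h1 h2
  have e0 : F t0 = ∫ p in DD, (1 - p.1 ^ 2 - p.2 ^ 2) *
        (ux t0 p.1 p.2 ^ 2 + uy t0 p.1 p.2 ^ 2) / u t0 p.1 p.2 := rfl
  have e1 : F t1 = ∫ p in DD, (1 - p.1 ^ 2 - p.2 ^ 2) *
        (ux t1 p.1 p.2 ^ 2 + uy t1 p.1 p.2 ^ 2) / u t1 p.1 p.2 := rfl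
  rw [← e0, ← e1]
  constructor <;> linarith
end

/-- existence of jets -/
def HJ' (u ux uy : ℝ → ℝ → ℝ → ℝ) : Prop :=
  ∃ uxx uxy uyy uxxx uxxy uxyy uyyy, HJ u ux uy uxx uxy uyy uxxx uxxy uxyy uyyy

lemma HJ'_const (c : ℝ) : HJ' (fun _ _ _ => c) (fun _ _ _ => 0) (fun _ _ _ => 0) := by
  refine ⟨fun _ _ _ => 0, fun _ _ _ => 0, fun _ _ _ => 0, fun _ _ _ => 0, fun _ _ _ => 0,
    fun _ _ _ => 0, fun _ _ _ => 0, ?_⟩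
  constructor
  all_goals first
    | fun_prop
    | (intro t x y
       refine (hasDerivAt_const _ _).congr_deriv ?_
       ring)

lemma HJ'_add {u ux uy v vx vy : ℝ → ℝ → ℝ → ℝ} (h : HJ' u ux uy) (h' : HJ' v vx vy) :
    HJ' (fun t x y => u t x y + v t x y) (fun t x y => ux t x y + vx t x y)
      (fun t x y => uy t x y + vy t x y) := by
  obtain ⟨uxx, uxy, uyy, uxxx, uxxy, uxyy, uyyy, H⟩ := h
  obtain ⟨vxx, vxy, vyy, vxxx, vxxy, vxyy, vyyy, G⟩ := h'
  refine ⟨fun t x y => uxx t x y + vxx t x y, fun t x y => uxy t x y + vxy t x y,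
    fun t x y => uyy t x y + vyy t x y, fun t x y => uxxx t x y + vxxx t x y,
    fun t x y => uxxy t x y + vxxy t x y, fun t x y => uxyy t x y + vxyy t x y,
    fun t x y => uyyy t x y + vyyy t x y, ?_⟩
  exact
  { c := H.c.add G.c, cx := H.cx.add G.cx, cy := H.cy.add G.cy, cxx := H.cxx.add G.cxx
    cxy := H.cxy.add G.cxy, cyy := H.cyy.add G.cyy, cxxx := H.cxxx.add G.cxxx
    cxxy := H.cxxy.add G.cxxy, cxyy := H.cxyy.add G.cxyy, cyyy := H.cyyy.add G.cyyy
    dx := fun t x y => (H.dx t x y).add (G.dx t x y)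
    dy := fun t x y => (H.dy t x y).add (G.dy t x y)
    dxx := fun t x y => (H.dxx t x y).add (G.dxx t x y)
    dxy := fun t x y => (H.dxy t x y).add (G.dxy t x y)
    dyx := fun t x y => (H.dyx t x y).add (G.dyx t x y)
    dyy := fun t x y => (H.dyy t x y).add (G.dyy t x y)
    dxxx := fun t x y => (H.dxxx t x y).add (G.dxxx t x y)
    dxxy := fun t x y => (H.dxxy t x y).add (G.dxxy t x y)
    dxyx := fun t x y => (H.dxyx t x y).add (G.dxyx t x y)
    dxyy := fun t x y => (H.dxyy t x y).add (G.dxyy t x y)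
    dyyx := fun t x y => (H.dyyx t x y).add (G.dyyx t x y)
    dyyy := fun t x y => (H.dyyy t x y).add (G.dyyy t x y)
    dt := fun t x y => ((H.dt t x y).add (G.dt t x y)).congr_deriv (by ring)
    dtx := fun t x y => ((H.dtx t x y).add (G.dtx t x y)).congr_deriv (by ring)
    dty := fun t x y => ((H.dty t x y).add (G.dty t x y)).congr_deriv (by ring) }

lemma HJ'_sum {ι : Type*} (S : Finset ι) (u ux uy : ι → ℝ → ℝ → ℝ → ℝ)
    (h : ∀ i, HJ' (u i) (ux i) (uy i)) :
    HJ' (fun t x y => ∑ i ∈ S, u i t x y) (fun t x y => ∑ i ∈ S, ux i t x y)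
      (fun t x y => ∑ i ∈ S, uy i t x y) := by
  classical
  induction S using Finset.induction_on with
  | empty => simpa using HJ'_const 0
  | insert i S hi ih =>
    simp only [Finset.sum_insert hi]
    exact HJ'_add (h i) ih

/-- `gc` on the disk -/
noncomputable def gd (k A B : ℕ) (x y : ℝ) : ℂ := gc (x + y * Complex.I) (x - y * Complex.I) k A B

lemma gd_x (k A B : ℕ) (x y : ℝ) : HasDerivAt (fun x => gd k A B x y)
    (k * (gd (k + 1) (A - 1) B x y + gd (k + 1) A (B - 1) x y)) x := by
  have h1 : HasDerivAt (fun x : ℝ => (x : ℂ) + y * Complex.I) 1 x :=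
    Complex.ofRealCLM.hasDerivAt.add_const _
  have h2 : HasDerivAt (fun x : ℝ => (x : ℂ) - y * Complex.I) 1 x :=
    Complex.ofRealCLM.hasDerivAt.sub_const _
  have := gc_deriv (fun x : ℝ => (x : ℂ) + y * Complex.I) (fun x : ℝ => (x : ℂ) - y * Complex.I)
    1 1 x h1 h2 k A B
  refine this.congr_deriv ?_
  simp only [gd]; ring

lemma gd_y (k A B : ℕ) (x y : ℝ) : HasDerivAt (fun y => gd k A B x y)
    (k * Complex.I * (gd (k + 1) (A - 1) B x y - gd (k + 1) A (B - 1) x y)) y := by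
  have h0 : HasDerivAt (fun y : ℝ => (y : ℂ) * Complex.I) Complex.I y := by
    simpa using (Complex.ofRealCLM.hasDerivAt (x := y)).mul_const Complex.I
  have h1 : HasDerivAt (fun y : ℝ => (x : ℂ) + y * Complex.I) Complex.I y := h0.const_add _
  have h2 : HasDerivAt (fun y : ℝ => (x : ℂ) - y * Complex.I) (-Complex.I) y := h0.const_sub _
  have := gc_deriv (fun y : ℝ => (x : ℂ) + y * Complex.I) (fun y : ℝ => (x : ℂ) - y * Complex.I)
    _ _ y h1 h2 k A B
  refine this.congr_deriv ?_
  simp only [gd]; ring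

lemma gc_cont (k A B : ℕ) : Continuous (fun q : ℂ × ℂ => gc q.1 q.2 k A B) := by
  induction k generalizing A B with
  | zero => simp only [gc]; fun_prop
  | succ k ihk =>
    induction A generalizing B with
    | zero => simp only [gc_zero_left]; fun_prop
    | succ A ihA =>
      induction B with
      | zero => simp only [gc_zero_right]; fun_prop
      | succ B ihB =>
        have h1 := ihA (B + 1)
        have h2 := ihA B
        have h3 := ihk (A + 1) (B + 1)
        simp only [gc_rec]; fun_prop

lemma gd_cont (k A B : ℕ) : Continuous (fun p : ℝ × ℝ => gd k A B p.1 p.2) := by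
  have := gc_cont k A B
  unfold gd
  exact this.comp (by fun_prop : Continuous (fun p : ℝ × ℝ =>
    ((p.1 : ℂ) + p.2 * Complex.I, (p.1 : ℂ) - p.2 * Complex.I)))

/-- eigenvalue -/
def lam (a b : ℕ) : ℝ := 4 * a * b + 2 * a + 2 * b

noncomputable def fw (a b : ℕ) (x y : ℝ) : ℂ := gd 2 a (b + 1) x y
noncomputable def fv (a b : ℕ) (x y : ℝ) : ℂ := gd 2 (a + 1) b x y

/-- disk polynomial on the real disk -/
noncomputable def fh (a b : ℕ) (x y : ℝ) : ℂ := ph a b (x + y * Complex.I) (x - y * Complex.I)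

lemma fh_eq (a b : ℕ) (x y : ℝ) : fh a b x y = gd 1 (a + 1) (b + 1) x y := rfl

noncomputable def fhx (a b : ℕ) (x y : ℝ) : ℂ := gd 2 a (b + 1) x y + gd 2 (a + 1) b x y
noncomputable def fhy (a b : ℕ) (x y : ℝ) : ℂ := Complex.I * (gd 2 a (b + 1) x y - gd 2 (a + 1) b x y)

lemma fh_x (a b : ℕ) (x y : ℝ) : HasDerivAt (fun x => fh a b x y) (fhx a b x y) x := by
  refine (gd_x 1 (a + 1) (b + 1) x y).congr_deriv ?_
  simp [fhx]

lemma fh_y (a b : ℕ) (x y : ℝ) : HasDerivAt (fun y => fh a b x y) (fhy a b x y) y := by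
  refine (gd_y 1 (a + 1) (b + 1) x y).congr_deriv ?_
  simp [fhy]

noncomputable def fhxx (a b : ℕ) (x y : ℝ) : ℂ :=
  2 * (gd 3 (a - 1) (b + 1) x y + 2 * gd 3 a b x y + gd 3 (a + 1) (b - 1) x y)
noncomputable def fhxy (a b : ℕ) (x y : ℝ) : ℂ :=
  2 * Complex.I * (gd 3 (a - 1) (b + 1) x y - gd 3 (a + 1) (b - 1) x y)
noncomputable def fhyy (a b : ℕ) (x y : ℝ) : ℂ :=
  -2 * (gd 3 (a - 1) (b + 1) x y - 2 * gd 3 a b x y + gd 3 (a + 1) (b - 1) x y)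
noncomputable def fhxxx (a b : ℕ) (x y : ℝ) : ℂ :=
  6 * (gd 4 (a - 1 - 1) (b + 1) x y + 3 * gd 4 (a - 1) b x y + 3 * gd 4 a (b - 1) x y
    + gd 4 (a + 1) (b - 1 - 1) x y)
noncomputable def fhxxy (a b : ℕ) (x y : ℝ) : ℂ :=
  6 * Complex.I * (gd 4 (a - 1 - 1) (b + 1) x y + gd 4 (a - 1) b x y - gd 4 a (b - 1) x y
    - gd 4 (a + 1) (b - 1 - 1) x y)
noncomputable def fhxyy (a b : ℕ) (x y : ℝ) : ℂ :=
  -6 * (gd 4 (a - 1 - 1) (b + 1) x y - gd 4 (a - 1) b x y - gd 4 a (b - 1) x y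
    + gd 4 (a + 1) (b - 1 - 1) x y)
noncomputable def fhyyy (a b : ℕ) (x y : ℝ) : ℂ :=
  -6 * Complex.I * (gd 4 (a - 1 - 1) (b + 1) x y - 3 * gd 4 (a - 1) b x y + 3 * gd 4 a (b - 1) x y
    - gd 4 (a + 1) (b - 1 - 1) x y)

lemma fhx_x (a b : ℕ) (x y : ℝ) : HasDerivAt (fun x => fhx a b x y) (fhxx a b x y) x := by
  refine ((gd_x 2 a (b + 1) x y).add (gd_x 2 (a + 1) b x y)).congr_deriv ?_
  simp [fhxx]; ring
lemma fhx_y (a b : ℕ) (x y : ℝ) : HasDerivAt (fun y => fhx a b x y) (fhxy a b x y) y := by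
  refine ((gd_y 2 a (b + 1) x y).add (gd_y 2 (a + 1) b x y)).congr_deriv ?_
  simp [fhxy]; ring
lemma fhy_x (a b : ℕ) (x y : ℝ) : HasDerivAt (fun x => fhy a b x y) (fhxy a b x y) x := by
  refine (((gd_x 2 a (b + 1) x y).sub (gd_x 2 (a + 1) b x y)).const_mul Complex.I).congr_deriv ?_
  simp [fhxy]; ring
lemma fhy_y (a b : ℕ) (x y : ℝ) : HasDerivAt (fun y => fhy a b x y) (fhyy a b x y) y := by
  refine (((gd_y 2 a (b + 1) x y).sub (gd_y 2 (a + 1) b x y)).const_mul Complex.I).congr_deriv ?_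
  simp [fhyy]; ring_nf; simp only [Complex.I_sq]; ring

lemma h3x (a b : ℕ) (x y : ℝ) : HasDerivAt (fun x => gd 3 (a - 1) (b + 1) x y)
    (3 * (gd 4 (a - 1 - 1) (b + 1) x y + gd 4 (a - 1) b x y)) x := by
  simpa using gd_x 3 (a - 1) (b + 1) x y
lemma h3x' (a b : ℕ) (x y : ℝ) : HasDerivAt (fun x => gd 3 a b x y)
    (3 * (gd 4 (a - 1) b x y + gd 4 a (b - 1) x y)) x := by
  simpa using gd_x 3 a b x y
lemma h3x'' (a b : ℕ) (x y : ℝ) : HasDerivAt (fun x => gd 3 (a + 1) (b - 1) x y)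
    (3 * (gd 4 a (b - 1) x y + gd 4 (a + 1) (b - 1 - 1) x y)) x := by
  simpa using gd_x 3 (a + 1) (b - 1) x y
lemma h3y (a b : ℕ) (x y : ℝ) : HasDerivAt (fun y => gd 3 (a - 1) (b + 1) x y)
    (3 * Complex.I * (gd 4 (a - 1 - 1) (b + 1) x y - gd 4 (a - 1) b x y)) y := by
  simpa using gd_y 3 (a - 1) (b + 1) x y
lemma h3y' (a b : ℕ) (x y : ℝ) : HasDerivAt (fun y => gd 3 a b x y)
    (3 * Complex.I * (gd 4 (a - 1) b x y - gd 4 a (b - 1) x y)) y := by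
  simpa using gd_y 3 a b x y
lemma h3y'' (a b : ℕ) (x y : ℝ) : HasDerivAt (fun y => gd 3 (a + 1) (b - 1) x y)
    (3 * Complex.I * (gd 4 a (b - 1) x y - gd 4 (a + 1) (b - 1 - 1) x y)) y := by
  simpa using gd_y 3 (a + 1) (b - 1) x y

lemma fhxx_x (a b : ℕ) (x y : ℝ) : HasDerivAt (fun x => fhxx a b x y) (fhxxx a b x y) x := by
  refine ((((h3x a b x y).add ((h3x' a b x y).const_mul 2)).add (h3x'' a b x y)).const_mul 2).congr_deriv ?_
  simp only [fhxxx]; ring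
lemma fhxx_y (a b : ℕ) (x y : ℝ) : HasDerivAt (fun y => fhxx a b x y) (fhxxy a b x y) y := by
  refine ((((h3y a b x y).add ((h3y' a b x y).const_mul 2)).add (h3y'' a b x y)).const_mul 2).congr_deriv ?_
  simp only [fhxxy]; ring
lemma fhxy_x (a b : ℕ) (x y : ℝ) : HasDerivAt (fun x => fhxy a b x y) (fhxxy a b x y) x := by
  refine (((h3x a b x y).sub (h3x'' a b x y)).const_mul (2 * Complex.I)).congr_deriv ?_
  simp only [fhxxy]; ring
lemma fhxy_y (a b : ℕ) (x y : ℝ) : HasDerivAt (fun y => fhxy a b x y) (fhxyy a b x y) y := by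
  refine (((h3y a b x y).sub (h3y'' a b x y)).const_mul (2 * Complex.I)).congr_deriv ?_
  simp only [fhxyy]; ring_nf; simp only [Complex.I_sq]; ring
lemma fhyy_x (a b : ℕ) (x y : ℝ) : HasDerivAt (fun x => fhyy a b x y) (fhxyy a b x y) x := by
  refine ((((h3x a b x y).sub ((h3x' a b x y).const_mul 2)).add (h3x'' a b x y)).const_mul (-2)).congr_deriv ?_
  simp only [fhxyy]; ring
lemma fhyy_y (a b : ℕ) (x y : ℝ) : HasDerivAt (fun y => fhyy a b x y) (fhyyy a b x y) y := by
  refine ((((h3y a b x y).sub ((h3y' a b x y).const_mul 2)).add (h3y'' a b x y)).const_mul (-2)).congr_deriv ?_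
  simp only [fhyyy]; ring

lemma fh_eigen (a b : ℕ) (x y : ℝ) :
    ((1 - x ^ 2 - y ^ 2 : ℝ) : ℂ) * (fhxx a b x y + fhyy a b x y)
      - 2 * ((x : ℂ) * fhx a b x y + (y : ℂ) * fhy a b x y) = ((-lam a b : ℝ) : ℂ) * fh a b x y := by
  have h := gc_eigen (x + y * Complex.I) (x - y * Complex.I) a b
  have hs : ((1 - x ^ 2 - y ^ 2 : ℝ) : ℂ) =
      1 - ((x : ℂ) + y * Complex.I) * (x - y * Complex.I) := by
    push_cast; ring_nf; simp only [Complex.I_sq]; ring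
  rw [hs]
  simp only [fhxx, fhyy, fhx, fhy, fh, gd, lam]
  push_cast
  linear_combination h

lemma fh_eigen_x (a b : ℕ) (x y : ℝ) :
    ((-2 * x : ℝ) : ℂ) * (fhxx a b x y + fhyy a b x y)
      + ((1 - x ^ 2 - y ^ 2 : ℝ) : ℂ) * (fhxxx a b x y + fhxyy a b x y)
      - 2 * (fhx a b x y + (x : ℂ) * fhxx a b x y + (y : ℂ) * fhxy a b x y)
      = ((-lam a b : ℝ) : ℂ) * fhx a b x y := by
  have h1 := (fh_x a b x y).const_mul ((-lam a b : ℝ) : ℂ)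
  simp only [← fh_eigen] at h1
  have h2 := ((hs_x x y).ofReal_comp.mul ((fhxx_x a b x y).add (fhyy_x a b x y))).sub
    ((((Complex.ofRealCLM.hasDerivAt (x := x)).mul (fhx_x a b x y)).add
      ((fhy_x a b x y).const_mul (y : ℂ))).const_mul 2)
  have := h2.unique h1
  rw [← this]
  simp

lemma fh_eigen_y (a b : ℕ) (x y : ℝ) :
    ((-2 * y : ℝ) : ℂ) * (fhxx a b x y + fhyy a b x y)
      + ((1 - x ^ 2 - y ^ 2 : ℝ) : ℂ) * (fhxxy a b x y + fhyyy a b x y)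
      - 2 * ((x : ℂ) * fhxy a b x y + fhy a b x y + (y : ℂ) * fhyy a b x y)
      = ((-lam a b : ℝ) : ℂ) * fhy a b x y := by
  have h1 := (fh_y a b x y).const_mul ((-lam a b : ℝ) : ℂ)
  simp only [← fh_eigen] at h1
  have h2 := ((hs_y x y).ofReal_comp.mul ((fhxx_y a b x y).add (fhyy_y a b x y))).sub
    ((((fhx_y a b x y).const_mul (x : ℂ)).add ((Complex.ofRealCLM.hasDerivAt (x := y)).mul
      (fhy_y a b x y))).const_mul 2)
  have := h2.unique h1
  rw [← this]
  simp; ring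

noncomputable def sg (a b : ℕ) (c : ℂ) (g : ℝ → ℝ → ℂ) (t x y : ℝ) : ℝ :=
  Real.exp (-lam a b * t) * (c * g x y).re

lemma sg_x (a b : ℕ) (c : ℂ) (g g' : ℝ → ℝ → ℂ) (t x y : ℝ)
    (h : HasDerivAt (fun x => g x y) (g' x y) x) :
    HasDerivAt (fun x => sg a b c g t x y) (sg a b c g' t x y) x :=
  ((Complex.reCLM.hasFDerivAt.comp_hasDerivAt x (h.const_mul c))).const_mul _

lemma sg_y (a b : ℕ) (c : ℂ) (g g' : ℝ → ℝ → ℂ) (t x y : ℝ)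
    (h : HasDerivAt (fun y => g x y) (g' x y) y) :
    HasDerivAt (fun y => sg a b c g t x y) (sg a b c g' t x y) y :=
  ((Complex.reCLM.hasFDerivAt.comp_hasDerivAt y (h.const_mul c))).const_mul _

lemma sg_t (a b : ℕ) (c : ℂ) (g : ℝ → ℝ → ℂ) (t x y : ℝ) :
    HasDerivAt (fun t => sg a b c g t x y)
      (Real.exp (-lam a b * t) * (c * (((-lam a b : ℝ) : ℂ) * g x y)).re) t := by
  have h1 : HasDerivAt (fun t : ℝ => -lam a b * t) (-lam a b) t := by
    simpa using (hasDerivAt_id t).const_mul (-lam a b)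
  refine (h1.exp.mul_const _).congr_deriv ?_
  rw [mul_left_comm, Complex.re_ofReal_mul]; ring

lemma sg_cont (a b : ℕ) (c : ℂ) (g : ℝ → ℝ → ℂ) (h : Continuous (fun p : ℝ × ℝ => g p.1 p.2)) :
    Continuous fun q : ℝ × (ℝ × ℝ) => sg a b c g q.1 q.2.1 q.2.2 := by
  have h2 : Continuous fun q : ℝ × (ℝ × ℝ) => g q.2.1 q.2.2 := h.comp continuous_snd
  unfold sg
  exact (by fun_prop : Continuous fun q : ℝ × (ℝ × ℝ) => Real.exp (-lam a b * q.1)).mul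
    (Complex.continuous_re.comp (continuous_const.mul h2))

lemma HJ'_single (a b : ℕ) (c : ℂ) :
    HJ' (sg a b c (fh a b)) (sg a b c (fhx a b)) (sg a b c (fhy a b)) := by
  refine ⟨sg a b c (fhxx a b), sg a b c (fhxy a b), sg a b c (fhyy a b), sg a b c (fhxxx a b),
    sg a b c (fhxxy a b), sg a b c (fhxyy a b), sg a b c (fhyyy a b), ?_⟩
  have G := gd_cont
  exact
  { c := sg_cont _ _ _ _ (gd_cont 1 (a + 1) (b + 1))
    cx := sg_cont _ _ _ _ (by unfold fhx; fun_prop)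
    cy := sg_cont _ _ _ _ (by unfold fhy; fun_prop)
    cxx := sg_cont _ _ _ _ (by unfold fhxx; fun_prop)
    cxy := sg_cont _ _ _ _ (by unfold fhxy; fun_prop)
    cyy := sg_cont _ _ _ _ (by unfold fhyy; fun_prop)
    cxxx := sg_cont _ _ _ _ (by unfold fhxxx; fun_prop)
    cxxy := sg_cont _ _ _ _ (by unfold fhxxy; fun_prop)
    cxyy := sg_cont _ _ _ _ (by unfold fhxyy; fun_prop)
    cyyy := sg_cont _ _ _ _ (by unfold fhyyy; fun_prop)
    dx := fun t x y => sg_x _ _ _ _ _ _ _ _ (fh_x a b x y)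
    dy := fun t x y => sg_y _ _ _ _ _ _ _ _ (fh_y a b x y)
    dxx := fun t x y => sg_x _ _ _ _ _ _ _ _ (fhx_x a b x y)
    dxy := fun t x y => sg_y _ _ _ _ _ _ _ _ (fhx_y a b x y)
    dyx := fun t x y => sg_x _ _ _ _ _ _ _ _ (fhy_x a b x y)
    dyy := fun t x y => sg_y _ _ _ _ _ _ _ _ (fhy_y a b x y)
    dxxx := fun t x y => sg_x _ _ _ _ _ _ _ _ (fhxx_x a b x y)
    dxxy := fun t x y => sg_y _ _ _ _ _ _ _ _ (fhxx_y a b x y)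
    dxyx := fun t x y => sg_x _ _ _ _ _ _ _ _ (fhxy_x a b x y)
    dxyy := fun t x y => sg_y _ _ _ _ _ _ _ _ (fhxy_y a b x y)
    dyyx := fun t x y => sg_x _ _ _ _ _ _ _ _ (fhyy_x a b x y)
    dyyy := fun t x y => sg_y _ _ _ _ _ _ _ _ (fhyy_y a b x y)
    dt := fun t x y => (sg_t a b c (fh a b) t x y).congr_deriv (by
      rw [← fh_eigen]
      simp only [sg, Complex.mul_re, Complex.mul_im, Complex.sub_re, Complex.sub_im, Complex.add_re,
        Complex.add_im, Complex.ofReal_re, Complex.ofReal_im, Complex.re_ofNat, Complex.im_ofNat]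
      ring)
    dtx := fun t x y => (sg_t a b c (fhx a b) t x y).congr_deriv (by
      rw [← fh_eigen_x]
      simp only [sg, Complex.mul_re, Complex.mul_im, Complex.sub_re, Complex.sub_im, Complex.add_re,
        Complex.add_im, Complex.ofReal_re, Complex.ofReal_im, Complex.re_ofNat, Complex.im_ofNat]
      ring)
    dty := fun t x y => (sg_t a b c (fhy a b) t x y).congr_deriv (by
      rw [← fh_eigen_y]
      simp only [sg, Complex.mul_re, Complex.mul_im, Complex.sub_re, Complex.sub_im, Complex.add_re,
        Complex.add_im, Complex.ofReal_re, Complex.ofReal_im, Complex.re_ofNat, Complex.im_ofNat]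
      ring) }
end

section
open Real

section
variable {E : Type*} [NormedAddCommGroup E] [NormedSpace ℝ E]

lemma prod_subst (f f' : ℝ → ℝ) (S T : Set ℝ) (hS : MeasurableSet S) (hT : MeasurableSet T)
    (hd : ∀ x ∈ S, HasDerivAt f (f' x) x) (hinj : Set.InjOn f S) (g : ℝ × ℝ → E) :
    (∫ p in (f '' S) ×ˢ T, g p = ∫ p in S ×ˢ T, |f' p.1| • g (f p.1, p.2)) ∧
    (MeasureTheory.IntegrableOn g ((f '' S) ×ˢ T) ↔
      MeasureTheory.IntegrableOn (fun p : ℝ × ℝ => |f' p.1| • g (f p.1, p.2)) (S ×ˢ T)) := by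
  set F' : ℝ × ℝ → (ℝ × ℝ →L[ℝ] ℝ × ℝ) := fun p =>
    ((1 : ℝ →L[ℝ] ℝ).smulRight (f' p.1)).prodMap (ContinuousLinearMap.id ℝ ℝ) with hF'
  have hdet : ∀ p, (F' p).det = f' p.1 := by
    intro p
    rw [hF', ContinuousLinearMap.det]
    have : ((((1 : ℝ →L[ℝ] ℝ).smulRight (f' p.1)).prodMap (ContinuousLinearMap.id ℝ ℝ) :
      ℝ × ℝ →L[ℝ] ℝ × ℝ) : ℝ × ℝ →ₗ[ℝ] ℝ × ℝ) =
      LinearMap.prodMap (((1 : ℝ →L[ℝ] ℝ).smulRight (f' p.1) : ℝ →L[ℝ] ℝ) : ℝ →ₗ[ℝ] ℝ) LinearMap.id := rfl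
    simp only [this, LinearMap.det_prodMap, LinearMap.det_id, mul_one]
    simp
  have hder : ∀ p ∈ S ×ˢ T, HasFDerivWithinAt (Prod.map f id) (F' p) (S ×ˢ T) p := by
    intro p hp
    apply HasFDerivAt.hasFDerivWithinAt
    exact HasFDerivAt.prodMap (p := p) ((hd p.1 hp.1).hasFDerivAt) (hasFDerivAt_id p.2)
  have him : (Prod.map f id) '' (S ×ˢ T) = (f '' S) ×ˢ T := by
    rw [Set.prodMap_image_prod]; simp
  have hin : Set.InjOn (Prod.map f id) (S ×ˢ T) := by
    rintro ⟨a, b⟩ hp ⟨c, d⟩ hq h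
    simp only [Prod.map, Prod.mk.injEq, id] at h
    rw [Prod.mk.injEq]
    exact ⟨hinj hp.1 hq.1 h.1, h.2⟩
  have h1 := MeasureTheory.integral_image_eq_integral_abs_det_fderiv_smul
    (MeasureTheory.volume : MeasureTheory.Measure (ℝ × ℝ)) (hS.prod hT) hder hin g
  have h2 := MeasureTheory.integrableOn_image_iff_integrableOn_abs_det_fderiv_smul
    (MeasureTheory.volume : MeasureTheory.Measure (ℝ × ℝ)) (hS.prod hT) hder hin g
  rw [him] at h1 h2
  simp only [hdet] at h1 h2
  exact ⟨h1, h2⟩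

lemma polar_integrable (f : ℝ × ℝ → E) (hf : MeasureTheory.Integrable f) :
    MeasureTheory.IntegrableOn (fun p : ℝ × ℝ => p.1 • f (polarCoord.symm p)) polarCoord.target := by
  have h := (MeasureTheory.integrableOn_image_iff_integrableOn_abs_det_fderiv_smul
    (MeasureTheory.volume : MeasureTheory.Measure (ℝ × ℝ)) (polarCoord.open_target.measurableSet)
    (fun p _ ↦ (hasFDerivAt_polarCoord_symm p).hasFDerivWithinAt) polarCoord.symm.injOn f).1
      hf.integrableOn
  simp only [det_fderivPolarCoordSymm] at h
  refine h.congr_fun ?_ polarCoord.open_target.measurableSet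
  intro p hp
  simp only
  rw [abs_of_pos hp.1]

lemma polar_ind (f : ℝ × ℝ → E) : Set.EqOn
    (fun p : ℝ × ℝ => p.1 • (DD.indicator f) (polarCoord.symm p))
    ((Set.Ioc (0 : ℝ) 1 ×ˢ Set.Ioo (-π) π).indicator
      (fun p => p.1 • f (p.1 * cos p.2, p.1 * sin p.2))) polarCoord.target := by
  rintro ⟨R, z⟩ hp
  simp only [polarCoord_target, Set.mem_prod, Set.mem_Ioi] at hp
  have hiff : (R * cos z, R * sin z) ∈ DD ↔ (R, z) ∈ Set.Ioc (0 : ℝ) 1 ×ˢ Set.Ioo (-π) π := by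
    simp only [DD, Set.mem_ofPred_eq, Set.mem_prod, Set.mem_Ioc, hp.2, hp.1, true_and, and_true]
    rw [show (R * cos z) ^ 2 + (R * sin z) ^ 2 = R ^ 2 by
      have := Real.sin_sq_add_cos_sq z
      linear_combination R ^ 2 * this]
    constructor
    · intro h; nlinarith [hp.1]
    · intro h; nlinarith [hp.1]
  have e : polarCoord.symm (R, z) = (R * cos z, R * sin z) := rfl
  simp only [e]
  by_cases h : (R, z) ∈ Set.Ioc (0 : ℝ) 1 ×ˢ Set.Ioo (-π) π
  · rw [Set.indicator_of_mem (hiff.2 h), Set.indicator_of_mem h]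
  · rw [Set.indicator_of_notMem (fun h' => h (hiff.1 h')), Set.indicator_of_notMem h, smul_zero]

lemma polar_sub : (Set.Ioc (0 : ℝ) 1 ×ˢ Set.Ioo (-π) π) ⊆ polarCoord.target := by
  rintro ⟨R, z⟩ h
  exact ⟨h.1.1, h.2⟩

lemma polar_DD (f : ℝ × ℝ → E) :
    ∫ p in DD, f p = ∫ p in Set.Ioc (0 : ℝ) 1 ×ˢ Set.Ioo (-π) π,
      p.1 • f (p.1 * cos p.2, p.1 * sin p.2) := by
  rw [← MeasureTheory.integral_indicator DD_meas, ← integral_comp_polarCoord_symm]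
  rw [MeasureTheory.setIntegral_congr_fun polarCoord.open_target.measurableSet (polar_ind f)]
  rw [MeasureTheory.setIntegral_indicator (measurableSet_Ioc.prod measurableSet_Ioo),
    Set.inter_eq_self_of_subset_right polar_sub]

lemma polar_DD_int (f : ℝ × ℝ → E) (hf : MeasureTheory.IntegrableOn f DD) :
    MeasureTheory.IntegrableOn (fun p : ℝ × ℝ => p.1 • f (p.1 * cos p.2, p.1 * sin p.2))
      (Set.Ioc (0 : ℝ) 1 ×ˢ Set.Ioo (-π) π) := by
  have h := polar_integrable _ ((MeasureTheory.integrable_indicator_iff DD_meas).2 hf)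
  have h2 := h.congr_fun (polar_ind f) polarCoord.open_target.measurableSet
  have h3 := h2.mono_set polar_sub
  exact h3.congr_fun (fun p hp => Set.indicator_of_mem hp _) (measurableSet_Ioc.prod measurableSet_Ioo)

lemma cos_image : Real.cos '' (Set.Ico 0 (π / 2)) = Set.Ioc 0 1 := by
  ext x
  simp only [Set.mem_image, Set.mem_Ico, Set.mem_Ioc]
  constructor
  · rintro ⟨r, hr, rfl⟩
    exact ⟨Real.cos_pos_of_mem_Ioo ⟨by linarith [hr.1, Real.pi_pos], hr.2⟩, Real.cos_le_one r⟩
  · intro hx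
    exact ⟨Real.arccos x, ⟨Real.arccos_nonneg x, Real.arccos_lt_pi_div_two.2 hx.1⟩,
      Real.cos_arccos (by linarith [hx.1]) hx.2⟩

/-- cylindric coordinates -/
lemma polar_P1 (f : ℝ × ℝ → ℝ) (hf : MeasureTheory.IntegrableOn f DD) :
    ∫ r in (0 : ℝ)..(π / 2), ∫ z in (-π)..π, f (cos r * cos z, cos r * sin z) * sin (2 * r) =
      2 * ∫ p in DD, f p := by
  have hps := prod_subst Real.cos (fun r => - Real.sin r) (Set.Ico 0 (π / 2)) (Set.Ioo (-π) π)
    measurableSet_Ico measurableSet_Ioo (fun x _ => Real.hasDerivAt_cos x)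
    (Real.injOn_cos.mono (fun x (hx : x ∈ Set.Ico 0 (π / 2)) =>
      (⟨hx.1, by linarith [hx.2, Real.pi_pos]⟩ : x ∈ Set.Icc 0 π)))
    (fun p => p.1 • f (p.1 * cos p.2, p.1 * sin p.2))
  rw [cos_image] at hps
  have hInt := hps.2.1 (polar_DD_int f hf)
  rw [polar_DD, hps.1, ← MeasureTheory.integral_const_mul]
  rw [MeasureTheory.Measure.volume_eq_prod] at hInt ⊢
  rw [MeasureTheory.setIntegral_prod _ (hInt.const_mul 2)]
  rw [intervalIntegral.integral_of_le (by positivity), ← MeasureTheory.integral_Icc_eq_integral_Ioc,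
    MeasureTheory.integral_Icc_eq_integral_Ico]
  apply MeasureTheory.setIntegral_congr_fun measurableSet_Ico
  intro r hr
  simp only
  rw [intervalIntegral.integral_of_le (by linarith [Real.pi_pos]),
    MeasureTheory.integral_Ioc_eq_integral_Ioo]
  congr 1; ext z
  rw [abs_neg, abs_of_nonneg (Real.sin_nonneg_of_nonneg_of_le_pi hr.1 (by linarith [hr.2, Real.pi_pos])),
    Real.sin_two_mul]
  simp only [smul_eq_mul]; ring

lemma sqrt_image : (fun s : ℝ => √(1 - s)) '' (Set.Ico 0 1) = Set.Ioc 0 1 := by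
  ext x
  simp only [Set.mem_image, Set.mem_Ico, Set.mem_Ioc]
  constructor
  · rintro ⟨s, hs, rfl⟩
    exact ⟨Real.sqrt_pos.2 (by linarith), Real.sqrt_le_one.2 (by linarith)⟩
  · intro hx
    refine ⟨1 - x ^ 2, ⟨by nlinarith, by nlinarith⟩, ?_⟩
    rw [sub_sub_cancel, Real.sqrt_sq hx.1.le]

lemma polar_Q (f : ℝ × ℝ → E) :
    (∫ p in DD, f p = (1 / 2 : ℝ) • ∫ p in Set.Ico (0 : ℝ) 1 ×ˢ Set.Ioo (-π) π,
      f (√(1 - p.1) * cos p.2, √(1 - p.1) * sin p.2)) := by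
  have hps := prod_subst (fun s : ℝ => √(1 - s)) (fun s => (-1) / (2 * √(1 - s))) (Set.Ico 0 1)
    (Set.Ioo (-π) π)
    measurableSet_Ico measurableSet_Ioo (fun x hx => by
      have : HasDerivAt (fun s : ℝ => 1 - s) (-1) x := by
        simpa using (hasDerivAt_id x).const_sub 1
      exact this.sqrt (by linarith [hx.2]))
    (by
      intro a ha b hb h
      simp only at h
      rw [Real.sqrt_inj (by linarith [ha.2]) (by linarith [hb.2])] at h
      linarith)
    (fun p => p.1 • f (p.1 * cos p.2, p.1 * sin p.2))
  rw [sqrt_image] at hps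
  rw [polar_DD, hps.1, ← MeasureTheory.integral_smul]
  apply MeasureTheory.setIntegral_congr_fun (measurableSet_Ico.prod measurableSet_Ioo)
  intro p hp
  have hpos : 0 < √(1 - p.1) := Real.sqrt_pos.2 (by linarith [hp.1.2])
  simp only
  rw [smul_smul, abs_div, abs_of_pos (by positivity : 0 < 2 * √(1 - p.1))]
  congr 1
  field_simp
  norm_num

open scoped Pointwise in
lemma polar_P2 (f : ℝ × ℝ → E) (t : ℝ) (ht : 0 < t) :
    (∫ p in DD, f p = (t ^ 2 / 2 : ℝ) • ∫ p in Set.Ico (0 : ℝ) (1 / t) ×ˢ Set.Ioo (-(π / t)) (π / t),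
      f (√(1 - t * p.1) * cos (t * p.2), √(1 - t * p.1) * sin (t * p.2))) := by
  rw [polar_Q]
  have h := MeasureTheory.Measure.setIntegral_comp_smul_of_pos
    (MeasureTheory.volume : MeasureTheory.Measure (ℝ × ℝ))
    (fun p : ℝ × ℝ => f (√(1 - p.1) * cos p.2, √(1 - p.1) * sin p.2))
    (Set.Ico (0 : ℝ) (1 / t) ×ˢ Set.Ioo (-(π / t)) (π / t)) ht
  have hset : t • (Set.Ico (0 : ℝ) (1 / t) ×ˢ Set.Ioo (-(π / t)) (π / t)) =
      Set.Ico (0 : ℝ) 1 ×ˢ Set.Ioo (-π) π := by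
    ext ⟨a, b⟩
    rw [Set.mem_smul_set_iff_inv_smul_mem₀ ht.ne']
    simp only [Prod.smul_mk, smul_eq_mul, Set.mem_prod, Set.mem_Ico, Set.mem_Ioo]
    have e1 : 0 ≤ t⁻¹ * a ↔ 0 ≤ a := by
      constructor
      · intro h
        have := mul_nonneg ht.le h
        rwa [← mul_assoc, mul_inv_cancel₀ ht.ne', one_mul] at this
      · intro h; positivity
    rw [e1, inv_mul_lt_iff₀ ht, inv_mul_lt_iff₀ ht, mul_div_cancel₀ _ ht.ne',
      mul_div_cancel₀ _ ht.ne', lt_inv_mul_iff₀ ht, mul_neg, mul_div_cancel₀ _ ht.ne']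
  rw [hset] at h
  simp only [Prod.smul_fst, Prod.smul_snd, smul_eq_mul] at h
  rw [h, smul_smul]
  congr 1
  simp only [Module.finrank_prod, Module.finrank_self]
  field_simp
end
end

section
open Real

lemma fh_polar (a b : ℕ) (R z : ℝ) : fh a b (R * cos z) (R * sin z) =
    ph a b R R * Complex.exp (((a : ℂ) - b) * z * Complex.I) := by
  have he : Complex.exp (z * Complex.I) * Complex.exp (-(z * Complex.I)) = 1 := by
    rw [← Complex.exp_add]; simp
  have h := ph_rot a b R R _ _ he
  have h1 : (R : ℂ) * Complex.exp (z * Complex.I) =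
      ((R * cos z : ℝ) : ℂ) + ((R * sin z : ℝ) : ℂ) * Complex.I := by
    rw [Complex.exp_mul_I]; push_cast; ring
  have h2 : (R : ℂ) * Complex.exp (-(z * Complex.I)) =
      ((R * cos z : ℝ) : ℂ) - ((R * sin z : ℝ) : ℂ) * Complex.I := by
    rw [← neg_mul, Complex.exp_mul_I, Complex.cos_neg, Complex.sin_neg]; push_cast; ring
  rw [h1, h2] at h
  unfold fh
  rw [← h, mul_assoc, mul_assoc, ← Complex.exp_nat_mul, ← Complex.exp_nat_mul, ← mul_assoc,
    mul_assoc, mul_assoc, ← Complex.exp_add, ← Complex.exp_add]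
  have : (a : ℂ) * -(z * Complex.I) + ((b : ℂ) * (z * Complex.I) + ((a : ℂ) - b) * (z * Complex.I)) = 0 := by
    ring
  rw [this]; simp

lemma int_exp_zero (n : ℤ) (hn : n ≠ 0) :
    ∫ z in Set.Ioo (-π) π, Complex.exp ((n : ℂ) * z * Complex.I) = 0 := by
  rw [← MeasureTheory.integral_Ioc_eq_integral_Ioo, ← intervalIntegral.integral_of_le (by linarith [Real.pi_pos])]
  have hc : (n : ℂ) * Complex.I ≠ 0 := mul_ne_zero (by exact_mod_cast hn) Complex.I_ne_zero
  have := integral_exp_mul_complex (a := -π) (b := π) hc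
  have e : ∀ z : ℝ, Complex.exp ((n : ℂ) * z * Complex.I) = Complex.exp ((n : ℂ) * Complex.I * z) := by
    intro z; congr 1; ring
  simp only [e]
  rw [this, div_eq_zero_iff]
  left
  rw [sub_eq_zero, Complex.exp_eq_exp_iff_exists_int]
  refine ⟨n, ?_⟩
  push_cast; ring

lemma fh_cont (a b : ℕ) : Continuous (fun p : ℝ × ℝ => fh a b p.1 p.2) := gd_cont 1 (a + 1) (b + 1)

lemma fhx_cont (a b : ℕ) : Continuous (fun p : ℝ × ℝ => fhx a b p.1 p.2) := by
  have G := gd_cont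
  unfold fhx; fun_prop
lemma fhy_cont (a b : ℕ) : Continuous (fun p : ℝ × ℝ => fhy a b p.1 p.2) := by
  have G := gd_cont
  unfold fhy; fun_prop
lemma fhxx_cont (a b : ℕ) : Continuous (fun p : ℝ × ℝ => fhxx a b p.1 p.2) := by
  have G := gd_cont
  unfold fhxx; fun_prop
lemma fhyy_cont (a b : ℕ) : Continuous (fun p : ℝ × ℝ => fhyy a b p.1 p.2) := by
  have G := gd_cont
  unfold fhyy; fun_prop

lemma orth_rot (a b c d : ℕ) (h : a + c ≠ b + d) :
    ∫ p in DD, fh a b p.1 p.2 * fh c d p.1 p.2 = 0 := by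
  rw [polar_DD]
  have e : ∀ p : ℝ × ℝ, p.1 • (fh a b (p.1 * cos p.2) (p.1 * sin p.2) *
      fh c d (p.1 * cos p.2) (p.1 * sin p.2)) =
      (p.1 • (ph a b p.1 p.1 * ph c d p.1 p.1)) *
        Complex.exp ((((a : ℤ) - b + c - d : ℤ) : ℂ) * p.2 * Complex.I) := by
    intro p
    rw [fh_polar, fh_polar, smul_mul_assoc]
    congr 1
    rw [mul_mul_mul_comm, ← Complex.exp_add]
    congr 2
    push_cast; ring
  simp only [e]
  rw [MeasureTheory.Measure.volume_eq_prod]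
  rw [MeasureTheory.setIntegral_prod_mul (fun R : ℝ => R • (ph a b R R * ph c d R R))
    (fun z : ℝ => Complex.exp ((((a : ℤ) - b + c - d : ℤ) : ℂ) * z * Complex.I))]
  rw [int_exp_zero _ (by omega), mul_zero]

lemma dirichlet (a b c d : ℕ) : ((-lam a b : ℝ) : ℂ) * ∫ p in DD, fh a b p.1 p.2 * fh c d p.1 p.2 =
    - ∫ p in DD, ((1 - p.1 ^ 2 - p.2 ^ 2 : ℝ) : ℂ) * (fhx a b p.1 p.2 * fhx c d p.1 p.2 +
      fhy a b p.1 p.2 * fhy c d p.1 p.2) := by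
  have g0 := fh_cont
  have g1 := fhx_cont
  have g2 := fhy_cont
  have g3 := fhxx_cont
  have g4 := fhyy_cont
  have c1 : Continuous (fun p : ℝ × ℝ => (((-2 * p.1 : ℝ) : ℂ) * fhx a b p.1 p.2 +
        ((1 - p.1 ^ 2 - p.2 ^ 2 : ℝ) : ℂ) * fhxx a b p.1 p.2) * fh c d p.1 p.2 +
        ((1 - p.1 ^ 2 - p.2 ^ 2 : ℝ) : ℂ) * fhx a b p.1 p.2 * fhx c d p.1 p.2) := by fun_prop
  have c2 : Continuous (fun p : ℝ × ℝ => (((-2 * p.2 : ℝ) : ℂ) * fhy a b p.1 p.2 +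
        ((1 - p.1 ^ 2 - p.2 ^ 2 : ℝ) : ℂ) * fhyy a b p.1 p.2) * fh c d p.1 p.2 +
        ((1 - p.1 ^ 2 - p.2 ^ 2 : ℝ) : ℂ) * fhy a b p.1 p.2 * fhy c d p.1 p.2) := by fun_prop
  have e1 := ibp_x (fun x y => ((1 - x ^ 2 - y ^ 2 : ℝ) : ℂ) * fhx a b x y * fh c d x y)
      (fun x y => (((-2 * x : ℝ) : ℂ) * fhx a b x y + ((1 - x ^ 2 - y ^ 2 : ℝ) : ℂ) * fhxx a b x y) *
        fh c d x y + ((1 - x ^ 2 - y ^ 2 : ℝ) : ℂ) * fhx a b x y * fhx c d x y)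
      (fun x y hxy => ((hs_x x y).ofReal_comp.mul (fhx_x a b x y)).mul (fh_x c d x y))
      (fun x y hxy => by
        have : 1 - x ^ 2 - y ^ 2 = 0 := by linarith
        rw [this]; simp) c1.continuousOn
  have e2 := ibp_y (fun x y => ((1 - x ^ 2 - y ^ 2 : ℝ) : ℂ) * fhy a b x y * fh c d x y)
      (fun x y => (((-2 * y : ℝ) : ℂ) * fhy a b x y + ((1 - x ^ 2 - y ^ 2 : ℝ) : ℂ) * fhyy a b x y) *
        fh c d x y + ((1 - x ^ 2 - y ^ 2 : ℝ) : ℂ) * fhy a b x y * fhy c d x y)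
      (fun x y hxy => ((hs_y x y).ofReal_comp.mul (fhy_y a b x y)).mul (fh_y c d x y))
      (fun x y hxy => by
        have : 1 - x ^ 2 - y ^ 2 = 0 := by linarith
        rw [this]; simp) c2.continuousOn
  rw [← MeasureTheory.integral_const_mul, eq_neg_iff_add_eq_zero, ← MeasureTheory.integral_add]
  · rw [← add_zero (0 : ℂ)]
    nth_rewrite 1 [← e1]
    rw [← e2, ← MeasureTheory.integral_add]
    · congr 1; ext p
      rw [← mul_assoc, ← fh_eigen]; push_cast; ring
    · exact c1.continuousOn.integrableOn_compact DD_compact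
    · exact c2.continuousOn.integrableOn_compact DD_compact
  · exact (by fun_prop : Continuous _).continuousOn.integrableOn_compact DD_compact
  · exact (by fun_prop : Continuous _).continuousOn.integrableOn_compact DD_compact

lemma orth_eig (a b c d : ℕ) (h : lam a b ≠ lam c d) :
    ∫ p in DD, fh a b p.1 p.2 * fh c d p.1 p.2 = 0 := by
  have h1 := dirichlet a b c d
  have h2 := dirichlet c d a b
  have e1 : ∫ p in DD, fh c d p.1 p.2 * fh a b p.1 p.2 = ∫ p in DD, fh a b p.1 p.2 * fh c d p.1 p.2 := by
    congr 1; ext p; ring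
  have e2 : (∫ p in DD, ((1 - p.1 ^ 2 - p.2 ^ 2 : ℝ) : ℂ) * (fhx a b p.1 p.2 * fhx c d p.1 p.2 +
      fhy a b p.1 p.2 * fhy c d p.1 p.2)) = ∫ p in DD, ((1 - p.1 ^ 2 - p.2 ^ 2 : ℝ) : ℂ) *
      (fhx c d p.1 p.2 * fhx a b p.1 p.2 + fhy c d p.1 p.2 * fhy a b p.1 p.2) := by
    congr 1; ext p; ring
  rw [e1, ← e2, ← h1] at h2
  have h3 : (((-lam c d : ℝ) : ℂ) - ((-lam a b : ℝ) : ℂ)) * ∫ p in DD, fh a b p.1 p.2 * fh c d p.1 p.2 = 0 := by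
    rw [sub_mul, h2, sub_self]
  rcases mul_eq_zero.1 h3 with h4 | h4
  · exfalso; apply h
    rw [sub_eq_zero] at h4
    have := Complex.ofReal_injective h4
    linarith
  · exact h4

lemma orth (a b c d : ℕ) (h : ¬ (c = b ∧ d = a)) :
    ∫ p in DD, fh a b p.1 p.2 * fh c d p.1 p.2 = 0 := by
  by_cases h1 : a + c = b + d
  · apply orth_eig
    intro h2
    apply h
    have h3 : (4 * a * b + 2 * a + 2 * b : ℤ) = 4 * c * d + 2 * c + 2 * d := by
      unfold lam at h2; exact_mod_cast h2
    have h4 : (a : ℤ) + c = b + d := by exact_mod_cast h1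
    have h5 : ((c : ℤ) + d + 1) ^ 2 = ((a : ℤ) + b + 1) ^ 2 := by
      have h6 : (c : ℤ) - d = b - a := by linarith
      have h7 : ((c : ℤ) - d) ^ 2 = (b - a) ^ 2 := by rw [h6]
      linarith
    have h8 : (c : ℤ) + d + 1 = (a : ℤ) + b + 1 := by
      have := abs_eq_abs.2 (sq_eq_sq_iff_eq_or_eq_neg.1 h5)
      rwa [abs_of_pos (by positivity), abs_of_pos (by positivity)] at this
    omega
  · exact orth_rot a b c d h1

lemma vol_DD : ∫ _p in DD, (1 : ℂ) = (π : ℂ) := by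
  rw [polar_Q]
  rw [MeasureTheory.setIntegral_const, MeasureTheory.Measure.volume_eq_prod, MeasureTheory.measureReal_prod_prod]
  simp only [Real.volume_real_Ico, Real.volume_real_Ioo]
  rw [max_eq_left (by norm_num), max_eq_left (by linarith [Real.pi_pos])]
  simp; ring

noncomputable def nn (a b : ℕ) : ℂ := ∫ p in DD, fh a b p.1 p.2 * fh b a p.1 p.2

lemma nn_comm (a b : ℕ) : nn a b = nn b a := by
  unfold nn; congr 1; ext p; ring

lemma fh_R (a b : ℕ) (x y : ℝ) : ((a : ℂ) + b + 1) * ((x + y * Complex.I) * fh a b x y) =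
    (a + 1) * fh (a + 1) b x y + b * (if b = 0 then 0 else fh a (b - 1) x y) := by
  have := ph_R (x + y * Complex.I) (x - y * Complex.I) a b
  unfold fh
  rw [this]
  rcases b with _ | b
  · simp
  · simp [ph]

lemma fh_int (a b c d : ℕ) : MeasureTheory.IntegrableOn
    (fun p : ℝ × ℝ => fh a b p.1 p.2 * fh c d p.1 p.2) DD :=
  ((fh_cont a b).mul (fh_cont c d)).continuousOn.integrableOn_compact DD_compact

lemma int_R (a b c d : ℕ) : ((a : ℂ) + b + 1) * ∫ p in DD, (p.1 + p.2 * Complex.I) *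
      (fh a b p.1 p.2 * fh c d p.1 p.2) =
    (a + 1) * (∫ p in DD, fh (a + 1) b p.1 p.2 * fh c d p.1 p.2) +
      b * (if b = 0 then 0 else ∫ p in DD, fh a (b - 1) p.1 p.2 * fh c d p.1 p.2) := by
  rw [← MeasureTheory.integral_const_mul]
  have e : ∀ p : ℝ × ℝ, ((a : ℂ) + b + 1) * ((p.1 + p.2 * Complex.I) * (fh a b p.1 p.2 * fh c d p.1 p.2)) =
      (a + 1) * (fh (a + 1) b p.1 p.2 * fh c d p.1 p.2) +
        b * (if b = 0 then 0 else fh a (b - 1) p.1 p.2 * fh c d p.1 p.2) := by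
    intro p
    have := fh_R a b p.1 p.2
    have h2 : (if b = 0 then 0 else fh a (b - 1) p.1 p.2 * fh c d p.1 p.2) =
      (if b = 0 then 0 else fh a (b - 1) p.1 p.2) * fh c d p.1 p.2 := by split_ifs <;> simp
    rw [h2]
    linear_combination (fh c d p.1 p.2) * this
  simp only [e]
  have i1 := (fh_int (a + 1) b c d).const_mul ((a : ℂ) + 1)
  split_ifs with hb
  · simp only [mul_zero, add_zero]
    rw [MeasureTheory.integral_const_mul]
  · have i2 := (fh_int a (b - 1) c d).const_mul (b : ℂ)
    rw [MeasureTheory.integral_add i1 i2, MeasureTheory.integral_const_mul,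
      MeasureTheory.integral_const_mul]

lemma nn_rec (a b : ℕ) : ((a : ℂ) + b + 2) * nn (a + 1) b = (a + b + 1) * nn a b := by
  have h1 := int_R a b b (a + 1)
  have h2 := int_R b (a + 1) a b
  have z1 : (if b = 0 then 0 else ∫ p in DD, fh a (b - 1) p.1 p.2 * fh b (a + 1) p.1 p.2) = 0 := by
    split_ifs with hb
    · rfl
    · exact orth _ _ _ _ (by omega)
  rw [z1] at h1
  rw [orth (b + 1) (a + 1) a b (by omega)] at h2
  simp only [Nat.add_eq_zero_iff, one_ne_zero, and_false, if_false, Nat.add_sub_cancel] at h2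
  have e3 : (∫ p in DD, (p.1 + p.2 * Complex.I) * (fh b (a + 1) p.1 p.2 * fh a b p.1 p.2)) =
      ∫ p in DD, (p.1 + p.2 * Complex.I) * (fh a b p.1 p.2 * fh b (a + 1) p.1 p.2) := by
    congr 1; ext p; ring
  rw [e3] at h2
  have e4 : nn (a + 1) b = ∫ p in DD, fh (a + 1) b p.1 p.2 * fh b (a + 1) p.1 p.2 := rfl
  have e5 : nn a b = ∫ p in DD, fh b a p.1 p.2 * fh a b p.1 p.2 := by rw [nn_comm]; rfl
  rw [← e4] at h1
  rw [← e5] at h2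
  have ha : (a : ℂ) + 1 ≠ 0 := by exact_mod_cast Nat.succ_ne_zero a
  push_cast at h2
  apply mul_left_cancel₀ ha
  linear_combination (-((a : ℂ) + b + 2)) * h1 + (a + b + 1) * h2

lemma nn_eq (a b : ℕ) : nn a b = π / ((a : ℂ) + b + 1) := by
  have key : ∀ b, nn 0 b = π / ((b : ℂ) + 1) → ∀ a, nn a b = π / ((a : ℂ) + b + 1) := by
    intro b h0 a
    induction a with
    | zero => rw [h0]; simp
    | succ a ih =>
      have := nn_rec a b
      rw [ih] at this
      have h1 : (a : ℂ) + b + 1 ≠ 0 := by exact_mod_cast Nat.succ_ne_zero (a + b)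
      have h2 : (a : ℂ) + b + 2 ≠ 0 := by exact_mod_cast Nat.succ_ne_zero (a + b + 1)
      have h3 : ((a + 1 : ℕ) : ℂ) + b + 1 ≠ 0 := by
        push_cast; convert h2 using 1; ring
      rw [eq_div_iff h3]
      rw [mul_div_cancel₀ _ h1] at this
      rw [← this]; push_cast; ring
  have h00 : nn 0 0 = π := by
    rw [← vol_DD]; unfold nn fh
    simp [ph_zero_right]
  apply key
  rw [nn_comm]
  have := key 0 (by rw [h00]; simp) b
  rw [this]; simp
end

section
open Real

lemma fh_bound (a b : ℕ) (x y τ : ℝ) (hτ : 0 < τ) (h : x ^ 2 + y ^ 2 ≤ 1) :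
    ‖fh a b x y‖ ≤ Real.exp (2 * a * b * τ + (1 - x ^ 2 - y ^ 2) / (2 * τ)) := by
  have e1 : ‖(x : ℂ) + y * Complex.I‖ ^ 2 = x ^ 2 + y ^ 2 := by
    rw [← Complex.normSq_eq_norm_sq, Complex.normSq_add_mul_I]
  have hw : ‖(x : ℂ) + y * Complex.I‖ ≤ 1 := by
    nlinarith [norm_nonneg ((x : ℂ) + y * Complex.I)]
  have := ph_bound a b _ hw τ hτ
  rw [e1] at this
  have e2 : (starRingEnd ℂ) ((x : ℂ) + y * Complex.I) = (x : ℂ) - y * Complex.I := by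
    simp [sub_eq_add_neg]
  rw [e2] at this
  unfold fh
  rw [sub_sub]; exact this

lemma fh_bound' (a b : ℕ) (x y τ : ℝ) (hτ : 0 < τ) (h : x ^ 2 + y ^ 2 ≤ 1) :
    ‖fh a b x y‖ ≤ Real.exp (2 * a * b * τ + 1 / (2 * τ)) := by
  refine (fh_bound a b x y τ hτ h).trans ?_
  apply Real.exp_le_exp.2
  gcongr
  nlinarith [sq_nonneg x, sq_nonneg y]

lemma gd2_bound (x y τ : ℝ) (hτ : 0 < τ) (h : x ^ 2 + y ^ 2 ≤ 1) : ∀ a b : ℕ,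
    ‖gd 2 (a + 1) (b + 1) x y‖ ≤ ((a : ℝ) + b + 1) ^ 2 * Real.exp (2 * a * b * τ + 1 / (2 * τ)) := by
  intro a
  have step : ∀ a b : ℕ, ‖gd 2 (a + 1) (b + 1) x y‖ ≤ ‖gd 2 a b x y‖ +
      ((a : ℝ) + b + 1) * Real.exp (2 * a * b * τ + 1 / (2 * τ)) := by
    intro a b
    have h1 : gd 2 (a + 1) (b + 1) x y = gd 2 a b x y + ((a : ℂ) + b + 1) * fh a b x y := by
      have := gc_two_step (x + y * Complex.I) (x - y * Complex.I) a b
      unfold gd fh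
      linear_combination this
    rw [h1]
    refine (norm_add_le _ _).trans ?_
    gcongr
    rw [norm_mul]
    have : ‖(a : ℂ) + b + 1‖ = (a : ℝ) + b + 1 := by
      have : (a : ℂ) + b + 1 = ((a + b + 1 : ℕ) : ℂ) := by push_cast; ring
      rw [this, Complex.norm_natCast]; push_cast; ring
    rw [this]
    gcongr
    exact fh_bound' a b x y τ hτ h
  have base : ∀ a b : ℕ, ‖gd 2 a b x y‖ = 0 → ‖gd 2 (a + 1) (b + 1) x y‖ ≤
      ((a : ℝ) + b + 1) ^ 2 * Real.exp (2 * a * b * τ + 1 / (2 * τ)) := by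
    intro a b h0
    refine (step a b).trans ?_
    rw [h0, zero_add]
    gcongr
    have : (0 : ℝ) ≤ (a : ℝ) + b := by positivity
    nlinarith
  induction a with
  | zero => intro b; exact base 0 b (by simp [gd, gc_zero_left])
  | succ a ih =>
    intro b
    cases b with
    | zero => exact base (a + 1) 0 (by simp [gd, gc_zero_right])
    | succ b =>
      refine (step (a + 1) (b + 1)).trans ?_
      have h1 := ih b
      have h2 : Real.exp (2 * a * b * τ + 1 / (2 * τ)) ≤
        Real.exp (2 * (a + 1 : ℕ) * (b + 1 : ℕ) * τ + 1 / (2 * τ)) := by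
        apply Real.exp_le_exp.2
        gcongr <;> simp
      have h3 := mul_le_mul_of_nonneg_left h2 (by positivity : (0 : ℝ) ≤ ((a : ℝ) + b + 1) ^ 2)
      have h4 : ((a : ℝ) + b + 1) ^ 2 + (((a + 1 : ℕ) : ℝ) + (b + 1 : ℕ) + 1) ≤
        (((a + 1 : ℕ) : ℝ) + (b + 1 : ℕ) + 1) ^ 2 := by
        push_cast
        have : (0 : ℝ) ≤ (a : ℝ) + b := by positivity
        nlinarith
      have h5 := mul_le_mul_of_nonneg_right h4
        (Real.exp_pos (2 * (a + 1 : ℕ) * (b + 1 : ℕ) * τ + 1 / (2 * τ))).le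
      linarith

noncomputable def bnd (t : ℝ) (i : ℕ × ℕ) : ℝ :=
  2 * (((i.1 : ℝ) + i.2 + 1) ^ 3 * Real.exp (-2 * (i.1 + i.2) * t)) * Real.exp (1 / (2 * t))

lemma bnd_nonneg (t : ℝ) (i : ℕ × ℕ) : 0 ≤ bnd t i := by unfold bnd; positivity

lemma bnd_summable (t : ℝ) (ht : 0 < t) : Summable (bnd t) := by
  unfold bnd
  apply Summable.mul_right
  apply Summable.mul_left
  have h1 : Summable (fun n : ℕ => ((n : ℝ) + 1) ^ 3 * Real.exp (-2 * n * t)) := by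
    have hr : ‖Real.exp (-2 * t)‖ < 1 := by
      rw [Real.norm_of_nonneg (Real.exp_pos _).le]
      rw [← Real.exp_zero]; apply Real.exp_lt_exp.2; linarith
    have := summable_pow_mul_geometric_of_norm_lt_one 3 hr
    have h2 := ((summable_nat_add_iff 1).2 this).mul_right (Real.exp (2 * t))
    refine h2.congr ?_
    intro n
    push_cast
    rw [mul_assoc, ← Real.exp_nat_mul, ← Real.exp_add]
    congr 2
    push_cast; ring
  have h2 := h1.mul_of_nonneg h1 (fun n => by positivity) (fun n => by positivity)
  refine Summable.of_nonneg_of_le (fun i => by positivity) ?_ h2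
  rintro ⟨a, b⟩
  simp only
  have : Real.exp (-2 * ((a : ℝ) + b) * t) = Real.exp (-2 * a * t) * Real.exp (-2 * b * t) := by
    rw [← Real.exp_add]; congr 1; ring
  rw [this, mul_mul_mul_comm, ← mul_pow]
  gcongr
  have ha : (0 : ℝ) ≤ a := by positivity
  have hb : (0 : ℝ) ≤ b := by positivity
  nlinarith [mul_nonneg ha hb]

lemma sg_le (a b : ℕ) (c : ℝ) (hc : 0 ≤ c) (g : ℝ → ℝ → ℂ) (t x y : ℝ) :
    |sg a b c g t x y| ≤ Real.exp (-lam a b * t) * (c * ‖g x y‖) := by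
  unfold sg
  rw [abs_mul, abs_of_pos (Real.exp_pos _)]
  gcongr
  refine (Complex.abs_re_le_norm _).trans ?_
  rw [norm_mul, Complex.norm_real, Real.norm_of_nonneg hc]

lemma sg_bnd (a b : ℕ) (g : ℝ → ℝ → ℂ) (t0 t x y : ℝ) (h0 : 0 < t0) (ht : t0 ≤ t)
    (hg : ‖g x y‖ ≤ 2 * ((a : ℝ) + b + 1) ^ 2 * Real.exp (2 * a * b * t0 + 1 / (2 * t0))) :
    |sg a b ((a : ℝ) + b + 1 : ℝ) g t x y| ≤ bnd t0 (a, b) := by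
  refine (sg_le a b _ (by positivity) g t x y).trans ?_
  have h1 : Real.exp (-lam a b * t) ≤ Real.exp (-lam a b * t0) := by
    apply Real.exp_le_exp.2
    have : 0 ≤ lam a b := by unfold lam; positivity
    nlinarith
  calc _ ≤ Real.exp (-lam a b * t0) * (((a : ℝ) + b + 1) *
        (2 * ((a : ℝ) + b + 1) ^ 2 * Real.exp (2 * a * b * t0 + 1 / (2 * t0)))) := by gcongr
    _ = 2 * ((a : ℝ) + b + 1) ^ 3 * (Real.exp (-lam a b * t0) *
        Real.exp (2 * a * b * t0 + 1 / (2 * t0))) := by ring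
    _ = 2 * ((a : ℝ) + b + 1) ^ 3 * (Real.exp (-2 * (a + b) * t0 - 2 * a * b * t0) *
        Real.exp (1 / (2 * t0))) := by
      rw [← Real.exp_add, ← Real.exp_add]; congr 2; unfold lam; ring
    _ ≤ 2 * ((a : ℝ) + b + 1) ^ 3 * (Real.exp (-2 * (a + b) * t0) *
        Real.exp (1 / (2 * t0))) := by
      gcongr
      have : (0 : ℝ) ≤ 2 * a * b * t0 := by positivity
      linarith
    _ = _ := by unfold bnd; ring

noncomputable def P0 (i : ℕ × ℕ) : ℝ → ℝ → ℝ → ℝ := sg i.1 i.2 ((i.1 : ℝ) + i.2 + 1 : ℝ) (fh i.1 i.2)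
noncomputable def P1 (i : ℕ × ℕ) : ℝ → ℝ → ℝ → ℝ := sg i.1 i.2 ((i.1 : ℝ) + i.2 + 1 : ℝ) (fhx i.1 i.2)
noncomputable def P2 (i : ℕ × ℕ) : ℝ → ℝ → ℝ → ℝ := sg i.1 i.2 ((i.1 : ℝ) + i.2 + 1 : ℝ) (fhy i.1 i.2)

lemma P0_bnd (i : ℕ × ℕ) (t0 t x y : ℝ) (h0 : 0 < t0) (ht : t0 ≤ t) (h : x ^ 2 + y ^ 2 ≤ 1) :
    |P0 i t x y| ≤ bnd t0 i := by
  apply sg_bnd _ _ _ _ _ _ _ h0 ht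
  refine (fh_bound' i.1 i.2 x y t0 h0 h).trans ?_
  apply le_mul_of_one_le_left (Real.exp_pos _).le
  have ha : (0 : ℝ) ≤ i.1 := by positivity
  have hb : (0 : ℝ) ≤ i.2 := by positivity
  nlinarith [mul_nonneg ha hb]

lemma gd2_bound2 (a b : ℕ) (x y τ : ℝ) (hτ : 0 < τ) (h : x ^ 2 + y ^ 2 ≤ 1) :
    ‖gd 2 a (b + 1) x y‖ ≤ ((a : ℝ) + b + 1) ^ 2 * Real.exp (2 * a * b * τ + 1 / (2 * τ)) := by
  cases a with
  | zero => simp [gd, gc_zero_left]; positivity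
  | succ a =>
    refine (gd2_bound x y τ hτ h a b).trans ?_
    gcongr <;> simp

lemma gd2_bound3 (a b : ℕ) (x y τ : ℝ) (hτ : 0 < τ) (h : x ^ 2 + y ^ 2 ≤ 1) :
    ‖gd 2 (a + 1) b x y‖ ≤ ((a : ℝ) + b + 1) ^ 2 * Real.exp (2 * a * b * τ + 1 / (2 * τ)) := by
  cases b with
  | zero => simp [gd, gc_zero_right]; positivity
  | succ b =>
    refine (gd2_bound x y τ hτ h a b).trans ?_
    gcongr <;> simp

lemma P1_bnd (i : ℕ × ℕ) (t0 t x y : ℝ) (h0 : 0 < t0) (ht : t0 ≤ t) (h : x ^ 2 + y ^ 2 ≤ 1) :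
    |P1 i t x y| ≤ bnd t0 i := by
  apply sg_bnd _ _ _ _ _ _ _ h0 ht
  unfold fhx
  refine (norm_add_le _ _).trans ?_
  linarith [gd2_bound2 i.1 i.2 x y t0 h0 h, gd2_bound3 i.1 i.2 x y t0 h0 h]

lemma P2_bnd (i : ℕ × ℕ) (t0 t x y : ℝ) (h0 : 0 < t0) (ht : t0 ≤ t) (h : x ^ 2 + y ^ 2 ≤ 1) :
    |P2 i t x y| ≤ bnd t0 i := by
  apply sg_bnd _ _ _ _ _ _ _ h0 ht
  unfold fhy
  rw [norm_mul, Complex.norm_I, one_mul]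
  refine (norm_sub_le _ _).trans ?_
  linarith [gd2_bound2 i.1 i.2 x y t0 h0 h, gd2_bound3 i.1 i.2 x y t0 h0 h]

noncomputable def q0 (t x y : ℝ) : ℝ := ∑' i, P0 i t x y
noncomputable def q1 (t x y : ℝ) : ℝ := ∑' i, P1 i t x y
noncomputable def q2 (t x y : ℝ) : ℝ := ∑' i, P2 i t x y

/-- generic series packaging -/
def Goodser (P : ℕ × ℕ → ℝ → ℝ → ℝ → ℝ) : Prop :=
  (∀ i t, Continuous (fun p : ℝ × ℝ => P i t p.1 p.2)) ∧
  ∀ i t0 t x y, 0 < t0 → t0 ≤ t → x ^ 2 + y ^ 2 ≤ 1 → |P i t x y| ≤ bnd t0 i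

lemma good0 : Goodser P0 := ⟨fun i _ => (sg_cont _ _ _ _ (fh_cont i.1 i.2)).comp
  (Continuous.prodMk continuous_const continuous_id), P0_bnd⟩
lemma good1 : Goodser P1 := ⟨fun i _ => (sg_cont _ _ _ _ (fhx_cont i.1 i.2)).comp
  (Continuous.prodMk continuous_const continuous_id), P1_bnd⟩
lemma good2 : Goodser P2 := ⟨fun i _ => (sg_cont _ _ _ _ (fhy_cont i.1 i.2)).comp
  (Continuous.prodMk continuous_const continuous_id), P2_bnd⟩

lemma good_summable {P} (hP : Goodser P) (t x y : ℝ) (ht : 0 < t) (h : x ^ 2 + y ^ 2 ≤ 1) :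
    Summable (fun i => P i t x y) :=
  Summable.of_norm_bounded (bnd_summable t ht) (fun i => hP.2 i t t x y ht le_rfl h)

lemma good_cont {P} (hP : Goodser P) (t : ℝ) (ht : 0 < t) :
    ContinuousOn (fun p : ℝ × ℝ => ∑' i, P i t p.1 p.2) DD :=
  continuousOn_tsum (fun i => (hP.1 i t).continuousOn) (bnd_summable t ht)
    (fun i p hp => hP.2 i t t p.1 p.2 ht le_rfl hp)

/-- uniform convergence of partial sums, uniformly in time -/
lemma good_unif {P} (hP : Goodser P) (t0 : ℝ) (ht : 0 < t0) (ε : ℝ) (hε : 0 < ε) :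
    ∀ᶠ S : Finset (ℕ × ℕ) in Filter.atTop, ∀ t x y, t0 ≤ t → x ^ 2 + y ^ 2 ≤ 1 →
      |(∑' i, P i t x y) - ∑ i ∈ S, P i t x y| < ε := by
  have := tendstoUniformlyOn_tsum (f := fun i (q : ℝ × ℝ × ℝ) => P i q.1 q.2.1 q.2.2)
    (s := {q | t0 ≤ q.1 ∧ q.2.1 ^ 2 + q.2.2 ^ 2 ≤ 1}) (bnd_summable t0 ht)
    (fun i q hq => hP.2 i t0 q.1 q.2.1 q.2.2 ht hq.1 hq.2)
  rw [Metric.tendstoUniformlyOn_iff] at this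
  filter_upwards [this ε hε] with S hS t x y h1 h2
  exact hS (t, x, y) ⟨h1, h2⟩

lemma fh_curve (a b : ℕ) (x y : ℝ → ℝ) (x' y' s : ℝ) (hx : HasDerivAt x x' s) (hy : HasDerivAt y y' s) :
    HasDerivAt (fun s => fh a b (x s) (y s)) (x' * fhx a b (x s) (y s) + y' * fhy a b (x s) (y s)) s := by
  have h1 : HasDerivAt (fun s : ℝ => (x s : ℂ) + y s * Complex.I) (x' + y' * Complex.I) s :=
    hx.ofReal_comp.add (hy.ofReal_comp.mul_const _)
  have h2 : HasDerivAt (fun s : ℝ => (x s : ℂ) - y s * Complex.I) (x' - y' * Complex.I) s :=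
    hx.ofReal_comp.sub (hy.ofReal_comp.mul_const _)
  have := gc_deriv _ _ _ _ s h1 h2 1 (a + 1) (b + 1)
  refine this.congr_deriv ?_
  simp only [fhx, fhy, gd, Nat.add_sub_cancel]
  push_cast; ring_nf

lemma P0_curve (i : ℕ × ℕ) (t : ℝ) (x y : ℝ → ℝ) (x' y' s : ℝ) (hx : HasDerivAt x x' s)
    (hy : HasDerivAt y y' s) :
    HasDerivAt (fun s => P0 i t (x s) (y s)) (x' * P1 i t (x s) (y s) + y' * P2 i t (x s) (y s)) s := by
  have h := fh_curve i.1 i.2 x y x' y' s hx hy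
  have := ((Complex.reCLM.hasFDerivAt.comp_hasDerivAt s (h.const_mul
    (((i.1 : ℝ) + i.2 + 1 : ℝ) : ℂ)))).const_mul (Real.exp (-lam i.1 i.2 * t))
  refine this.congr_deriv ?_
  simp only [P1, P2, sg, Complex.reCLM_apply, Complex.re_ofReal_mul, Complex.add_re]
  ring

lemma q0_curve (t : ℝ) (ht : 0 < t) (x y x' y' : ℝ → ℝ) (hx : ∀ s, HasDerivAt x (x' s) s)
    (hy : ∀ s, HasDerivAt y (y' s) s) (hD : ∀ s, x s ^ 2 + y s ^ 2 ≤ 1)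
    (hx' : ∀ s, |x' s| ≤ 1) (hy' : ∀ s, |y' s| ≤ 1) (s : ℝ) :
    HasDerivAt (fun s => q0 t (x s) (y s)) (x' s * q1 t (x s) (y s) + y' s * q2 t (x s) (y s)) s := by
  have := hasDerivAt_tsum (u := fun i => 2 * bnd t i) (g := fun i s => P0 i t (x s) (y s))
    (g' := fun i s => x' s * P1 i t (x s) (y s) + y' s * P2 i t (x s) (y s)) (y₀ := 0)
    ((bnd_summable t ht).mul_left 2) (fun i s => P0_curve i t x y _ _ s (hx s) (hy s))
    (fun i s => by
      have h1 := P1_bnd i t t _ _ ht le_rfl (hD s)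
      have h2 := P2_bnd i t t _ _ ht le_rfl (hD s)
      refine (norm_add_le _ _).trans ?_
      rw [norm_mul, norm_mul]
      simp only [Real.norm_eq_abs]
      nlinarith [hx' s, hy' s, abs_nonneg (x' s), abs_nonneg (y' s),
        abs_nonneg (P1 i t (x s) (y s)), abs_nonneg (P2 i t (x s) (y s))])
    (good_summable good0 t _ _ ht (hD 0)) s
  refine this.congr_deriv ?_
  rw [((good_summable good1 t _ _ ht (hD s)).mul_left _).tsum_add
    ((good_summable good2 t _ _ ht (hD s)).mul_left _), tsum_mul_left, tsum_mul_left]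
  rfl
end

section
open Real

lemma jacobi_eq (k m : ℕ) (r : ℝ) (hr : cos r ≠ 0) :
    cos r ^ m * jacobiP k m (cos (2 * r)) = ∑ j ∈ Finset.range (k + 1),
      ((k + m).choose j : ℝ) * (k.choose j) * (-(1 - cos r * cos r)) ^ j *
        (cos r ^ (k + m - j) * cos r ^ (k - j)) := by
  unfold jacobiP
  have e1 : (fun y : ℝ => (1 + y) ^ m * (1 - y ^ 2) ^ k) = fun y => (1 + y) ^ (k + m) * (1 - y) ^ k := by
    ext y
    rw [pow_add, mul_comm ((1 + y) ^ k), mul_assoc, ← mul_pow]; congr 2; ring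
  rw [e1, iteratedDeriv_fun_mul (by fun_prop) (by fun_prop)]
  have d1 : ∀ i x, iteratedDeriv i (fun y : ℝ => (1 + y) ^ (k + m)) x =
      ((k + m).descFactorial i) * (1 + x) ^ (k + m - i) := by
    intro i x
    rw [iteratedDeriv_comp_const_add i (fun y : ℝ => y ^ (k + m)) 1]
    simp only [iteratedDeriv_pow]
  have d2 : ∀ i x, iteratedDeriv i (fun y : ℝ => (1 - y) ^ k) x =
      (-1) ^ i * ((k.descFactorial i) * (1 - x) ^ (k - i)) := by
    intro i x
    rw [iteratedDeriv_comp_const_sub i (fun y : ℝ => y ^ k) 1]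
    simp only [iteratedDeriv_pow, smul_eq_mul]
  simp only [d1, d2]
  rw [Finset.mul_sum, Finset.mul_sum]
  apply Finset.sum_congr rfl
  intro i hi
  have hik : i ≤ k := by simpa [Nat.lt_succ_iff] using hi
  obtain ⟨l, rfl⟩ := Nat.exists_eq_add_of_le hik
  have hc : 1 + cos (2 * r) = 2 * cos r ^ 2 := by rw [cos_two_mul]; ring
  have hs : 1 - cos (2 * r) = 2 * (1 - cos r * cos r) := by rw [cos_two_mul]; ring
  rw [hc, hs]
  have n1 : i + l - (i + l - i) = i := by omega
  have n2 : i + l - i = l := by omega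
  have n3 : i + l + m - i = l + m := by omega
  rw [n1, n2, n3]
  have f1 : ((i + l + m).descFactorial i : ℝ) = (i.factorial) * ((i + l + m).choose i) := by
    exact_mod_cast Nat.descFactorial_eq_factorial_mul_choose _ _
  have f2 : (i.factorial : ℝ) * ((i + l).descFactorial l) = ((i + l).factorial) := by
    have := Nat.factorial_mul_descFactorial (n := i + l) (k := l) (by omega)
    rw [Nat.add_sub_cancel] at this
    exact_mod_cast this
  rw [f1]
  have f3 : ((i + l).factorial : ℝ) ≠ 0 := by positivity
  have hcm : (2 * cos r ^ 2) ^ m ≠ 0 := by positivity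
  have hpm : ((-1 : ℝ)) ^ (i + l) * (-1) ^ l = (-1) ^ i := by
    rw [pow_add, mul_assoc, ← pow_add, ← two_mul, pow_mul]; simp
  rw [← f2] at f3 ⊢
  rw [neg_pow (1 - cos r * cos r), ← hpm]
  rw [pow_add (2 * cos r ^ 2) l m, mul_pow 2 (1 - cos r * cos r) i]
  generalize hS : (1 - cos r * cos r) ^ i = S
  field_simp
  ring

lemma fh_neg_swap (a b : ℕ) (R : ℝ) : ph a b (R : ℂ) R = ph b a R R := ph_swap _ _ _ _

lemma ph_jacobi (k m : ℕ) (r : ℝ) (hr : cos r ≠ 0) :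
    ph (k + m) k (cos r : ℝ) (cos r : ℝ) = ((cos r ^ m * jacobiP k m (cos (2 * r)) : ℝ) : ℂ) := by
  rw [jacobi_eq k m r hr, ph_explicit, phE]
  push_cast
  rfl

def ezk : ℤ × ℕ ≃ ℕ × ℕ where
  toFun q := (q.2 + q.1.toNat, q.2 + (-q.1).toNat)
  invFun i := ((i.1 : ℤ) - i.2, min i.1 i.2)
  left_inv := by
    rintro ⟨n, k⟩
    ext
    · simp
    · simp; omega
  right_inv := by
    rintro ⟨a, b⟩
    ext
    · simp; omega
    · simp; omega

lemma heatTerm_eq (t r z : ℝ) (hr : cos r ≠ 0) (q : ℤ × ℕ) : heatTerm t r z q.1 q.2 =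
    (((((ezk q).1 : ℝ) + (ezk q).2 + 1) * Real.exp (-lam (ezk q).1 (ezk q).2 * t) : ℝ) : ℂ) *
      fh (ezk q).1 (ezk q).2 (cos r * cos z) (cos r * sin z) := by
  obtain ⟨n, k⟩ := q
  rw [fh_polar]
  have key := ph_jacobi k n.natAbs r hr
  have e2 : ph (ezk (n, k)).1 (ezk (n, k)).2 (cos r : ℝ) (cos r : ℝ) =
      ((cos r ^ n.natAbs * jacobiP k n.natAbs (cos (2 * r)) : ℝ) : ℂ) := by
    rw [← key]
    simp only [ezk, Equiv.coe_fn_mk]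
    rcases le_total 0 n with h | h
    · have h1 : n.toNat = n.natAbs := by omega
      have h2 : (-n).toNat = 0 := by omega
      rw [h1, h2]; simp
    · have h1 : n.toNat = 0 := by omega
      have h2 : (-n).toNat = n.natAbs := by omega
      rw [h1, h2, fh_neg_swap]; simp
  rw [e2]
  have e3 : ((ezk (n, k)).1 : ℂ) - (ezk (n, k)).2 = n := by
    have : ((ezk (n, k)).1 : ℤ) - (ezk (n, k)).2 = n := by simp [ezk]
    exact_mod_cast congrArg (Int.cast : ℤ → ℂ) this
  rw [e3]
  have e4 : ((ezk (n, k)).1 : ℝ) + (ezk (n, k)).2 = 2 * k + n.natAbs := by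
    have : (ezk (n, k)).1 + (ezk (n, k)).2 = 2 * k + n.natAbs := by simp [ezk]; omega
    exact_mod_cast this
  have e5 : lam (ezk (n, k)).1 (ezk (n, k)).2 =
      4 * (k : ℝ) * ((k : ℝ) + (n.natAbs : ℝ) + 1) + 2 * (n.natAbs : ℝ) := by
    have e6 : ((ezk (n, k)).1 : ℝ) * (ezk (n, k)).2 = k * (k + n.natAbs) := by
      simp only [ezk, Equiv.coe_fn_mk]
      rcases le_total 0 n with h | h
      · have h1 : n.toNat = n.natAbs := by omega
        have h2 : (-n).toNat = 0 := by omega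
        rw [h1, h2]; push_cast; ring
      · have h1 : n.toNat = 0 := by omega
        have h2 : (-n).toNat = n.natAbs := by omega
        rw [h1, h2]; push_cast; ring
    unfold lam
    linear_combination 4 * e6 + 2 * e4
  rw [e4, e5]
  unfold heatTerm
  push_cast
  ring

lemma ser_norm (t x y : ℝ) (ht : 0 < t) (h : x ^ 2 + y ^ 2 ≤ 1) :
    Summable (fun i : ℕ × ℕ => ((((i.1 : ℝ) + i.2 + 1) * Real.exp (-lam i.1 i.2 * t) : ℝ) : ℂ) *
      fh i.1 i.2 x y) := by
  refine Summable.of_norm_bounded (bnd_summable t ht) (fun i => ?_)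
  rw [norm_mul, Complex.norm_real, Real.norm_of_nonneg (by positivity)]
  have h1 := fh_bound' i.1 i.2 x y t ht h
  unfold bnd
  have h2 : Real.exp (-lam i.1 i.2 * t) * ‖fh i.1 i.2 x y‖ ≤
      Real.exp (-2 * (i.1 + i.2) * t) * Real.exp (1 / (2 * t)) := by
    refine (mul_le_mul_of_nonneg_left h1 (Real.exp_pos _).le).trans ?_
    rw [← Real.exp_add, ← Real.exp_add]
    apply Real.exp_le_exp.2
    unfold lam
    have : (0 : ℝ) ≤ i.1 * i.2 * t := by positivity
    linarith
  have h3 : ((i.1 : ℝ) + i.2 + 1) ≤ 2 * ((i.1 : ℝ) + i.2 + 1) ^ 3 := by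
    have : 1 ≤ (i.1 : ℝ) + i.2 + 1 := by
      have : (0 : ℝ) ≤ (i.1 : ℝ) + i.2 := by positivity
      linarith
    nlinarith [sq_nonneg ((i.1 : ℝ) + i.2)]
  calc _ = ((i.1 : ℝ) + i.2 + 1) * (Real.exp (-lam i.1 i.2 * t) * ‖fh i.1 i.2 x y‖) := by ring
    _ ≤ (2 * ((i.1 : ℝ) + i.2 + 1) ^ 3) * (Real.exp (-2 * (i.1 + i.2) * t) * Real.exp (1 / (2 * t))) := by
      gcongr
    _ = _ := by ring

lemma polar_in (r z : ℝ) : (cos r * cos z) ^ 2 + (cos r * sin z) ^ 2 ≤ 1 := by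
  have := sin_sq_add_cos_sq z
  have h2 := cos_sq_le_one r
  nlinarith

lemma heatP_eq (t r z : ℝ) (ht : 0 < t) (hr : cos r ≠ 0) :
    heatP t r z = q0 t (cos r * cos z) (cos r * sin z) := by
  have hs := ser_norm t _ _ ht (polar_in r z)
  unfold heatP q0
  have e : ∀ n k, heatTerm t r z n k = (fun i : ℕ × ℕ => ((((i.1 : ℝ) + i.2 + 1) *
    Real.exp (-lam i.1 i.2 * t) : ℝ) : ℂ) * fh i.1 i.2 (cos r * cos z) (cos r * sin z)) (ezk (n, k)) :=
    fun n k => heatTerm_eq t r z hr (n, k)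
  simp only [e]
  rw [← Summable.tsum_prod (f := fun q : ℤ × ℕ => (fun i : ℕ × ℕ => ((((i.1 : ℝ) + i.2 + 1) *
    Real.exp (-lam i.1 i.2 * t) : ℝ) : ℂ) * fh i.1 i.2 (cos r * cos z) (cos r * sin z)) (ezk q))
    (ezk.summable_iff.2 hs), ezk.tsum_eq (fun i : ℕ × ℕ => ((((i.1 : ℝ) + i.2 + 1) *
    Real.exp (-lam i.1 i.2 * t) : ℝ) : ℂ) * fh i.1 i.2 (cos r * cos z) (cos r * sin z)),
    Complex.re_tsum hs]
  congr 1
  ext i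
  unfold P0 sg
  rw [Complex.re_ofReal_mul, Complex.re_ofReal_mul]; ring

/-- chain rule data in polar coordinates -/
lemma q0_r (t : ℝ) (ht : 0 < t) (z r : ℝ) : HasDerivAt (fun r => q0 t (cos r * cos z) (cos r * sin z))
    (-sin r * cos z * q1 t (cos r * cos z) (cos r * sin z) +
      -sin r * sin z * q2 t (cos r * cos z) (cos r * sin z)) r := by
  have hb : ∀ u v : ℝ, |-sin u * cos v| ≤ 1 ∧ |-sin u * sin v| ≤ 1 := by
    intro u v
    rw [abs_mul, abs_mul, abs_neg]
    exact ⟨mul_le_one₀ (abs_sin_le_one _) (abs_nonneg _) (abs_cos_le_one _),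
      mul_le_one₀ (abs_sin_le_one _) (abs_nonneg _) (abs_sin_le_one _)⟩
  exact q0_curve t ht (fun r => cos r * cos z) (fun r => cos r * sin z) (fun r => -sin r * cos z)
    (fun r => -sin r * sin z) (fun s => (hasDerivAt_cos s).mul_const _)
    (fun s => (hasDerivAt_cos s).mul_const _) (fun s => polar_in s z) (fun s => (hb s z).1)
    (fun s => (hb s z).2) r

lemma q0_z (t : ℝ) (ht : 0 < t) (r z : ℝ) : HasDerivAt (fun z => q0 t (cos r * cos z) (cos r * sin z))
    (cos r * -sin z * q1 t (cos r * cos z) (cos r * sin z) +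
      cos r * cos z * q2 t (cos r * cos z) (cos r * sin z)) z := by
  have hb : ∀ u v : ℝ, |cos u * -sin v| ≤ 1 ∧ |cos u * cos v| ≤ 1 := by
    intro u v
    rw [abs_mul, abs_mul, abs_neg]
    exact ⟨mul_le_one₀ (abs_cos_le_one _) (abs_nonneg _) (abs_sin_le_one _),
      mul_le_one₀ (abs_cos_le_one _) (abs_nonneg _) (abs_cos_le_one _)⟩
  exact q0_curve t ht (fun z => cos r * cos z) (fun z => cos r * sin z) (fun z => cos r * -sin z)
    (fun z => cos r * cos z) (fun s => (hasDerivAt_cos s).const_mul _)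
    (fun s => (hasDerivAt_sin s).const_mul _) (fun s => polar_in r s) (fun s => (hb r s).1)
    (fun s => (hb r s).2) z

noncomputable def FF (t : ℝ) (p : ℝ × ℝ) : ℝ :=
  (1 - p.1 ^ 2 - p.2 ^ 2) * (q1 t p.1 p.2 ^ 2 + q2 t p.1 p.2 ^ 2) / q0 t p.1 p.2

lemma Cconst_eq (t : ℝ) (ht : 0 < t) (hi : MeasureTheory.IntegrableOn (FF t) DD) :
    Cconst t = 1 / (2 * π) * ∫ p in DD, FF t p := by
  have h := polar_P1 (FF t) hi
  unfold Cconst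
  have e : (∫ r in (0 : ℝ)..(π / 2), ∫ z in (-π)..π,
      ((deriv (fun r' => heatP t r' z) r) ^ 2 +
          tan r ^ 2 * (deriv (fun z' => heatP t r z') z) ^ 2) / heatP t r z * sin (2 * r)) =
      ∫ r in (0 : ℝ)..(π / 2), ∫ z in (-π)..π, FF t (cos r * cos z, cos r * sin z) * sin (2 * r) := by
    rw [intervalIntegral.integral_of_le (by positivity), intervalIntegral.integral_of_le (by positivity),
      MeasureTheory.integral_Ioc_eq_integral_Ioo, MeasureTheory.integral_Ioc_eq_integral_Ioo]
    apply MeasureTheory.setIntegral_congr_fun measurableSet_Ioo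
    intro r hr
    have hc : 0 < cos r := cos_pos_of_mem_Ioo ⟨by linarith [hr.1, hr.2], hr.2⟩
    apply intervalIntegral.integral_congr
    intro z _
    simp only
    rw [heatP_eq t r z ht hc.ne']
    have d1 : deriv (fun r' => heatP t r' z) r = (-sin r * cos z * q1 t (cos r * cos z) (cos r * sin z) +
        -sin r * sin z * q2 t (cos r * cos z) (cos r * sin z)) := by
      have : (fun r' => heatP t r' z) =ᶠ[nhds r] fun r => q0 t (cos r * cos z) (cos r * sin z) := by
        filter_upwards [continuous_cos.continuousAt.eventually_ne hc.ne'] with r' hr'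
        exact heatP_eq t r' z ht hr'
      rw [this.deriv_eq]
      exact (q0_r t ht z r).deriv
    have d2 : deriv (fun z' => heatP t r z') z = (cos r * -sin z * q1 t (cos r * cos z) (cos r * sin z) +
        cos r * cos z * q2 t (cos r * cos z) (cos r * sin z)) := by
      have : (fun z' => heatP t r z') = fun z => q0 t (cos r * cos z) (cos r * sin z) := by
        ext z'; exact heatP_eq t r z' ht hc.ne'
      rw [this]
      exact (q0_z t ht r z).deriv
    rw [d1, d2]
    unfold FF
    simp only
    congr 2
    rw [tan_eq_sin_div_cos]
    have s1 := sin_sq_add_cos_sq r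
    have s2 := sin_sq_add_cos_sq z
    generalize q1 t (cos r * cos z) (cos r * sin z) = A
    generalize q2 t (cos r * cos z) (cos r * sin z) = B
    have e1 : 1 - (cos r * cos z) ^ 2 - (cos r * sin z) ^ 2 = sin r ^ 2 := by
      linear_combination (-cos r ^ 2) * s2 - s1
    rw [e1]
    field_simp
    linear_combination (sin r ^ 2 * (A ^ 2 + B ^ 2)) * s2
  rw [e, h]
  field_simp
  ring
end

section
open Real

lemma fh_conj (a b : ℕ) (x y : ℝ) : (starRingEnd ℂ) (fh a b x y) = fh b a x y := by
  unfold fh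
  rw [ph_conj, ph_swap]
  simp [sub_eq_add_neg]

lemma fh_re (a b : ℕ) (x y : ℝ) : ((fh a b x y).re : ℂ) = (fh a b x y + fh b a x y) / 2 := by
  rw [Complex.re_eq_add_conj, fh_conj]

lemma q0_contOn (t : ℝ) (ht : 0 < t) : ContinuousOn (fun p : ℝ × ℝ => q0 t p.1 p.2) DD :=
  good_cont good0 t ht
lemma q1_contOn (t : ℝ) (ht : 0 < t) : ContinuousOn (fun p : ℝ × ℝ => q1 t p.1 p.2) DD :=
  good_cont good1 t ht
lemma q2_contOn (t : ℝ) (ht : 0 < t) : ContinuousOn (fun p : ℝ × ℝ => q2 t p.1 p.2) DD :=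
  good_cont good2 t ht

lemma P0_fh (i : ℕ × ℕ) (t : ℝ) (c : ℕ × ℕ) :
    ∫ p in DD, (P0 i t p.1 p.2 : ℂ) * fh c.1 c.2 p.1 p.2 =
      (if i = c.swap then (π : ℂ) * Real.exp (-lam c.1 c.2 * t) / 2 else 0) +
      (if i = c then (π : ℂ) * Real.exp (-lam c.1 c.2 * t) / 2 else 0) := by
  have e : ∀ p : ℝ × ℝ, (P0 i t p.1 p.2 : ℂ) * fh c.1 c.2 p.1 p.2 =
      (Real.exp (-lam i.1 i.2 * t) * ((i.1 : ℂ) + i.2 + 1) / 2) * (fh i.1 i.2 p.1 p.2 * fh c.1 c.2 p.1 p.2) +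
      (Real.exp (-lam i.1 i.2 * t) * ((i.1 : ℂ) + i.2 + 1) / 2) * (fh i.2 i.1 p.1 p.2 * fh c.1 c.2 p.1 p.2) := by
    intro p
    unfold P0 sg
    rw [Complex.re_ofReal_mul]
    push_cast
    rw [fh_re]; ring
  simp only [e]
  rw [MeasureTheory.integral_add ((fh_int _ _ _ _).const_mul _) ((fh_int _ _ _ _).const_mul _),
    MeasureTheory.integral_const_mul, MeasureTheory.integral_const_mul]
  have hn : (c.1 : ℂ) + c.2 + 1 ≠ 0 := by exact_mod_cast Nat.succ_ne_zero (c.1 + c.2)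
  congr 1
  · split_ifs with h
    · subst h
      have : (∫ p in DD, fh c.swap.1 c.swap.2 p.1 p.2 * fh c.1 c.2 p.1 p.2) = nn c.2 c.1 := rfl
      rw [this, nn_eq]
      have h2 : lam c.swap.1 c.swap.2 = lam c.1 c.2 := by simp [lam]; ring
      rw [h2]
      have hn' : (c.2 : ℂ) + c.1 + 1 ≠ 0 := by rwa [add_comm (c.2 : ℂ)]
      simp only [Prod.fst_swap, Prod.snd_swap]
      field_simp
    · rw [orth _ _ _ _ (fun hh => h (by ext <;> simp [hh.1, hh.2])), mul_zero]
  · split_ifs with h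
    · subst h
      have : (∫ p in DD, fh i.2 i.1 p.1 p.2 * fh i.1 i.2 p.1 p.2) = nn i.2 i.1 := rfl
      rw [this, nn_eq]
      have hn' : (i.2 : ℂ) + i.1 + 1 ≠ 0 := by rwa [add_comm (i.2 : ℂ)]
      field_simp; ring
    · rw [orth _ _ _ _ (fun hh => h (by ext <;> simp [hh.1, hh.2])), mul_zero]

lemma q0_fh (t : ℝ) (ht : 0 < t) (c : ℕ × ℕ) :
    ∫ p in DD, (q0 t p.1 p.2 : ℂ) * fh c.1 c.2 p.1 p.2 = (π : ℂ) * Real.exp (-lam c.1 c.2 * t) := by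
  have hc0 := fh_cont c.1 c.2
  have := MeasureTheory.hasSum_integral_of_dominated_convergence (μ := MeasureTheory.volume.restrict DD)
    (F := fun i (p : ℝ × ℝ) => (P0 i t p.1 p.2 : ℂ) * fh c.1 c.2 p.1 p.2)
    (f := fun p => (q0 t p.1 p.2 : ℂ) * fh c.1 c.2 p.1 p.2)
    (fun i p => bnd t i * ‖fh c.1 c.2 p.1 p.2‖)
    (fun i => by
      have := good0.1 i t
      exact (by fun_prop : Continuous fun p : ℝ × ℝ => (P0 i t p.1 p.2 : ℂ) * fh c.1 c.2 p.1 p.2).aestronglyMeasurable)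
    (fun i => by
      refine (MeasureTheory.ae_restrict_mem DD_meas).mono fun p hp => ?_
      rw [norm_mul, Complex.norm_real]
      gcongr
      exact P0_bnd i t t _ _ ht le_rfl hp)
    (by
      refine Filter.Eventually.of_forall fun p => ?_
      exact (bnd_summable t ht).mul_right _)
    (by
      simp only [tsum_mul_right]
      exact ((by fun_prop : Continuous fun p : ℝ × ℝ => (∑' i, bnd t i) * ‖fh c.1 c.2 p.1 p.2‖).continuousOn.integrableOn_compact DD_compact))
    (by
      refine (MeasureTheory.ae_restrict_mem DD_meas).mono fun p hp => ?_
      apply HasSum.mul_right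
      exact_mod_cast (good_summable good0 t _ _ ht hp).hasSum)
  rw [← this.tsum_eq]
  simp only [P0_fh]
  rw [Summable.tsum_add, tsum_ite_eq, tsum_ite_eq]
  · ring
  · exact (hasSum_ite_eq _ _).summable
  · exact (hasSum_ite_eq _ _).summable

lemma q0_int (t : ℝ) (ht : 0 < t) (g : ℝ × ℝ → ℂ) (hg : ContinuousOn g DD) :
    MeasureTheory.IntegrableOn (fun p : ℝ × ℝ => (q0 t p.1 p.2 : ℂ) * g p) DD := by
  exact ((Complex.continuous_ofReal.comp_continuousOn (q0_contOn t ht)).mul hg).integrableOn_compact DD_compact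

lemma q0_comb (t : ℝ) (ht : 0 < t) (S : Finset (ℕ × ℕ)) (c : ℕ × ℕ → ℂ) :
    ∫ p in DD, (q0 t p.1 p.2 : ℂ) * ∑ i ∈ S, c i * fh i.1 i.2 p.1 p.2 =
      π * ∑ i ∈ S, c i * Real.exp (-lam i.1 i.2 * t) := by
  have e : ∀ p : ℝ × ℝ, (q0 t p.1 p.2 : ℂ) * ∑ i ∈ S, c i * fh i.1 i.2 p.1 p.2 =
      ∑ i ∈ S, c i * ((q0 t p.1 p.2 : ℂ) * fh i.1 i.2 p.1 p.2) := by
    intro p; rw [Finset.mul_sum]; apply Finset.sum_congr rfl; intros; ring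
  simp only [e]
  rw [MeasureTheory.integral_finsetSum _ (fun i _ => ((q0_int t ht _ (fh_cont i.1 i.2).continuousOn).const_mul _)),
    Finset.mul_sum]
  apply Finset.sum_congr rfl
  intro i _
  rw [MeasureTheory.integral_const_mul, q0_fh t ht]; ring

lemma q0_pos_comb (t : ℝ) (ht : 0 < t) (S : Finset (ℕ × ℕ)) (c : ℕ × ℕ → ℂ)
    (h : ∀ x y : ℝ, x ^ 2 + y ^ 2 ≤ 1 → 0 ≤ (∑ i ∈ S, c i * fh i.1 i.2 x y).re) :
    0 ≤ (∫ p in DD, (q0 t p.1 p.2 : ℂ) * ∑ i ∈ S, c i * fh i.1 i.2 p.1 p.2).re := by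
  rw [q0_comb t ht, Complex.re_ofReal_mul]
  apply mul_nonneg pi_pos.le
  have H := HJ'_sum S (fun i => sg i.1 i.2 (c i) (fh i.1 i.2)) (fun i => sg i.1 i.2 (c i) (fhx i.1 i.2))
    (fun i => sg i.1 i.2 (c i) (fhy i.1 i.2)) (fun i => HJ'_single i.1 i.2 (c i))
  obtain ⟨_, _, _, _, _, _, _, H⟩ := H
  have := nonneg_pres H 0 t ht.le (by
    intro x y hxy
    have := h x y hxy
    rw [Complex.re_sum] at this
    simpa [sg] using this) 1 0 (by norm_num)
  simp only [sg, fh] at this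
  rw [Complex.re_sum]
  refine this.trans_eq ?_
  apply Finset.sum_congr rfl
  intro i _
  rw [mul_comm (c i) ((Real.exp _ : ℝ) : ℂ), Complex.re_ofReal_mul]
  simp [ph_one]

/-- span of the eigenfunctions -/
def MM : Submodule ℂ (ℝ × ℝ → ℂ) :=
  Submodule.span ℂ (Set.range fun i : ℕ × ℕ => fun p : ℝ × ℝ => fh i.1 i.2 p.1 p.2)

lemma fh_mem (a b : ℕ) : (fun p : ℝ × ℝ => fh a b p.1 p.2) ∈ MM :=
  Submodule.subset_span ⟨(a, b), rfl⟩

def AA : Subalgebra ℂ (ℝ × ℝ → ℂ) where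
  carrier := {f | ∀ m ∈ MM, f * m ∈ MM}
  mul_mem' := by
    intro f g hf hg m hm
    rw [mul_assoc]; exact hf _ (hg _ hm)
  add_mem' := by
    intro f g hf hg m hm
    rw [add_mul]; exact MM.add_mem (hf _ hm) (hg _ hm)
  algebraMap_mem' := by
    intro r m hm
    rw [← Algebra.smul_def]; exact MM.smul_mem _ hm

lemma AA_sub (f : ℝ × ℝ → ℂ) (hf : f ∈ AA) : f ∈ MM := by
  have := hf _ (fh_mem 0 0)
  convert this using 1
  ext p
  simp [fh, ph_zero_right]

lemma AA_of (f : ℝ × ℝ → ℂ) (h : ∀ a b : ℕ, (fun p : ℝ × ℝ => f p * fh a b p.1 p.2) ∈ MM) : f ∈ AA := by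
  intro m hm
  induction hm using Submodule.span_induction with
  | mem x hx => obtain ⟨i, rfl⟩ := hx; exact h i.1 i.2
  | zero => rw [mul_zero]; exact MM.zero_mem
  | add x y _ _ hx hy => rw [mul_add]; exact MM.add_mem hx hy
  | smul c x _ hx => rw [mul_smul_comm]; exact MM.smul_mem _ hx

lemma X_mem : (fun p : ℝ × ℝ => (p.1 + p.2 * Complex.I : ℂ)) ∈ AA := by
  apply AA_of
  intro a b
  have hn : (a : ℂ) + b + 1 ≠ 0 := by exact_mod_cast Nat.succ_ne_zero (a + b)
  have : (fun p : ℝ × ℝ => (p.1 + p.2 * Complex.I : ℂ) * fh a b p.1 p.2) =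
      ((a + 1 : ℂ) / (a + b + 1)) • (fun p : ℝ × ℝ => fh (a + 1) b p.1 p.2) +
      ((b : ℂ) / (a + b + 1)) • (fun p : ℝ × ℝ => if b = 0 then 0 else fh a (b - 1) p.1 p.2) := by
    ext p
    have := fh_R a b p.1 p.2
    simp only [Pi.add_apply, Pi.smul_apply, smul_eq_mul]
    field_simp
    linear_combination this
  rw [this]
  refine MM.add_mem (MM.smul_mem _ (fh_mem _ _)) (MM.smul_mem _ ?_)
  split_ifs with hb
  · exact MM.zero_mem
  · exact fh_mem _ _

lemma Y_mem : (fun p : ℝ × ℝ => (p.1 - p.2 * Complex.I : ℂ)) ∈ AA := by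
  apply AA_of
  intro a b
  have hn : (a : ℂ) + b + 1 ≠ 0 := by exact_mod_cast Nat.succ_ne_zero (a + b)
  have : (fun p : ℝ × ℝ => (p.1 - p.2 * Complex.I : ℂ) * fh a b p.1 p.2) =
      ((b + 1 : ℂ) / (a + b + 1)) • (fun p : ℝ × ℝ => fh a (b + 1) p.1 p.2) +
      ((a : ℂ) / (a + b + 1)) • (fun p : ℝ × ℝ => if a = 0 then 0 else fh (a - 1) b p.1 p.2) := by
    ext p
    have := congrArg (starRingEnd ℂ) (fh_R b a p.1 p.2)
    have h3 : (starRingEnd ℂ) (if a = 0 then 0 else fh b (a - 1) p.1 p.2) =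
      if a = 0 then 0 else fh (a - 1) b p.1 p.2 := by split_ifs <;> simp [fh_conj]
    simp only [map_mul, map_add, map_one, map_natCast, fh_conj, Complex.conj_ofReal, Complex.conj_I, h3] at this
    simp only [Pi.add_apply, Pi.smul_apply, smul_eq_mul]
    field_simp
    linear_combination this
  rw [this]
  refine MM.add_mem (MM.smul_mem _ (fh_mem _ _)) (MM.smul_mem _ ?_)
  split_ifs with hb
  · exact MM.zero_mem
  · exact fh_mem _ _

lemma x_mem : (fun p : ℝ × ℝ => (p.1 : ℂ)) ∈ AA := by
  have := AA.smul_mem (AA.add_mem X_mem Y_mem) (1 / 2 : ℂ)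
  convert this using 1
  ext p; simp; ring

lemma y_mem : (fun p : ℝ × ℝ => (p.2 : ℂ)) ∈ AA := by
  have := AA.smul_mem (AA.sub_mem X_mem Y_mem) (1 / (2 * Complex.I) : ℂ)
  convert this using 1
  ext p; simp; field_simp; rw [Complex.I_sq]; ring

lemma MM_comb (f : ℝ × ℝ → ℂ) (hf : f ∈ MM) : ∃ (S : Finset (ℕ × ℕ)) (c : ℕ × ℕ → ℂ),
    ∀ p, f p = ∑ i ∈ S, c i * fh i.1 i.2 p.1 p.2 := by
  obtain ⟨c, rfl⟩ := (Finsupp.mem_span_range_iff_exists_finsupp).1 hf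
  refine ⟨c.support, c, fun p => ?_⟩
  simp [Finsupp.sum, Finset.sum_apply]

def BB : Subalgebra ℝ C(DD, ℝ) where
  carrier := {g | ∃ F ∈ AA, ∀ p : DD, F p = (g p : ℂ)}
  mul_mem' := by
    rintro f g ⟨F, hF, h1⟩ ⟨G, hG, h2⟩
    exact ⟨F * G, AA.mul_mem hF hG, fun p => by simp [h1, h2]⟩
  add_mem' := by
    rintro f g ⟨F, hF, h1⟩ ⟨G, hG, h2⟩
    exact ⟨F + G, AA.add_mem hF hG, fun p => by simp [h1, h2]⟩
  algebraMap_mem' := by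
    intro r
    exact ⟨algebraMap ℂ _ (r : ℂ), AA.algebraMap_mem _, fun p => by simp⟩

lemma BB_sep : BB.SeparatesPoints := by
  intro p q hpq
  by_cases h : p.1.1 = q.1.1
  · refine ⟨_, ⟨⟨fun p : DD => p.1.2, by fun_prop⟩, ⟨_, y_mem, fun p => rfl⟩, rfl⟩, ?_⟩
    intro h2
    exact hpq (Subtype.ext (Prod.ext h h2))
  · exact ⟨_, ⟨⟨fun p : DD => p.1.1, by fun_prop⟩, ⟨_, x_mem, fun p => rfl⟩, rfl⟩, h⟩

lemma BB_pos (t : ℝ) (ht : 0 < t) (g : C(DD, ℝ)) (hg : g ∈ BB) (G : ℝ × ℝ → ℝ)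
    (hG : ∀ p : DD, G p = g p) : 0 ≤ ∫ p in DD, q0 t p.1 p.2 * G p ^ 2 := by
  obtain ⟨F, hF, h⟩ := hg
  obtain ⟨S, c, hS⟩ := MM_comb _ (AA_sub _ (AA.mul_mem hF hF))
  have key : ∀ p ∈ DD, ∑ i ∈ S, c i * fh i.1 i.2 p.1 p.2 = ((G p ^ 2 : ℝ) : ℂ) := by
    intro p hp
    rw [← hS p]
    have := h ⟨p, hp⟩
    rw [← hG ⟨p, hp⟩] at this
    simp only at this
    simp [this, sq]
  have := q0_pos_comb t ht S c (by
    intro x y hxy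
    rw [key (x, y) hxy, Complex.ofReal_re]; positivity)
  have e : (∫ p in DD, (q0 t p.1 p.2 : ℂ) * ∑ i ∈ S, c i * fh i.1 i.2 p.1 p.2) =
      ((∫ p in DD, q0 t p.1 p.2 * G p ^ 2 : ℝ) : ℂ) := by
    rw [← integral_complex_ofReal]
    apply MeasureTheory.setIntegral_congr_fun DD_meas
    intro p hp
    simp only
    rw [key p hp]; push_cast; rfl
  rw [e, Complex.ofReal_re] at this
  exact this

lemma q0_nonneg (t : ℝ) (ht : 0 < t) : ∀ p ∈ DD, 0 ≤ q0 t p.1 p.2 := by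
  have : CompactSpace DD := isCompact_iff_compactSpace.1 DD_compact
  have hq := q0_contOn t ht
  set H : ℝ × ℝ → ℝ := fun p => √(max (-q0 t p.1 p.2) 0) with hH
  have hHc : ContinuousOn H DD := (hq.neg.sup continuousOn_const).sqrt
  have hHi : MeasureTheory.IntegrableOn (fun p => q0 t p.1 p.2 * H p ^ 2) DD :=
    (hq.mul (hHc.pow 2)).integrableOn_compact DD_compact
  obtain ⟨K, hK⟩ := DD_compact.exists_bound_of_continuousOn hHc
  obtain ⟨L, hL⟩ := DD_compact.exists_bound_of_continuousOn hq
  have hK0 : 0 ≤ K := (norm_nonneg _).trans (hK (0, 0) (by simp [DD]))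
  have hL0 : 0 ≤ L := (norm_nonneg _).trans (hL (0, 0) (by simp [DD]))
  have main : ∀ ε : ℝ, 0 < ε → ε < 1 → -(L * (ε * (2 * K + 1)) * MeasureTheory.volume.real DD) ≤
      ∫ p in DD, q0 t p.1 p.2 * H p ^ 2 := by
    intro ε hε hε1
    obtain ⟨⟨g, hg⟩, hgn⟩ := ContinuousMap.exists_mem_subalgebra_near_continuous_of_separatesPoints BB BB_sep
      (fun p : DD => H p) hHc.domRestrict ε hε
    classical
    set G : ℝ × ℝ → ℝ := fun p => if hp : p ∈ DD then g ⟨p, hp⟩ else 0 with hGd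
    have hG : ∀ p : DD, G p = g p := by intro p; simp [hGd]
    have hGc : ContinuousOn G DD := by
      rw [continuousOn_iff_continuous_domRestrict]
      convert g.continuous using 1
      ext p; exact hG p
    have h1 := BB_pos t ht g hg G hG
    have hGi : MeasureTheory.IntegrableOn (fun p => q0 t p.1 p.2 * G p ^ 2) DD :=
      (hq.mul (hGc.pow 2)).integrableOn_compact DD_compact
    have h2 : |(∫ p in DD, q0 t p.1 p.2 * G p ^ 2) - ∫ p in DD, q0 t p.1 p.2 * H p ^ 2| ≤
        L * (ε * (2 * K + 1)) * MeasureTheory.volume.real DD := by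
      rw [← MeasureTheory.integral_sub hGi hHi, ← Real.norm_eq_abs]
      apply MeasureTheory.norm_setIntegral_le_of_norm_le_const (lt_top_iff_ne_top.2 DD_fin.ne)
      intro p hp
      have a1 : |G p - H p| < ε := by rw [hG ⟨p, hp⟩]; exact hgn ⟨p, hp⟩
      have a2 := hK p hp
      have a3 := hL p hp
      have e : q0 t p.1 p.2 * G p ^ 2 - q0 t p.1 p.2 * H p ^ 2 =
        q0 t p.1 p.2 * ((G p - H p) * ((G p - H p) + 2 * H p)) := by ring
      rw [e, norm_mul, norm_mul]
      gcongr
      · exact a1.le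
      · refine (norm_add_le _ _).trans ?_
        rw [norm_mul, Real.norm_ofNat, Real.norm_eq_abs]
        linarith
    rw [abs_le] at h2
    linarith [h2.2]
  have hlim : 0 ≤ ∫ p in DD, q0 t p.1 p.2 * H p ^ 2 := by
    have ht : Filter.Tendsto (fun ε : ℝ => -(L * (ε * (2 * K + 1)) * MeasureTheory.volume.real DD))
        (nhdsWithin 0 (Set.Ioi 0)) (nhds 0) := by
      have : Continuous (fun ε : ℝ => -(L * (ε * (2 * K + 1)) * MeasureTheory.volume.real DD)) := by fun_prop
      have := this.tendsto 0
      simp only [zero_mul, mul_zero, neg_zero] at this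
      exact this.mono_left nhdsWithin_le_nhds
    apply le_of_tendsto ht
    filter_upwards [Ioo_mem_nhdsGT (zero_lt_one)] with ε hε
    exact main ε hε.1 hε.2
  have e : ∀ p, q0 t p.1 p.2 * H p ^ 2 = -(max (-q0 t p.1 p.2) 0) ^ 2 := by
    intro p
    simp only [hH]
    rw [Real.sq_sqrt (le_max_right _ _)]
    rcases le_total (q0 t p.1 p.2) 0 with h | h
    · rw [max_eq_left (by linarith)]; ring
    · rw [max_eq_right (by linarith)]; ring
  simp only [e] at hlim
  rw [MeasureTheory.integral_neg] at hlim
  have := DD_eq_zero_of_integral (fun p => (max (-q0 t p.1 p.2) 0) ^ 2)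
    ((hq.neg.sup continuousOn_const).pow 2) (fun p _ => by positivity) (by linarith)
  intro p hp
  have h1 := this p hp
  have h2 := pow_eq_zero_iff (two_ne_zero) |>.1 h1
  have := le_max_left (-q0 t p.1 p.2) 0
  rw [h2] at this
  linarith
end

section
open Real MeasureTheory Filter

lemma polar_exists (p : ℝ × ℝ) (hp : p ∈ DD) : ∃ r z : ℝ, p = (cos r * cos z, cos r * sin z) := by
  set w : ℂ := ⟨p.1, p.2⟩ with hw
  have h2 : ‖w‖ ^ 2 = p.1 ^ 2 + p.2 ^ 2 := by
    rw [← Complex.normSq_eq_norm_sq, Complex.normSq_apply]; simp [hw]; ring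
  have hp' : p.1 ^ 2 + p.2 ^ 2 ≤ 1 := hp
  have h1 : ‖w‖ ≤ 1 := by nlinarith [norm_nonneg w]
  refine ⟨arccos ‖w‖, w.arg, ?_⟩
  rw [Real.cos_arccos (by linarith [norm_nonneg w]) h1]
  ext
  · simp only [Complex.norm_mul_cos_arg, hw]
  · simp only [Complex.norm_mul_sin_arg, hw]

lemma num_zero (t : ℝ) (ht : 0 < t) (p : ℝ × ℝ) (hp : p ∈ DD) (h0 : q0 t p.1 p.2 = 0) :
    (1 - p.1 ^ 2 - p.2 ^ 2) * (q1 t p.1 p.2 ^ 2 + q2 t p.1 p.2 ^ 2) = 0 := by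
  have hr : ∀ r z, q0 t (cos r * cos z) (cos r * sin z) = 0 →
      (-sin r * cos z * q1 t (cos r * cos z) (cos r * sin z) +
      -sin r * sin z * q2 t (cos r * cos z) (cos r * sin z)) = 0 := by
    intro r z h
    refine IsLocalMin.hasDerivAt_eq_zero (Filter.Eventually.of_forall fun r' => ?_) (q0_r t ht z r)
    simp only [h]
    exact q0_nonneg t ht (cos r' * cos z, cos r' * sin z) (polar_in r' z)
  have hz : ∀ r z, q0 t (cos r * cos z) (cos r * sin z) = 0 →
      (cos r * -sin z * q1 t (cos r * cos z) (cos r * sin z) +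
      cos r * cos z * q2 t (cos r * cos z) (cos r * sin z)) = 0 := by
    intro r z h
    refine IsLocalMin.hasDerivAt_eq_zero (Filter.Eventually.of_forall fun z' => ?_) (q0_z t ht r z)
    simp only [h]
    exact q0_nonneg t ht (cos r * cos z', cos r * sin z') (polar_in r z')
  obtain ⟨r, z, rfl⟩ := polar_exists p hp
  simp only at *
  by_cases hc : cos r = 0
  · have a1 := hr r 0 (by simpa [hc] using h0)
    have a2 := hr r (π / 2) (by simpa [hc] using h0)
    have hs : sin r ≠ 0 := by
      intro h; have := sin_sq_add_cos_sq r; rw [h, hc] at this; norm_num at this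
    simp [hc, hs] at a1 a2 ⊢
    rw [a1, a2]; simp
  · have a1 := hr r z h0
    have a2 := hz r z h0
    generalize q1 t (cos r * cos z) (cos r * sin z) = A at *
    generalize q2 t (cos r * cos z) (cos r * sin z) = B at *
    have b2 : -sin z * A + cos z * B = 0 := by
      apply mul_left_cancel₀ hc; linear_combination a2
    have s1 := sin_sq_add_cos_sq r
    have s2 := sin_sq_add_cos_sq z
    have e1 : 1 - (cos r * cos z) ^ 2 - (cos r * sin z) ^ 2 = sin r ^ 2 := by
      linear_combination (-cos r ^ 2) * s2 - s1
    rw [e1]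
    have e2 : A ^ 2 + B ^ 2 = (cos z * A + sin z * B) ^ 2 + (-sin z * A + cos z * B) ^ 2 := by
      linear_combination (-(A ^ 2 + B ^ 2)) * s2
    rw [e2, b2]
    linear_combination (-(sin r * (cos z * A + sin z * B))) * a1

noncomputable def FE (ε t : ℝ) (p : ℝ × ℝ) : ℝ :=
  (1 - p.1 ^ 2 - p.2 ^ 2) * (q1 t p.1 p.2 ^ 2 + q2 t p.1 p.2 ^ 2) / (ε + q0 t p.1 p.2)
noncomputable def EE (ε t : ℝ) (p : ℝ × ℝ) : ℝ := (ε + q0 t p.1 p.2) * log (ε + q0 t p.1 p.2)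

lemma xlogx_bound (x : ℝ) (hx : 0 ≤ x) : |x * log x| ≤ 1 + x ^ 2 := by
  rcases hx.eq_or_lt with rfl | h
  · simp
  rw [abs_le]
  have h1 := Real.log_le_sub_one_of_pos h
  have h2 := Real.one_sub_inv_le_log_of_pos h
  constructor
  · have : x * (1 - x⁻¹) ≤ x * log x := by gcongr
    rw [mul_sub, mul_inv_cancel₀ h.ne'] at this
    nlinarith
  · nlinarith

lemma sum_bnd {P} (hP : Goodser P) (t : ℝ) (ht : 0 < t) (S : Finset (ℕ × ℕ)) (p : ℝ × ℝ) (hp : p ∈ DD) :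
    |∑ i ∈ S, P i t p.1 p.2| ≤ ∑' i, bnd t i := by
  refine (Finset.abs_sum_le_sum_abs _ _).trans ?_
  refine (Finset.sum_le_sum fun i _ => hP.2 i t t p.1 p.2 ht le_rfl hp).trans ?_
  exact (bnd_summable t ht).sum_le_tsum _ (fun i _ => bnd_nonneg t i)

lemma tsum_bnd {P} (hP : Goodser P) (t : ℝ) (ht : 0 < t) (p : ℝ × ℝ) (hp : p ∈ DD) :
    |∑' i, P i t p.1 p.2| ≤ ∑' i, bnd t i := by
  rw [← Real.norm_eq_abs]
  exact tsum_of_norm_bounded (bnd_summable t ht).hasSum (fun i => hP.2 i t t p.1 p.2 ht le_rfl hp)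

lemma sandwich_eps (ε t0 t1 : ℝ) (hε : 0 < ε) (h0 : 0 < t0) (h01 : t0 ≤ t1) :
    (∫ p in DD, FE ε t1 p) ≤ (∫ p in DD, FE ε t0 p) ∧
    (t1 - t0) * (∫ p in DD, FE ε t1 p) ≤ (∫ p in DD, EE ε t0 p) - (∫ p in DD, EE ε t1 p) ∧
    (∫ p in DD, EE ε t0 p) - (∫ p in DD, EE ε t1 p) ≤ (t1 - t0) * (∫ p in DD, FE ε t0 p) := by
  set U : Finset (ℕ × ℕ) → ℝ → ℝ → ℝ → ℝ := fun S t x y => ε + ∑ i ∈ S, P0 i t x y with hU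
  set Ux : Finset (ℕ × ℕ) → ℝ → ℝ → ℝ → ℝ := fun S t x y => 0 + ∑ i ∈ S, P1 i t x y with hUx
  set Uy : Finset (ℕ × ℕ) → ℝ → ℝ → ℝ → ℝ := fun S t x y => 0 + ∑ i ∈ S, P2 i t x y with hUy
  have HJS : ∀ S, HJ' (U S) (Ux S) (Uy S) := fun S => HJ'_add (HJ'_const ε)
    (HJ'_sum S P0 P1 P2 (fun i => HJ'_single i.1 i.2 _))
  have hpos : ∀ᶠ S : Finset (ℕ × ℕ) in atTop, ∀ t x y, t0 ≤ t → x ^ 2 + y ^ 2 ≤ 1 → ε / 2 ≤ U S t x y := by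
    filter_upwards [good_unif good0 t0 h0 (ε / 2) (by linarith)] with S hS t x y h1 h2
    have a1 := hS t x y h1 h2
    have a2 : 0 ≤ ∑' i, P0 i t x y := q0_nonneg t (h0.trans_le h1) (x, y) h2
    rw [abs_lt] at a1
    simp only [hU]; linarith
  have meas : ∀ P, Goodser P → ∀ S : Finset (ℕ × ℕ), ∀ t,
      Continuous (fun p : ℝ × ℝ => ∑ i ∈ S, P i t p.1 p.2) := fun P hP S t =>
    continuous_finsetSum _ (fun i _ => hP.1 i t)
  -- limits
  have limF : ∀ t, t0 ≤ t → Tendsto (fun S => ∫ p in DD, (1 - p.1 ^ 2 - p.2 ^ 2) *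
      (Ux S t p.1 p.2 ^ 2 + Uy S t p.1 p.2 ^ 2) / U S t p.1 p.2) atTop (nhds (∫ p in DD, FE ε t p)) := by
    intro t ht
    have tp : 0 < t := h0.trans_le ht
    set B := ∑' i, bnd t i
    have m0 := meas _ good0
    have m1 := meas _ good1
    have m2 := meas _ good2
    refine tendsto_integral_filter_of_dominated_convergence (fun _ => (2 * B ^ 2) / (ε / 2)) ?_ ?_ ?_ ?_
    · refine Eventually.of_forall fun S => ?_
      apply Measurable.aestronglyMeasurable
      have a0 := (m0 S t).measurable
      have a1 := (m1 S t).measurable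
      have a2 := (m2 S t).measurable
      simp only [hU, hUx, hUy]
      fun_prop
    · filter_upwards [hpos] with S hS
      refine (ae_restrict_mem DD_meas).mono fun p hp => ?_
      have b1 := sum_bnd good1 t tp S p hp
      have b2 := sum_bnd good2 t tp S p hp
      have b0 := hS t p.1 p.2 ht hp
      have hp' : p.1 ^ 2 + p.2 ^ 2 ≤ 1 := hp
      rw [norm_div, norm_mul]
      have c1 : ‖1 - p.1 ^ 2 - p.2 ^ 2‖ ≤ 1 := by
        rw [Real.norm_eq_abs, abs_le]; constructor <;> nlinarith [sq_nonneg p.1, sq_nonneg p.2]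
      have c2 : ‖Ux S t p.1 p.2 ^ 2 + Uy S t p.1 p.2 ^ 2‖ ≤ 2 * B ^ 2 := by
        rw [Real.norm_of_nonneg (by positivity)]
        simp only [hUx, hUy, zero_add]
        have := sq_le_sq' (abs_le.1 b1).1 (abs_le.1 b1).2
        have := sq_le_sq' (abs_le.1 b2).1 (abs_le.1 b2).2
        linarith
      have c3 : ε / 2 ≤ ‖U S t p.1 p.2‖ := b0.trans (le_abs_self _)
      have c4 : ‖1 - p.1 ^ 2 - p.2 ^ 2‖ * ‖Ux S t p.1 p.2 ^ 2 + Uy S t p.1 p.2 ^ 2‖ ≤ 2 * B ^ 2 := by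
        calc _ ≤ 1 * (2 * B ^ 2) := mul_le_mul c1 c2 (norm_nonneg _) zero_le_one
          _ = _ := one_mul _
      exact div_le_div₀ (by positivity) c4 (by linarith) c3
    · have : IsFiniteMeasure (volume.restrict DD) := ⟨by rw [Measure.restrict_apply_univ]; exact DD_fin⟩
      exact integrable_const _
    · refine (ae_restrict_mem DD_meas).mono fun p hp => ?_
      have s0 := (good_summable good0 t p.1 p.2 tp hp).hasSum.const_add ε
      have s1 := (good_summable good1 t p.1 p.2 tp hp).hasSum.const_add 0
      have s2 := (good_summable good2 t p.1 p.2 tp hp).hasSum.const_add 0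
      rw [zero_add] at s1 s2
      have hne : ε + ∑' i, P0 i t p.1 p.2 ≠ 0 := by
        have : 0 ≤ ∑' i, P0 i t p.1 p.2 := q0_nonneg t tp p hp
        linarith
      exact ((((s1.pow 2).add (s2.pow 2)).const_mul _).div s0 hne)
  have limE : ∀ t, t0 ≤ t → Tendsto (fun S => ∫ p in DD, U S t p.1 p.2 * log (U S t p.1 p.2)) atTop
      (nhds (∫ p in DD, EE ε t p)) := by
    intro t ht
    have tp : 0 < t := h0.trans_le ht
    set B := ∑' i, bnd t i
    have m0 := meas _ good0
    refine tendsto_integral_filter_of_dominated_convergence (fun _ => 1 + (ε + B) ^ 2) ?_ ?_ ?_ ?_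
    · refine Eventually.of_forall fun S => ?_
      apply Measurable.aestronglyMeasurable
      have a0 := (m0 S t).measurable
      simp only [hU]
      fun_prop
    · filter_upwards [hpos] with S hS
      refine (ae_restrict_mem DD_meas).mono fun p hp => ?_
      have b1 := sum_bnd good0 t tp S p hp
      have b0 := hS t p.1 p.2 ht hp
      have b3 : 0 ≤ U S t p.1 p.2 := by linarith
      refine (xlogx_bound _ b3).trans ?_
      gcongr
      simp only [hU]
      linarith [(abs_le.1 b1).2]
    · have : IsFiniteMeasure (volume.restrict DD) := ⟨by rw [Measure.restrict_apply_univ]; exact DD_fin⟩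
      exact integrable_const _
    · refine (ae_restrict_mem DD_meas).mono fun p hp => ?_
      have s0 := (good_summable good0 t p.1 p.2 tp hp).hasSum.const_add ε
      exact (Real.continuous_mul_log.tendsto _).comp s0
  have ev : ∀ᶠ S in atTop, (∫ p in DD, (1 - p.1 ^ 2 - p.2 ^ 2) *
      (Ux S t1 p.1 p.2 ^ 2 + Uy S t1 p.1 p.2 ^ 2) / U S t1 p.1 p.2) ≤ (∫ p in DD, (1 - p.1 ^ 2 - p.2 ^ 2) *
      (Ux S t0 p.1 p.2 ^ 2 + Uy S t0 p.1 p.2 ^ 2) / U S t0 p.1 p.2) ∧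
      ((t1 - t0) * (∫ p in DD, (1 - p.1 ^ 2 - p.2 ^ 2) *
      (Ux S t1 p.1 p.2 ^ 2 + Uy S t1 p.1 p.2 ^ 2) / U S t1 p.1 p.2) ≤
      (∫ p in DD, U S t0 p.1 p.2 * log (U S t0 p.1 p.2)) - (∫ p in DD, U S t1 p.1 p.2 * log (U S t1 p.1 p.2)) ∧
      (∫ p in DD, U S t0 p.1 p.2 * log (U S t0 p.1 p.2)) - (∫ p in DD, U S t1 p.1 p.2 * log (U S t1 p.1 p.2)) ≤
      (t1 - t0) * (∫ p in DD, (1 - p.1 ^ 2 - p.2 ^ 2) *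
      (Ux S t0 p.1 p.2 ^ 2 + Uy S t0 p.1 p.2 ^ 2) / U S t0 p.1 p.2)) := by
    filter_upwards [hpos] with S hS
    obtain ⟨_, _, _, _, _, _, _, H⟩ := HJS S
    have hp : ∀ t x y, t ∈ Set.Icc t0 t1 → x ^ 2 + y ^ 2 ≤ 1 → 0 < U S t x y := fun t x y ht hxy =>
      lt_of_lt_of_le (by linarith) (hS t x y ht.1 hxy)
    exact ⟨fisher_anti H t0 t1 h01 hp, entropy_sandwich H t0 t1 h01 hp⟩
  have F0 := limF t0 le_rfl
  have F1 := limF t1 h01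
  have E0 := limE t0 le_rfl
  have E1 := limE t1 h01
  refine ⟨le_of_tendsto_of_tendsto F1 F0 (ev.mono fun S h => h.1),
    le_of_tendsto_of_tendsto (F1.const_mul _) (E0.sub E1) (ev.mono fun S h => h.2.1),
    le_of_tendsto_of_tendsto (E0.sub E1) (F0.const_mul _) (ev.mono fun S h => h.2.2)⟩
end

section
open Real MeasureTheory Filter

lemma DD_finm : IsFiniteMeasure (volume.restrict DD) :=
  ⟨by rw [Measure.restrict_apply_univ]; exact DD_fin⟩

lemma FE_contOn (ε t : ℝ) (hε : 0 < ε) (ht : 0 < t) : ContinuousOn (FE ε t) DD := by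
  refine ContinuousOn.div ?_ (continuousOn_const.add (q0_contOn t ht)) ?_
  · exact ContinuousOn.mul (by fun_prop) (((q1_contOn t ht).pow 2).add ((q2_contOn t ht).pow 2))
  · intro p hp
    have := q0_nonneg t ht p hp
    linarith

lemma EE_contOn (ε t : ℝ) (ht : 0 < t) : ContinuousOn (EE ε t) DD :=
  Real.continuous_mul_log.comp_continuousOn (continuousOn_const.add (q0_contOn t ht))

lemma num_nonneg (t : ℝ) (p : ℝ × ℝ) (hp : p ∈ DD) :
    0 ≤ (1 - p.1 ^ 2 - p.2 ^ 2) * (q1 t p.1 p.2 ^ 2 + q2 t p.1 p.2 ^ 2) := by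
  have hp' : p.1 ^ 2 + p.2 ^ 2 ≤ 1 := hp
  exact mul_nonneg (by linarith) (by positivity)

lemma FE_nonneg (ε t : ℝ) (hε : 0 < ε) (ht : 0 < t) (p : ℝ × ℝ) (hp : p ∈ DD) : 0 ≤ FE ε t p :=
  div_nonneg (num_nonneg t p hp) (by have := q0_nonneg t ht p hp; linarith)

lemma FE_le (ε t : ℝ) (hε : 0 < ε) (ht : 0 < t) (p : ℝ × ℝ) (hp : p ∈ DD) : FE ε t p ≤ FF t p := by
  have h0 := q0_nonneg t ht p hp
  rcases h0.eq_or_lt with h | h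
  · simp only [FE, FF, num_zero t ht p hp h.symm, zero_div, le_refl]
  · exact div_le_div_of_nonneg_left (num_nonneg t p hp) h (by linarith)

lemma FE_tendsto (t : ℝ) (ht : 0 < t) (p : ℝ × ℝ) (hp : p ∈ DD) :
    Tendsto (fun n : ℕ => FE (1 / (n + 1 : ℝ)) t p) atTop (nhds (FF t p)) := by
  have h0 := q0_nonneg t ht p hp
  rcases h0.eq_or_lt with h | h
  · simp only [FE, FF, num_zero t ht p hp h.symm, zero_div]
    exact tendsto_const_nhds
  · have := (tendsto_one_div_add_atTop_nhds_zero_nat (𝕜 := ℝ)).add_const (q0 t p.1 p.2)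
    rw [zero_add] at this
    exact tendsto_const_nhds.div this h.ne'

lemma EE_tendsto (t : ℝ) (ht : 0 < t) :
    Tendsto (fun n : ℕ => ∫ p in DD, EE (1 / (n + 1 : ℝ)) t p) atTop (nhds (∫ p in DD, EE 0 t p)) := by
  have := DD_finm
  set B := ∑' i, bnd t i
  refine tendsto_integral_filter_of_dominated_convergence (fun _ => 1 + (1 + B) ^ 2) ?_ ?_ ?_ ?_
  · exact Eventually.of_forall fun n => (EE_contOn _ t ht).aestronglyMeasurable DD_meas
  · refine Eventually.of_forall fun n => (ae_restrict_mem DD_meas).mono fun p hp => ?_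
    have h0 := q0_nonneg t ht p hp
    have h1 := (abs_le.1 (tsum_bnd good0 t ht p hp)).2
    have h2 : (1 / (n + 1 : ℝ)) ≤ 1 := by
      rw [div_le_one (by positivity)]; linarith [n.cast_nonneg (α := ℝ)]
    have h3 : 0 ≤ (1 / (n + 1 : ℝ)) := by positivity
    refine (xlogx_bound _ (by linarith)).trans ?_
    have : 1 / (n + 1 : ℝ) + q0 t p.1 p.2 ≤ 1 + B := add_le_add h2 h1
    gcongr
  · exact integrable_const _
  · refine (ae_restrict_mem DD_meas).mono fun p hp => ?_
    have := (tendsto_one_div_add_atTop_nhds_zero_nat (𝕜 := ℝ)).add_const (q0 t p.1 p.2)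
    exact (Real.continuous_mul_log.tendsto _).comp this

lemma integrable_of_tendsto_prod {μ : Measure (ℝ × ℝ)} {G : ℕ → ℝ × ℝ → ℝ} {f : ℝ × ℝ → ℝ}
    (hGf : ∀ᵐ x ∂μ, Tendsto (fun n : ℕ => G n x) atTop (nhds (f x)))
    (hG : ∀ n : ℕ, AEStronglyMeasurable (G n) μ)
    (hG' : liminf (fun n => ∫⁻ x, ‖G n x‖ₑ ∂μ) atTop ≠ ⊤) : Integrable f μ := by
  refine ⟨aestronglyMeasurable_of_tendsto_ae _ hG hGf, lt_of_le_of_lt ?_ hG'.lt_top⟩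
  refine le_trans (le_of_eq ?_) (lintegral_liminf_le' (fun n => (hG n).enorm))
  refine lintegral_congr_ae (hGf.mono fun x hx => ?_)
  exact hx.enorm.liminf_eq.symm

lemma FF_int (t : ℝ) (ht : 0 < t) : IntegrableOn (FF t) DD := by
  have hfe : ∀ n : ℕ, IntegrableOn (FE (1 / (n + 1 : ℝ)) t) DD := fun n =>
    (FE_contOn _ t (by positivity) ht).integrableOn_compact DD_compact
  have hb : ∃ K, ∀ n : ℕ, ∫ p in DD, FE (1 / (n + 1 : ℝ)) t p ≤ K := by
    have a := (EE_tendsto (t / 2) (by linarith)).sub (EE_tendsto t ht)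
    obtain ⟨K, hK⟩ := a.bddAbove_range
    refine ⟨K / (t / 2), fun n => ?_⟩
    rw [le_div_iff₀ (by linarith)]
    have := (sandwich_eps (1 / (n + 1 : ℝ)) (t / 2) t (by positivity) (by linarith) (by linarith)).2.1
    have h2 := hK ⟨n, rfl⟩
    simp only at h2
    linarith
  obtain ⟨K, hK⟩ := hb
  refine integrable_of_tendsto_prod (G := fun n : ℕ => FE (1 / (n + 1 : ℝ)) t) ((ae_restrict_mem DD_meas).mono fun p hp => FE_tendsto t ht p hp)
    (fun n => (hfe n).aestronglyMeasurable) ?_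
  have : ∀ n : ℕ, ∫⁻ p in DD, ‖FE (1 / (n + 1 : ℝ)) t p‖ₑ ≤ ENNReal.ofReal K := by
    intro n
    rw [← ofReal_integral_norm_eq_lintegral_enorm (hfe n)]
    refine ENNReal.ofReal_le_ofReal (le_trans (le_of_eq ?_) (hK n))
    refine setIntegral_congr_fun DD_meas fun p hp => ?_
    exact Real.norm_of_nonneg (FE_nonneg _ t (by positivity) ht p hp)
  refine ne_of_lt (lt_of_le_of_lt ?_ (ENNReal.ofReal_lt_top (r := K)))
  exact (liminf_le_liminf (Eventually.of_forall this)).trans (by simp)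

lemma FE_int_tendsto (t : ℝ) (ht : 0 < t) :
    Tendsto (fun n : ℕ => ∫ p in DD, FE (1 / (n + 1 : ℝ)) t p) atTop (nhds (∫ p in DD, FF t p)) := by
  refine tendsto_integral_filter_of_dominated_convergence (FF t) ?_ ?_ (FF_int t ht) ?_
  · exact Eventually.of_forall fun n =>
      (FE_contOn _ t (by positivity) ht).aestronglyMeasurable DD_meas
  · refine Eventually.of_forall fun n => (ae_restrict_mem DD_meas).mono fun p hp => ?_
    rw [Real.norm_of_nonneg (FE_nonneg _ t (by positivity) ht p hp)]
    exact FE_le _ t (by positivity) ht p hp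
  · exact (ae_restrict_mem DD_meas).mono fun p hp => FE_tendsto t ht p hp

lemma sandwich (t0 t1 : ℝ) (h0 : 0 < t0) (h01 : t0 ≤ t1) :
    (∫ p in DD, FF t1 p) ≤ (∫ p in DD, FF t0 p) ∧
    (t1 - t0) * (∫ p in DD, FF t1 p) ≤ (∫ p in DD, EE 0 t0 p) - (∫ p in DD, EE 0 t1 p) ∧
    (∫ p in DD, EE 0 t0 p) - (∫ p in DD, EE 0 t1 p) ≤ (t1 - t0) * (∫ p in DD, FF t0 p) := by
  have h1 := h0.trans_le h01
  have F0 := FE_int_tendsto t0 h0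
  have F1 := FE_int_tendsto t1 h1
  have E0 := EE_tendsto t0 h0
  have E1 := EE_tendsto t1 h1
  have S := fun n : ℕ => sandwich_eps (1 / (n + 1 : ℝ)) t0 t1 (by positivity) h0 h01
  exact ⟨le_of_tendsto_of_tendsto' F1 F0 (fun n => (S n).1),
    le_of_tendsto_of_tendsto' (F1.const_mul _) (E0.sub E1) (fun n => (S n).2.1),
    le_of_tendsto_of_tendsto' (E0.sub E1) (F0.const_mul _) (fun n => (S n).2.2)⟩

lemma Cc (t : ℝ) (ht : 0 < t) : Cconst t = 1 / (2 * π) * ∫ p in DD, FF t p :=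
  Cconst_eq t ht (FF_int t ht)

theorem part_i : AntitoneOn Cconst (Set.Ioi 0) := by
  intro a ha b hb hab
  rw [Cc a ha, Cc b hb]
  have := (sandwich a b ha hab).1
  gcongr
end

section
open Real MeasureTheory Filter

lemma sg_shift (a b : ℕ) (c : ℂ) (g : ℝ → ℝ → ℂ) (t x y : ℝ) :
    sg a b c g t x y = exp (-(lam a b * (t - 1))) * sg a b c g 1 x y := by
  unfold sg
  rw [← mul_assoc, ← Real.exp_add]
  congr 2; ring

lemma lam_ge (i : ℕ × ℕ) (h : i ≠ (0, 0)) : 2 ≤ lam i.1 i.2 := by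
  unfold lam
  have : 1 ≤ i.1 + i.2 := by
    by_contra h1
    exact h (Prod.ext (by omega) (by omega))
  have h2 : (1 : ℝ) ≤ i.1 + i.2 := by exact_mod_cast this
  have : (0 : ℝ) ≤ i.1 * i.2 := by positivity
  nlinarith

lemma lam_gt (i : ℕ × ℕ) (h : i ≠ (0, 0)) (h1 : i ≠ (1, 0)) (h2 : i ≠ (0, 1)) : 2 < lam i.1 i.2 := by
  unfold lam
  have : 2 ≤ i.1 + i.2 := by
    by_contra h3
    obtain ⟨a, b⟩ := i
    simp only [ne_eq, Prod.mk.injEq] at *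
    omega
  have h2 : (2 : ℝ) ≤ i.1 + i.2 := by exact_mod_cast this
  have : (0 : ℝ) ≤ i.1 * i.2 := by positivity
  nlinarith

/-- shift property -/
def Shiftser (P : ℕ × ℕ → ℝ → ℝ → ℝ → ℝ) : Prop :=
  ∀ i t x y, P i t x y = exp (-(lam i.1 i.2 * (t - 1))) * P i 1 x y

lemma shift0 : Shiftser P0 := fun _ t x y => sg_shift _ _ _ _ t x y
lemma shift1 : Shiftser P1 := fun _ t x y => sg_shift _ _ _ _ t x y
lemma shift2 : Shiftser P2 := fun _ t x y => sg_shift _ _ _ _ t x y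

lemma tail_bnd {P} (hP : Goodser P) (hS : Shiftser P) (t : ℝ) (ht : 1 ≤ t) (p : ℝ × ℝ) (hp : p ∈ DD) :
    |(∑' i, P i t p.1 p.2) - P (0, 0) 1 p.1 p.2| ≤ exp (-(2 * (t - 1))) * ∑' i, bnd 1 i := by
  have s1 := good_summable hP t p.1 p.2 (by linarith) hp
  have s2 : HasSum (fun i : ℕ × ℕ => if i = (0, 0) then P (0, 0) 1 p.1 p.2 else 0) (P (0, 0) 1 p.1 p.2) :=
    hasSum_ite_eq _ _
  have s3 := s1.hasSum.sub s2
  rw [← s3.tsum_eq, ← tsum_mul_left, ← Real.norm_eq_abs]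
  refine tsum_of_norm_bounded ((bnd_summable 1 one_pos).mul_left _).hasSum (fun i => ?_)
  have b0 := bnd_nonneg 1 i
  by_cases hi : i = (0, 0)
  · subst hi
    rw [if_pos rfl, hS (0, 0) t]
    simp only [lam]
    norm_num
    positivity
  · rw [if_neg hi, sub_zero, hS i t, norm_mul, Real.norm_of_nonneg (exp_pos _).le]
    refine mul_le_mul ?_ (hP.2 i 1 1 _ _ one_pos le_rfl hp) (norm_nonneg _) (exp_pos _).le
    rw [exp_le_exp]
    nlinarith [lam_ge i hi]

lemma tail_lim {P} (hP : Goodser P) (hS : Shiftser P) (h0 : ∀ x y, P (0, 0) 1 x y = 0) (p : ℝ × ℝ) (hp : p ∈ DD) :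
    Tendsto (fun t => exp (2 * (t - 1)) * ∑' i, P i t p.1 p.2) atTop
      (nhds (P (1, 0) 1 p.1 p.2 + P (0, 1) 1 p.1 p.2)) := by
  have e : ∀ t, exp (2 * (t - 1)) * ∑' i, P i t p.1 p.2 =
      ∑' i : ℕ × ℕ, exp ((2 - lam i.1 i.2) * (t - 1)) * P i 1 p.1 p.2 := by
    intro t
    rw [← tsum_mul_left]
    congr 1; ext i
    rw [hS i t, ← mul_assoc, ← Real.exp_add]
    congr 2; ring
  simp_rw [e]
  set L : ℕ × ℕ → ℝ := fun i => (if i = (1, 0) then P (1, 0) 1 p.1 p.2 else 0) +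
    (if i = (0, 1) then P (0, 1) 1 p.1 p.2 else 0) with hL
  have hs : HasSum L (P (1, 0) 1 p.1 p.2 + P (0, 1) 1 p.1 p.2) :=
    (hasSum_ite_eq _ _).add (hasSum_ite_eq _ _)
  rw [← hs.tsum_eq]
  refine tendsto_tsum_of_dominated_convergence (bnd_summable 1 one_pos) ?_ ?_
  · intro i
    by_cases h1 : i = (0, 0)
    · subst h1; simp [h0, hL]
    by_cases h2 : i = (1, 0)
    · subst h2; simp [hL, lam]
    by_cases h3 : i = (0, 1)
    · subst h3; simp [hL, lam]
    simp only [hL, if_neg h2, if_neg h3, add_zero]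
    have := lam_gt i h1 h2 h3
    rw [← zero_mul (P i 1 p.1 p.2)]
    refine Tendsto.mul_const _ (tendsto_exp_atBot.comp ?_)
    exact Tendsto.const_mul_atTop_of_neg (by linarith) (tendsto_atTop_add_const_right _ _ tendsto_id)
  · filter_upwards [eventually_ge_atTop 1] with t ht i
    by_cases hi : i = (0, 0)
    · subst hi; rw [h0]; simp [bnd_nonneg]
    · rw [norm_mul, Real.norm_of_nonneg (exp_pos _).le]
      refine (mul_le_of_le_one_left (norm_nonneg _) ?_).trans (hP.2 i 1 1 _ _ one_pos le_rfl hp)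
      rw [exp_le_one_iff]
      nlinarith [lam_ge i hi]

lemma P0_00 (x y : ℝ) : P0 (0, 0) 1 x y = 1 := by
  simp [P0, sg, fh, ph_zero_right, lam]
lemma P1_00 (x y : ℝ) : P1 (0, 0) 1 x y = 0 := by
  simp [P1, sg, fhx, gd, gc_zero_left, gc_zero_right]
lemma P2_00 (x y : ℝ) : P2 (0, 0) 1 x y = 0 := by
  simp [P2, sg, fhy, gd, gc_zero_left, gc_zero_right]
lemma P1_10 (x y : ℝ) : P1 (1, 0) 1 x y = 2 * exp (-2) := by
  simp [P1, sg, fhx, gd, gc_zero_left, gc_zero_right, gc, lam]; norm_num; ring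
lemma P1_01 (x y : ℝ) : P1 (0, 1) 1 x y = 2 * exp (-2) := by
  simp [P1, sg, fhx, gd, gc_zero_left, gc_zero_right, gc, lam]; norm_num; ring
lemma P2_10 (x y : ℝ) : P2 (1, 0) 1 x y = 0 := by
  simp [P2, sg, fhy, gd, gc_zero_left, gc_zero_right, gc, lam]
lemma P2_01 (x y : ℝ) : P2 (0, 1) 1 x y = 0 := by
  simp [P2, sg, fhy, gd, gc_zero_left, gc_zero_right, gc, lam]

lemma fh00 (x y : ℝ) : fh 0 0 x y = 1 := by simp [fh, ph_zero_right]
lemma fh11 (x y : ℝ) : fh 1 1 x y = 2 * (x ^ 2 + y ^ 2) - 1 := by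
  have : fh 1 1 x y = (x + y * Complex.I) * (x - y * Complex.I) - (1 - (x + y * Complex.I) * (x - y * Complex.I)) := by
    simp only [fh, ph_explicit, phE, Finset.sum_range_succ]
    simp; ring
  rw [this]
  linear_combination (-2 * (y : ℂ) ^ 2) * Complex.I_sq

lemma vol_DD_real : ∫ _p in DD, (1 : ℝ) = π := by
  have := vol_DD
  have h : ∫ _p in DD, ((1 : ℝ) : ℂ) = (π : ℂ) := by simpa using this
  rw [integral_complex_ofReal] at h
  exact_mod_cast h

lemma int_s : ∫ p in DD, (1 - p.1 ^ 2 - p.2 ^ 2) = π / 2 := by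
  have h := orth 0 0 1 1 (by simp)
  have h2 : ∫ p in DD, (2 * (1 - p.1 ^ 2 - p.2 ^ 2) - 1 : ℝ) = 0 := by
    have : ∫ p in DD, (((2 * (1 - p.1 ^ 2 - p.2 ^ 2) - 1 : ℝ)) : ℂ) = 0 := by
      rw [← neg_eq_zero, ← integral_neg, ← h]
      congr 1; ext p
      rw [fh00, fh11]; push_cast; ring
    rw [integral_complex_ofReal] at this
    exact_mod_cast this
  have := DD_finm
  have i1 : IntegrableOn (fun p : ℝ × ℝ => (1 - p.1 ^ 2 - p.2 ^ 2)) DD :=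
    (by fun_prop : Continuous fun p : ℝ × ℝ => (1 - p.1 ^ 2 - p.2 ^ 2)).continuousOn.integrableOn_compact DD_compact
  rw [integral_sub (i1.const_mul 2) (integrable_const _), integral_const_mul, vol_DD_real] at h2
  linarith

theorem part_iii : Tendsto (fun t => Real.exp (4 * t) * Cconst t) atTop (nhds 4) := by
  have := DD_finm
  have pp := Real.pi_pos
  set B := ∑' i, bnd 1 i with hB
  have hB0 : 0 ≤ B := tsum_nonneg (bnd_nonneg 1)
  have key : Tendsto (fun t => ∫ p in DD, exp (4 * (t - 1)) * FF t p) atTop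
      (nhds (∫ p in DD, (1 - p.1 ^ 2 - p.2 ^ 2) * (16 * exp (-4)))) := by
    have small : ∀ᶠ t in atTop, exp (-(2 * (t - 1))) * B ≤ 1 / 2 := by
      have : Tendsto (fun t : ℝ => exp (-(2 * (t - 1))) * B) atTop (nhds (0 * B)) := by
        refine Tendsto.mul_const _ (tendsto_exp_neg_atTop_nhds_zero.comp ?_)
        exact Tendsto.const_mul_atTop (by norm_num) (tendsto_atTop_add_const_right _ _ tendsto_id)
      rw [zero_mul] at this
      exact this.eventually_le_const (by norm_num)
    refine tendsto_integral_filter_of_dominated_convergence (fun _ => 2 * B ^ 2 / (1 / 2)) ?_ ?_ ?_ ?_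
    · filter_upwards [eventually_ge_atTop 1] with t ht
      exact ((FF_int t (by linarith)).const_mul _).aestronglyMeasurable
    · filter_upwards [eventually_ge_atTop 1, small] with t ht hs
      refine (ae_restrict_mem DD_meas).mono fun p hp => ?_
      have t0 := tail_bnd good0 shift0 t ht p hp
      have t1 := tail_bnd good1 shift1 t ht p hp
      have t2 := tail_bnd good2 shift2 t ht p hp
      rw [P0_00] at t0
      rw [P1_00, sub_zero] at t1
      rw [P2_00, sub_zero] at t2
      have hp' : p.1 ^ 2 + p.2 ^ 2 ≤ 1 := hp
      have e4 : exp (4 * (t - 1)) * exp (-(2 * (t - 1))) ^ 2 = 1 := by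
        rw [← Real.exp_nat_mul, ← Real.exp_add]; norm_num; ring
      have a1 := sq_le_sq' (abs_le.1 t1).1 (abs_le.1 t1).2
      have a2 := sq_le_sq' (abs_le.1 t2).1 (abs_le.1 t2).2
      change (q1 t p.1 p.2) ^ 2 ≤ _ at a1
      change (q2 t p.1 p.2) ^ 2 ≤ _ at a2
      change |q0 t p.1 p.2 - 1| ≤ _ at t0
      have a0 : 1 / 2 ≤ q0 t p.1 p.2 := by linarith [(abs_le.1 t0).1]
      unfold FF
      rw [← mul_div_assoc, norm_div]
      have c1 : exp (4 * (t - 1)) * (q1 t p.1 p.2 ^ 2 + q2 t p.1 p.2 ^ 2) ≤ 2 * B ^ 2 := by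
        calc _ ≤ exp (4 * (t - 1)) * ((exp (-(2 * (t - 1))) * B) ^ 2 + (exp (-(2 * (t - 1))) * B) ^ 2) := by
              gcongr
          _ = (exp (4 * (t - 1)) * exp (-(2 * (t - 1))) ^ 2) * (2 * B ^ 2) := by ring
          _ = _ := by rw [e4, one_mul]
      have c0 : 0 ≤ exp (4 * (t - 1)) * (q1 t p.1 p.2 ^ 2 + q2 t p.1 p.2 ^ 2) := by positivity
      refine div_le_div₀ (by positivity) ?_ (by norm_num) (a0.trans (le_abs_self _))
      have : exp (4 * (t - 1)) * ((1 - p.1 ^ 2 - p.2 ^ 2) * (q1 t p.1 p.2 ^ 2 + q2 t p.1 p.2 ^ 2)) =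
        (1 - p.1 ^ 2 - p.2 ^ 2) * (exp (4 * (t - 1)) * (q1 t p.1 p.2 ^ 2 + q2 t p.1 p.2 ^ 2)) := by ring
      rw [this, Real.norm_of_nonneg (mul_nonneg (by linarith) c0)]
      nlinarith [sq_nonneg p.1, sq_nonneg p.2]
    · exact integrable_const _
    · refine (ae_restrict_mem DD_meas).mono fun p hp => ?_
      have l1 := tail_lim good1 shift1 P1_00 p hp
      have l2 := tail_lim good2 shift2 P2_00 p hp
      rw [P1_10, P1_01] at l1
      rw [P2_10, P2_01] at l2
      have l0 : Tendsto (fun t => q0 t p.1 p.2) atTop (nhds 1) := by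
        rw [tendsto_iff_norm_sub_tendsto_zero]
        have : Tendsto (fun t : ℝ => exp (-(2 * (t - 1))) * B) atTop (nhds (0 * B)) := by
          refine Tendsto.mul_const _ (tendsto_exp_neg_atTop_nhds_zero.comp ?_)
          exact Tendsto.const_mul_atTop (by norm_num) (tendsto_atTop_add_const_right _ _ tendsto_id)
        rw [zero_mul] at this
        refine tendsto_of_tendsto_of_tendsto_of_le_of_le' tendsto_const_nhds this
          (Eventually.of_forall fun t => norm_nonneg _) ?_
        filter_upwards [eventually_ge_atTop 1] with t ht
        have t0 := tail_bnd good0 shift0 t ht p hp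
        rw [P0_00] at t0
        exact t0
      have := (((l1.pow 2).add (l2.pow 2)).const_mul (1 - p.1 ^ 2 - p.2 ^ 2)).div l0 one_ne_zero
      have e4 : exp (-4) = exp (-2) ^ 2 := by rw [← Real.exp_nat_mul]; norm_num
      convert this using 1
      · ext t
        have e5 : exp (4 * (t - 1)) = exp (2 * (t - 1)) ^ 2 := by
          rw [← Real.exp_nat_mul]; congr 1; push_cast; ring
        simp only [Pi.div_apply, FF, e5, q1, q2]
        ring
      · rw [e4]; congr 1; ring
  rw [integral_mul_const, int_s] at key
  have k2 := key.const_mul (exp 4 / (2 * π))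
  have e : exp 4 / (2 * π) * (π / 2 * (16 * exp (-4))) = 4 := by
    have : exp 4 * exp (-4) = 1 := by rw [← Real.exp_add]; simp
    field_simp
    linear_combination 16 * this
  rw [e] at k2
  refine k2.congr' ?_
  filter_upwards [eventually_ge_atTop 1] with t ht
  rw [Cc t (by linarith), integral_const_mul]
  have : exp (4 * t) = exp 4 * exp (4 * (t - 1)) := by rw [← Real.exp_add]; congr 1; ring
  rw [this]; ring
end

section
open Real MeasureTheory Filter

lemma exp_abs_integral (c : ℝ) (hc : 0 < c) : ∫ x : ℝ, exp (-c * |x|) = 2 / c := by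
  rw [integral_comp_abs (f := fun x => exp (-c * x)), integral_exp_mul_Ioi (by linarith)]
  simp; ring

lemma exp_abs_integrable (c : ℝ) (hc : 0 < c) : Integrable (fun x : ℝ => exp (-c * |x|)) := by
  apply Integrable.of_integral_ne_zero
  rw [exp_abs_integral c hc]; positivity

noncomputable def mu2 : Measure (ℝ × ℕ) := (volume : Measure ℝ).prod Measure.count

noncomputable def G2 (q : ℝ × ℕ) : ℝ := 2 / (q.2 + 1) * exp (-(q.2 + 1 : ℝ) * |q.1|)

lemma G2_integrable : Integrable G2 mu2 := by
  have hm : Measurable G2 := by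
    apply measurable_from_prod_countable_left
    intro k
    simp only [G2]
    fun_prop
  unfold mu2
  rw [integrable_prod_iff' hm.aestronglyMeasurable]
  constructor
  · exact ae_of_all _ fun k => (exp_abs_integrable (k + 1) (by positivity)).const_mul (2 / ((k : ℝ) + 1))
  · rw [integrable_count_iff]
    have : ∀ k : ℕ, ∫ x : ℝ, ‖G2 (x, k)‖ = 4 * (1 / ((k + 1 : ℕ) : ℝ) ^ 2) := by
      intro k
      have : ∀ x : ℝ, ‖G2 (x, k)‖ = 2 / (k + 1) * exp (-(k + 1 : ℝ) * |x|) := fun x => by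
        rw [Real.norm_of_nonneg] <;> simp only [G2]
        positivity
      simp_rw [this]
      rw [integral_const_mul, exp_abs_integral _ (by positivity)]
      push_cast
      field_simp; norm_num
    simp_rw [this]
    refine Summable.norm ?_
    exact ((summable_nat_add_iff 1).2 (Real.summable_one_div_nat_pow.2 (by norm_num : 1 < 2))).mul_left 4

noncomputable def fl (t : ℝ) (q : ℝ × ℕ) : ℤ × ℕ := (⌊q.1 / t⌋, q.2)

lemma fl_meas (t : ℝ) : Measurable (fl t) := by
  unfold fl
  fun_prop

lemma fl_map (t : ℝ) (ht : 0 < t) (i : ℤ × ℕ) : (mu2.map (fl t)).real {i} = t := by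
  have : fl t ⁻¹' {i} = Set.Ico (i.1 * t) ((i.1 + 1) * t) ×ˢ {i.2} := by
    ext ⟨x, k⟩
    obtain ⟨n, k'⟩ := i
    simp only [fl, Set.mem_preimage, Set.mem_singleton_iff, Prod.mk.injEq, Set.mem_prod, Set.mem_Ico,
      Int.floor_eq_iff, le_div_iff₀ ht, div_lt_iff₀ ht]
  rw [measureReal_def, Measure.map_apply (fl_meas t) (measurableSet_singleton _), this, mu2,
    Measure.prod_prod, Real.volume_Ico]
  simp
  rw [ENNReal.toReal_ofReal] <;> linarith

/-- Riemann sums as integrals -/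
lemma riemann_sum (t : ℝ) (ht : 0 < t) (h : ℤ × ℕ → ℝ) (hi : Integrable (fun q => h (fl t q)) mu2) :
    ∫ q, h (fl t q) ∂mu2 = t * ∑' i, h i := by
  have hm : AEStronglyMeasurable h (mu2.map (fl t)) := (Measurable.of_discrete).aestronglyMeasurable
  have e := integral_map (μ := mu2) (fl_meas t).aemeasurable hm
  rw [← e, integral_countable, ← tsum_mul_left]
  · congr 1; ext i
    rw [fl_map t ht, smul_eq_mul]
  · rw [integrable_map_measure hm (fl_meas t).aemeasurable]
    exact hi

/-- Riemann sum limit -/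
lemma riemann_lim (h : ℝ → ℤ × ℕ → ℝ) (c : ℝ) (L : ℝ × ℕ → ℝ)
    (hb : ∀ᶠ t in nhdsWithin 0 (Set.Ioi 0), ∀ q, |h t (fl t q)| ≤ c * G2 q)
    (hl : ∀ q, Tendsto (fun t => h t (fl t q)) (nhdsWithin 0 (Set.Ioi 0)) (nhds (L q))) :
    Tendsto (fun t => t * ∑' i, h t i) (nhdsWithin 0 (Set.Ioi 0)) (nhds (∫ q, L q ∂mu2)) := by
  have hm : ∀ t, AEStronglyMeasurable (fun q => h t (fl t q)) mu2 := fun t =>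
    ((Measurable.of_discrete (f := h t)).comp (fl_meas t)).aestronglyMeasurable
  have := tendsto_integral_filter_of_dominated_convergence (μ := mu2) (fun q => c * G2 q)
    (F := fun t q => h t (fl t q)) (Eventually.of_forall hm)
    (hb.mono fun t ht => ae_of_all _ ht) (G2_integrable.const_mul c) (ae_of_all _ hl)
  refine this.congr' ?_
  filter_upwards [hb, self_mem_nhdsWithin] with t h1 h2
  exact riemann_sum t h2 (h t) ((G2_integrable.const_mul c).mono' (hm t) (ae_of_all _ h1))

lemma riemann_bound (t : ℝ) (ht : 0 < t) (h : ℤ × ℕ → ℝ) (c : ℝ) 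
    (hb : ∀ q, |h (fl t q)| ≤ c * G2 q) : |t * ∑' i, h i| ≤ c * ∫ q, G2 q ∂mu2 := by
  have hm : AEStronglyMeasurable (fun q => h (fl t q)) mu2 :=
    ((Measurable.of_discrete (f := h)).comp (fl_meas t)).aestronglyMeasurable
  have hi := (G2_integrable.const_mul c).mono' hm (ae_of_all _ hb)
  rw [← riemann_sum t ht h hi, ← integral_const_mul, ← Real.norm_eq_abs]
  exact norm_integral_le_of_norm_le (G2_integrable.const_mul c) (ae_of_all _ hb)
end

section
open Real MeasureTheory Filter

lemma ezk_sub (n : ℤ) (k : ℕ) : ((ezk (n, k)).1 : ℂ) - (ezk (n, k)).2 = n := by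
  have : ((ezk (n, k)).1 : ℤ) - (ezk (n, k)).2 = n := by simp [ezk]
  exact_mod_cast congrArg (Int.cast : ℤ → ℂ) this
lemma ezk_add (n : ℤ) (k : ℕ) : ((ezk (n, k)).1 : ℝ) + (ezk (n, k)).2 = 2 * k + n.natAbs := by
  have : (ezk (n, k)).1 + (ezk (n, k)).2 = 2 * k + n.natAbs := by simp [ezk]; omega
  exact_mod_cast this
lemma ezk_mul (n : ℤ) (k : ℕ) : ((ezk (n, k)).1 : ℝ) * (ezk (n, k)).2 = k * (k + n.natAbs) := by
  simp only [ezk, Equiv.coe_fn_mk]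
  rcases le_total 0 n with h | h
  · have h1 : n.toNat = n.natAbs := by omega
    have h2 : (-n).toNat = 0 := by omega
    rw [h1, h2]; push_cast; ring
  · have h1 : n.toNat = 0 := by omega
    have h2 : (-n).toNat = n.natAbs := by omega
    rw [h1, h2]; push_cast; ring
lemma ezk_lam (n : ℤ) (k : ℕ) : lam (ezk (n, k)).1 (ezk (n, k)).2 =
    4 * (k : ℝ) * ((k : ℝ) + (n.natAbs : ℝ) + 1) + 2 * (n.natAbs : ℝ) := by
  unfold lam
  linear_combination 4 * ezk_mul n k + 2 * ezk_add n k

noncomputable def phR (m k : ℕ) (R : ℝ) : ℝ := ∑ j ∈ Finset.range (k + 1),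
  ((k + m).choose j : ℝ) * (k.choose j : ℝ) * (-(1 - R * R)) ^ j * (R ^ (k + m - j) * R ^ (k - j))

lemma phR_eq (m k : ℕ) (R : ℝ) : ph (k + m) k R R = (phR m k R : ℂ) := by
  rw [ph_explicit, phE, phR]
  push_cast
  rfl

lemma ph_ezk (n : ℤ) (k : ℕ) (R : ℝ) : ph (ezk (n, k)).1 (ezk (n, k)).2 R R = (phR n.natAbs k R : ℂ) := by
  rw [← phR_eq]
  simp only [ezk, Equiv.coe_fn_mk]
  rcases le_total 0 n with h | h
  · have h1 : n.toNat = n.natAbs := by omega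
    have h2 : (-n).toNat = 0 := by omega
    rw [h1, h2]; simp
  · have h1 : n.toNat = 0 := by omega
    have h2 : (-n).toNat = n.natAbs := by omega
    rw [h1, h2, ph_swap]; simp

lemma P0_ezk (n : ℤ) (k : ℕ) (t R z : ℝ) : P0 (ezk (n, k)) t (R * cos z) (R * sin z) =
    (2 * k + n.natAbs + 1) * exp (-(4 * (k : ℝ) * ((k : ℝ) + (n.natAbs : ℝ) + 1) + 2 * (n.natAbs : ℝ)) * t) *
      phR n.natAbs k R * cos (n * z) := by
  unfold P0 sg
  push_cast
  rw [fh_polar, ph_ezk, ezk_sub, ezk_lam]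
  have e1 : ((ezk (n, k)).1 : ℂ) + (ezk (n, k)).2 + 1 = ((2 * k + n.natAbs + 1 : ℝ) : ℂ) := by
    rw [← ezk_add]; push_cast; ring
  have e2 : Complex.exp ((n : ℂ) * z * Complex.I) = Complex.exp (((n * z : ℝ) : ℂ) * Complex.I) := by
    push_cast; rfl
  rw [e1, e2, Complex.re_ofReal_mul, Complex.re_ofReal_mul, Complex.exp_ofReal_mul_I_re]
  ring

noncomputable def hT (t σ ζ : ℝ) (i : ℤ × ℕ) : ℝ :=
  t * P0 (ezk i) t (√(1 - t * σ) * cos (t * ζ)) (√(1 - t * σ) * sin (t * ζ))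

noncomputable def PHI (t : ℝ) (p : ℝ × ℝ) : ℝ :=
  t ^ 2 * q0 t (√(1 - t * p.1) * cos (t * p.2)) (√(1 - t * p.1) * sin (t * p.2))

lemma PHI_eq (t : ℝ) (p : ℝ × ℝ) : PHI t p = t * ∑' i, hT t p.1 p.2 i := by
  unfold PHI hT q0
  rw [tsum_mul_left, ezk.tsum_eq (fun i => P0 i t (√(1 - t * p.1) * cos (t * p.2)) (√(1 - t * p.1) * sin (t * p.2)))]
  ring

lemma sc_sq (t σ ζ : ℝ) (h : t * σ ≤ 1) :
    (√(1 - t * σ) * cos (t * ζ)) ^ 2 + (√(1 - t * σ) * sin (t * ζ)) ^ 2 = 1 - t * σ := by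
  have h1 := sin_sq_add_cos_sq (t * ζ)
  have h2 := Real.sq_sqrt (show 0 ≤ 1 - t * σ by linarith)
  rw [mul_pow, mul_pow, h2]
  linear_combination (1 - t * σ) * h1

lemma floor_abs (t x : ℝ) (ht : 0 < t) : |x| ≤ ((⌊x / t⌋.natAbs : ℝ) + 1) * t ∧
    |(⌊x / t⌋.natAbs : ℝ) * t - abs x| ≤ t := by
  have e : (⌊x / t⌋.natAbs : ℝ) = |(⌊x / t⌋ : ℝ)| := by
    rw [Nat.cast_natAbs]; simp
  have h1 := Int.floor_le (x / t)
  have h2 := Int.lt_floor_add_one (x / t)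
  rw [le_div_iff₀ ht] at h1
  rw [div_lt_iff₀ ht] at h2
  have h3 : (⌊x / t⌋.natAbs : ℝ) * t = |(⌊x / t⌋ : ℝ) * t| := by rw [e, abs_mul, abs_of_pos ht]
  have h4 : |(⌊x / t⌋.natAbs : ℝ) * t - abs x| ≤ t := by
    rw [h3]
    refine (abs_abs_sub_abs_le _ _).trans ?_
    rw [abs_le]; constructor <;> linarith
  refine ⟨?_, h4⟩
  have := (abs_le.1 h4).1
  linarith

lemma hT_bound (t σ ζ : ℝ) (ht : 0 < t) (ht1 : t ≤ 1) (hσ : 0 ≤ σ) (h : t * σ ≤ 1) (q : ℝ × ℕ) :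
    |hT t σ ζ (fl t q)| ≤ exp (σ / 2 + 2) * G2 q := by
  obtain ⟨x, k⟩ := q
  set n := ⌊x / t⌋ with hn
  have hfl : fl t (x, k) = (n, k) := rfl
  have hx := (floor_abs t x ht).1
  rw [← hn] at hx
  rw [hfl]
  set m : ℝ := (n.natAbs : ℝ) with hm
  have hm0 : 0 ≤ m := by positivity
  have hsc := sc_sq t σ ζ h
  have hle : (√(1 - t * σ) * cos (t * ζ)) ^ 2 + (√(1 - t * σ) * sin (t * ζ)) ^ 2 ≤ 1 := by
    rw [hsc]; nlinarith
  have hb := fh_bound (ezk (n, k)).1 (ezk (n, k)).2 (√(1 - t * σ) * cos (t * ζ)) (√(1 - t * σ) * sin (t * ζ)) t ht hle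
  have e1 : 2 * ((ezk (n, k)).1 : ℝ) * (ezk (n, k)).2 * t + (1 - (√(1 - t * σ) * cos (t * ζ)) ^ 2 -
    (√(1 - t * σ) * sin (t * ζ)) ^ 2) / (2 * t) = 2 * (k * (k + m)) * t + σ / 2 := by
    rw [show 2 * ((ezk (n, k)).1 : ℝ) * (ezk (n, k)).2 = 2 * (k * (k + m)) by rw [← ezk_mul]; ring]
    rw [show 1 - (√(1 - t * σ) * cos (t * ζ)) ^ 2 - (√(1 - t * σ) * sin (t * ζ)) ^ 2 = t * σ by linarith]
    field_simp
  rw [e1] at hb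
  have hP : |P0 (ezk (n, k)) t (√(1 - t * σ) * cos (t * ζ)) (√(1 - t * σ) * sin (t * ζ))| ≤
      (2 * k + m + 1) * (exp (-(4 * k * (k + m + 1) + 2 * m) * t) * exp (2 * (k * (k + m)) * t + σ / 2)) := by
    unfold P0 sg
    rw [ezk_lam, ← ezk_add n k, abs_mul, abs_of_pos (exp_pos _), Complex.re_ofReal_mul, abs_mul,
      abs_of_nonneg (by positivity)]
    have := (Complex.abs_re_le_norm _).trans hb
    calc _ = (((ezk (n, k)).1 : ℝ) + (ezk (n, k)).2 + 1) * (exp (-(4 * k * (k + m + 1) + 2 * m) * t) *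
          |(fh (ezk (n, k)).1 (ezk (n, k)).2 (√(1 - t * σ) * cos (t * ζ)) (√(1 - t * σ) * sin (t * ζ))).re|) := by ring
      _ ≤ _ := by gcongr
  rw [← exp_add] at hP
  set u := ((k : ℝ) + 1) * (m + k + 1) * t with hu
  have hu0 : 0 ≤ u := by positivity
  have e2 : -(4 * k * (k + m + 1) + 2 * m) * t + (2 * (k * (k + m)) * t + σ / 2) = (σ / 2 + 2 * t) + (-u + -u) := by
    rw [hu]; ring
  rw [e2, exp_add, exp_add (-u)] at hP
  have h3 : u * exp (-u) ≤ 1 := by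
    have := Real.add_one_le_exp u
    rw [exp_neg, ← div_eq_mul_inv, div_le_one (exp_pos _)]; linarith
  have h4 : t * (2 * k + m + 1) ≤ 2 * u / (k + 1) := by
    rw [le_div_iff₀ (by positivity), hu]
    nlinarith [mul_nonneg ht.le hm0, mul_nonneg (mul_nonneg ht.le hm0) (Nat.cast_nonneg (α := ℝ) k), mul_nonneg ht.le (Nat.cast_nonneg (α := ℝ) k)]
  have h5 : exp (-u) ≤ exp (-(k + 1 : ℝ) * |x|) := by
    rw [exp_le_exp, hu]
    have : |x| ≤ (m + k + 1) * t := hx.trans (by gcongr; linarith [Nat.cast_nonneg (α := ℝ) k])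
    have : ((k : ℝ) + 1) * |x| ≤ (k + 1) * ((m + k + 1) * t) := by gcongr
    linarith
  unfold hT G2
  rw [abs_mul, abs_of_pos ht]
  simp only
  calc _ ≤ t * ((2 * k + m + 1) * (exp (σ / 2 + 2 * t) * (exp (-u) * exp (-u)))) := by gcongr
    _ = (t * (2 * k + m + 1)) * (exp (σ / 2 + 2 * t) * (exp (-u) * exp (-u))) := by ring
    _ ≤ (2 * u / (k + 1)) * (exp (σ / 2 + 2) * (exp (-u) * exp (-(k + 1 : ℝ) * |x|))) := by
        gcongr
        linarith
    _ = (u * exp (-u)) * (exp (σ / 2 + 2) * (2 / (k + 1) * exp (-(k + 1 : ℝ) * |x|))) := by ring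
    _ ≤ 1 * _ := by gcongr
    _ = _ := one_mul _
end

section
open Real MeasureTheory Filter

lemma tt0 : Tendsto (fun t : ℝ => t) (nhdsWithin 0 (Set.Ioi 0)) (nhds 0) :=
  tendsto_nhdsWithin_of_tendsto_nhds tendsto_id

lemma evpos : ∀ᶠ t : ℝ in nhdsWithin 0 (Set.Ioi 0), 0 < t := self_mem_nhdsWithin

lemma natsub_lim (N : ℝ → ℕ) (l : ℝ) (hN : Tendsto (fun t => (N t : ℝ) * t) (nhdsWithin 0 (Set.Ioi 0)) (nhds l))
    (j : ℕ) : Tendsto (fun t => ((N t - j : ℕ) : ℝ) * t) (nhdsWithin 0 (Set.Ioi 0)) (nhds l) := by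
  have h1 : Tendsto (fun t => (N t : ℝ) * t - j * t) (nhdsWithin 0 (Set.Ioi 0)) (nhds l) := by
    simpa using hN.sub (tt0.const_mul (j : ℝ))
  refine tendsto_of_tendsto_of_tendsto_of_le_of_le' h1 hN ?_ ?_
  · filter_upwards [evpos] with t ht
    rw [← sub_mul]
    gcongr
    have : N t ≤ (N t - j) + j := by omega
    have : (N t : ℝ) ≤ ((N t - j : ℕ) : ℝ) + j := by exact_mod_cast this
    linarith
  · filter_upwards [evpos] with t ht
    gcongr
    omega

lemma choose_lim (N : ℝ → ℕ) (l : ℝ) (hN : Tendsto (fun t => (N t : ℝ) * t) (nhdsWithin 0 (Set.Ioi 0)) (nhds l))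
    (j : ℕ) : ∃ c, Tendsto (fun t => ((N t).choose j : ℝ) * t ^ j) (nhdsWithin 0 (Set.Ioi 0)) (nhds c) := by
  induction j with
  | zero => exact ⟨1, by simp⟩
  | succ j ih =>
    obtain ⟨c, hc⟩ := ih
    refine ⟨c * l / (j + 1), ?_⟩
    refine ((hc.mul (natsub_lim N l hN j)).div_const ((j : ℝ) + 1)).congr fun t => ?_
    have := Nat.choose_succ_right_eq (N t) j
    have h2 : ((N t).choose (j + 1) : ℝ) * (j + 1) = (N t).choose j * ((N t - j : ℕ) : ℝ) := by
      exact_mod_cast this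
    rw [div_eq_iff (by positivity)]
    linear_combination (-(t ^ (j + 1))) * h2

lemma pow_lim (N : ℝ → ℕ) (l σ : ℝ) (hN : Tendsto (fun t => (N t : ℝ) * t) (nhdsWithin 0 (Set.Ioi 0)) (nhds l)) :
    Tendsto (fun t => √(1 - t * σ) ^ (N t)) (nhdsWithin 0 (Set.Ioi 0)) (nhds (exp (l * (-σ / 2)))) := by
  have hd : HasDerivAt (fun t : ℝ => log (1 - t * σ)) (-σ) 0 := by
    have := ((hasDerivAt_id (0 : ℝ)).mul_const σ).const_sub 1
    have h2 := this.log (by simp)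
    simpa using h2
  have hs := hd.tendsto_slope_zero_right
  simp only [zero_add, zero_mul, sub_zero, log_one, smul_eq_mul] at hs
  have h3 := (continuous_exp.tendsto _).comp (hN.mul (hs.div_const 2))
  refine h3.congr' ?_
  have hp : ∀ᶠ t in nhdsWithin (0 : ℝ) (Set.Ioi 0), 0 < 1 - t * σ := by
    have : Tendsto (fun t : ℝ => 1 - t * σ) (nhdsWithin 0 (Set.Ioi 0)) (nhds 1) := by
      simpa using (tt0.mul_const σ).const_sub 1
    exact this.eventually_const_lt (by norm_num)
  filter_upwards [evpos, hp] with t ht h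
  have h4 : √(1 - t * σ) = exp (log (1 - t * σ) / 2) := by
    rw [← Real.log_sqrt h.le, exp_log (Real.sqrt_pos.2 h)]
  rw [h4, ← Real.exp_nat_mul]
  simp only [Function.comp]
  congr 1
  field_simp

lemma phR_lim (N : ℝ → ℕ) (l σ : ℝ) (k : ℕ)
    (hN : Tendsto (fun t => (N t : ℝ) * t) (nhdsWithin 0 (Set.Ioi 0)) (nhds l)) :
    ∃ c, Tendsto (fun t => phR (N t) k (√(1 - t * σ))) (nhdsWithin 0 (Set.Ioi 0)) (nhds c) := by
  have hN2 : Tendsto (fun t => ((k + N t : ℕ) : ℝ) * t) (nhdsWithin 0 (Set.Ioi 0)) (nhds l) := by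
    have := (tt0.const_mul (k : ℝ)).add hN
    simp only [mul_zero, zero_add] at this
    refine this.congr fun t => ?_
    push_cast; ring
  choose c hc using choose_lim _ l hN2
  have hconst : ∀ i : ℕ, Tendsto (fun t : ℝ => ((i : ℕ) : ℝ) * t) (nhdsWithin 0 (Set.Ioi 0)) (nhds 0) := fun i => by
    simpa using tt0.const_mul (i : ℝ)
  refine ⟨∑ j ∈ Finset.range (k + 1), c j * (k.choose j : ℝ) * (-σ) ^ j *
    (exp (l * (-σ / 2)) * exp (0 * (-σ / 2))), ?_⟩
  unfold phR
  refine tendsto_finsetSum _ fun j _ => ?_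
  have h1 := ((hc j).mul_const (k.choose j : ℝ)).mul_const ((-σ) ^ j)
  have h2 := (pow_lim _ l σ (natsub_lim _ l hN2 j)).mul (pow_lim (fun _ => k - j) 0 σ (hconst (k - j)))
  refine (h1.mul h2).congr' ?_
  have hp : ∀ᶠ t in nhdsWithin (0 : ℝ) (Set.Ioi 0), 0 < 1 - t * σ := by
    have : Tendsto (fun t : ℝ => 1 - t * σ) (nhdsWithin 0 (Set.Ioi 0)) (nhds 1) := by
      simpa using (tt0.mul_const σ).const_sub 1
    exact this.eventually_const_lt (by norm_num)
  filter_upwards [hp] with t h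
  rw [Real.mul_self_sqrt h.le]
  have : -(1 - (1 - t * σ)) = t * (-σ) := by ring
  rw [this, mul_pow]; ring

lemma hT_lim (σ ζ : ℝ) (q : ℝ × ℕ) : ∃ c, Tendsto (fun t => hT t σ ζ (fl t q)) (nhdsWithin 0 (Set.Ioi 0)) (nhds c) := by
  obtain ⟨x, k⟩ := q
  have hN : Tendsto (fun t => (⌊x / t⌋.natAbs : ℝ) * t) (nhdsWithin 0 (Set.Ioi 0)) (nhds |x|) := by
    rw [tendsto_iff_norm_sub_tendsto_zero]
    refine tendsto_of_tendsto_of_tendsto_of_le_of_le' tendsto_const_nhds tt0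
      (Eventually.of_forall fun t => norm_nonneg _) ?_
    filter_upwards [evpos] with t ht using (floor_abs t x ht).2
  have hn : Tendsto (fun t => (⌊x / t⌋ : ℝ) * t) (nhdsWithin 0 (Set.Ioi 0)) (nhds x) := by
    rw [tendsto_iff_norm_sub_tendsto_zero]
    refine tendsto_of_tendsto_of_tendsto_of_le_of_le' tendsto_const_nhds tt0
      (Eventually.of_forall fun t => norm_nonneg _) ?_
    filter_upwards [evpos] with t ht
    have h1 := Int.floor_le (x / t)
    have h2 := Int.lt_floor_add_one (x / t)
    rw [le_div_iff₀ ht] at h1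
    rw [div_lt_iff₀ ht] at h2
    rw [Real.norm_eq_abs, abs_le]; constructor <;> linarith
  obtain ⟨c, hc⟩ := phR_lim _ _ σ k hN
  have h1 := (tt0.const_mul (2 * k + 1 : ℝ)).add hN
  have h2 := (continuous_exp.tendsto _).comp ((tt0.const_mul (-(4 * k * (k + 1) : ℝ))).add (hN.const_mul (-(4 * k + 2 : ℝ))))
  have h3 := (continuous_cos.tendsto _).comp (hn.mul_const ζ)
  refine ⟨_, (((h1.mul h2).mul hc).mul h3).congr fun t => ?_⟩
  simp only [hT, fl, P0_ezk, Function.comp]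
  have e1 : -(4 * (k : ℝ) * (k + 1)) * t + -(4 * (k : ℝ) + 2) * ((⌊x / t⌋.natAbs : ℝ) * t) =
    -(4 * (k : ℝ) * ((k : ℝ) + (⌊x / t⌋.natAbs : ℝ) + 1) + 2 * (⌊x / t⌋.natAbs : ℝ)) * t := by ring
  have e2 : (⌊x / t⌋ : ℝ) * t * ζ = ⌊x / t⌋ * (t * ζ) := by ring
  rw [e1, e2]; ring

lemma PHI_lim (p : ℝ × ℝ) (hσ : 0 ≤ p.1) : ∃ c, Tendsto (fun t => PHI t p) (nhdsWithin 0 (Set.Ioi 0)) (nhds c) := by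
  choose L hL using hT_lim p.1 p.2
  refine ⟨_, (riemann_lim (fun t => hT t p.1 p.2) (exp (p.1 / 2 + 2)) L ?_ hL).congr fun t => (PHI_eq t p).symm⟩
  have h1 : ∀ᶠ t : ℝ in nhdsWithin 0 (Set.Ioi 0), t ≤ 1 := tt0.eventually_le_const (by norm_num)
  have h2 : ∀ᶠ t : ℝ in nhdsWithin 0 (Set.Ioi 0), t * p.1 ≤ 1 := by
    have : Tendsto (fun t : ℝ => t * p.1) (nhdsWithin 0 (Set.Ioi 0)) (nhds 0) := by simpa using tt0.mul_const p.1
    exact this.eventually_le_const (by norm_num)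
  filter_upwards [evpos, h1, h2] with t a b c q
  exact hT_bound t p.1 p.2 a b hσ c q

lemma PHI_bound : ∃ K, 1 ≤ K ∧ ∀ t, 0 < t → t ≤ 1 → ∀ p : ℝ × ℝ, 0 ≤ p.1 → t * p.1 ≤ 1 →
    PHI t p ≤ K * exp (p.1 / 2) := by
  refine ⟨max 1 (exp 2 * ∫ q, G2 q ∂mu2), le_max_left _ _, fun t h0 h1 p hp hp1 => ?_⟩
  have := riemann_bound t h0 (hT t p.1 p.2) _ (hT_bound t p.1 p.2 h0 h1 hp hp1)
  rw [← PHI_eq, exp_add] at this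
  calc _ ≤ _ := (le_abs_self _).trans this
    _ = (exp 2 * ∫ q, G2 q ∂mu2) * exp (p.1 / 2) := by ring
    _ ≤ _ := by gcongr; exact le_max_right _ _

lemma PHI_nonneg (t : ℝ) (ht : 0 < t) (p : ℝ × ℝ) (hp : 0 ≤ p.1) (hp1 : t * p.1 ≤ 1) : 0 ≤ PHI t p := by
  unfold PHI
  refine mul_nonneg (by positivity) (q0_nonneg t ht (_, _) ?_)
  change _ ≤ (1 : ℝ)
  rw [sc_sq t _ _ hp1]
  nlinarith
end

section
open Real MeasureTheory Filter

noncomputable def Qt (t : ℝ) : Set (ℝ × ℝ) := Set.Ico 0 (1 / t) ×ˢ Set.Ioo (-(π / t)) (π / t)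
noncomputable def sc (t : ℝ) (p : ℝ × ℝ) : ℝ × ℝ := (√(1 - t * p.1) * cos (t * p.2), √(1 - t * p.1) * sin (t * p.2))

lemma Qt_meas (t : ℝ) : MeasurableSet (Qt t) := measurableSet_Ico.prod measurableSet_Ioo

lemma sc_cont (t : ℝ) : Continuous (sc t) := by unfold sc; fun_prop

lemma Qt_tle {t : ℝ} (ht : 0 < t) {p : ℝ × ℝ} (hp : p ∈ Qt t) : 0 ≤ p.1 ∧ t * p.1 ≤ 1 := by
  refine ⟨hp.1.1, ?_⟩
  have := hp.1.2
  rw [lt_div_iff₀ ht] at this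
  linarith

lemma sc_mem {t : ℝ} (ht : 0 < t) {p : ℝ × ℝ} (h0 : 0 ≤ p.1) (h1 : t * p.1 ≤ 1) : sc t p ∈ DD := by
  change _ ≤ (1 : ℝ)
  simp only [sc]
  rw [sc_sq t _ _ h1]
  nlinarith

lemma scale_int (t : ℝ) (ht : 0 < t) (g : ℝ × ℝ → ℝ) :
    ∫ p in Qt t, PHI t p * g (sc t p) = 2 * ∫ p in DD, q0 t p.1 p.2 * g p := by
  rw [polar_P2 _ t ht, smul_eq_mul, ← integral_const_mul, ← integral_const_mul]
  congr 1; ext p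
  simp only [PHI, sc]; ring

lemma Qt_integrable (t : ℝ) (_ : 0 < t) (g : ℝ × ℝ → ℝ)
    (hg : ContinuousOn g (Set.Icc 0 (1 / t) ×ˢ Set.Icc (-(π / t)) (π / t))) : IntegrableOn g (Qt t) :=
  (hg.integrableOn_compact (isCompact_Icc.prod isCompact_Icc)).mono_set
    (Set.prod_mono Set.Ico_subset_Icc_self Set.Ioo_subset_Icc_self)

lemma PHI_contOn (t : ℝ) (ht : 0 < t) : ContinuousOn (PHI t) (Set.Icc 0 (1 / t) ×ˢ Set.Icc (-(π / t)) (π / t)) := by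
  have hm : Set.MapsTo (sc t) (Set.Icc 0 (1 / t) ×ˢ Set.Icc (-(π / t)) (π / t)) DD := by
    intro p hp
    refine sc_mem ht hp.1.1 ?_
    have := hp.1.2
    rw [le_div_iff₀ ht] at this
    linarith
  have h := ContinuousOn.comp (g := fun p : ℝ × ℝ => q0 t p.1 p.2) (q0_contOn t ht) (sc_cont t).continuousOn hm
  have h2 := h.const_smul (t ^ 2)
  refine h2.congr fun p _ => ?_
  simp only [PHI, sc, smul_eq_mul, Function.comp, Pi.smul_apply]

lemma q0_mom (t : ℝ) (ht : 0 < t) (S : Finset (ℕ × ℕ)) (c : ℕ × ℕ → ℝ) (g : ℝ × ℝ → ℝ)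
    (hg : ∀ p : ℝ × ℝ, (g p : ℂ) = ∑ i ∈ S, (c i : ℂ) * fh i.1 i.2 p.1 p.2) :
    ∫ p in DD, q0 t p.1 p.2 * g p = π * ∑ i ∈ S, c i * Real.exp (-lam i.1 i.2 * t) := by
  have h := q0_comb t ht S (fun i => (c i : ℂ))
  simp_rw [← hg] at h
  have h2 : ∫ p in DD, ((q0 t p.1 p.2 * g p : ℝ) : ℂ) = ((π * ∑ i ∈ S, c i * Real.exp (-lam i.1 i.2 * t) : ℝ) : ℂ) := by
    push_cast
    push_cast at h
    exact h
  rw [integral_complex_ofReal] at h2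
  exact_mod_cast h2

lemma fh10 (x y : ℝ) : fh 1 0 x y = x + y * Complex.I := by simp [fh, ph_zero_right]
lemma fh01 (x y : ℝ) : fh 0 1 x y = x - y * Complex.I := by simp [fh, ph_zero_left]
lemma fh22 (x y : ℝ) : fh 2 2 x y = 6 * (x ^ 2 + y ^ 2) ^ 2 - 6 * (x ^ 2 + y ^ 2) + 1 := by
  have h : ((x : ℂ) + y * Complex.I) * (x - y * Complex.I) = x ^ 2 + y ^ 2 := by
    linear_combination (-(y : ℂ) ^ 2) * Complex.I_sq
  have : fh 2 2 x y = (((x : ℂ) + y * Complex.I) * (x - y * Complex.I)) ^ 2 -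
      4 * (1 - (x + y * Complex.I) * (x - y * Complex.I)) * ((x + y * Complex.I) * (x - y * Complex.I)) +
      (1 - (x + y * Complex.I) * (x - y * Complex.I)) ^ 2 := by
    simp only [fh, ph_explicit, phE, Finset.sum_range_succ]
    simp; ring
  rw [this, h]; ring

lemma mass (t : ℝ) (ht : 0 < t) : ∫ p in Qt t, PHI t p = 2 * π := by
  have h1 := scale_int t ht (fun _ => 1)
  have h2 := q0_mom t ht {(0, 0)} (fun _ => 1) (fun _ => 1) (fun p => by simp [fh00])
  rw [h2] at h1
  simpa [lam] using h1

lemma one_sub_exp_sq (c t : ℝ) (hc : 0 < c) (ht : 0 < t) : 0 ≤ exp (-(c * t)) ∧ exp (-(c * t)) ≤ 1 ∧ (1 - exp (-(c * t))) ^ 2 ≤ c ^ 2 * t ^ 2 := by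
  have h1 := Real.add_one_le_exp (-(c * t))
  have h2 : exp (-(c * t)) ≤ 1 := by rw [exp_le_one_iff]; nlinarith
  refine ⟨(exp_pos _).le, h2, ?_⟩
  rw [← mul_pow]
  apply sq_le_sq' <;> nlinarith [mul_pos hc ht]

lemma mom_s (t : ℝ) (ht : 0 < t) : ∫ p in DD, q0 t p.1 p.2 * (1 - p.1 ^ 2 - p.2 ^ 2) ^ 2 ≤ 32 * π * t ^ 2 := by
  rw [q0_mom t ht {(0, 0), (1, 1), (2, 2)} (fun i => if i = (0, 0) then 1 / 3 else if i = (1, 1) then -1 / 2 else 1 / 6)]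
  · have e1 : lam 1 1 * t = 8 * t := by norm_num [lam]
    have e2 : lam 2 2 * t = 8 * t + 8 * t + 8 * t := by norm_num [lam]; ring
    have e0 : lam 0 0 * t = 0 := by norm_num [lam]
    obtain ⟨a, b, c⟩ := one_sub_exp_sq 8 t (by norm_num) ht
    have s2 : exp (-(lam 2 2 * t)) = exp (-(8 * t)) * exp (-(8 * t)) * exp (-(8 * t)) := by
      rw [e2, ← Real.exp_add, ← Real.exp_add]; congr 1; ring
    simp [e0, e1, s2]
    have : (1 / 3 : ℝ) + (-1 / 2 * exp (-(8 * t)) + 1 / 6 * (exp (-(8 * t)) * exp (-(8 * t)) * exp (-(8 * t)))) ≤ 32 * t ^ 2 := by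
      nlinarith [mul_nonneg (sq_nonneg (1 - exp (-(8 * t)))) (sub_nonneg.2 b)]
    have := mul_le_mul_of_nonneg_left this pi_pos.le
    norm_num at this ⊢
    linarith
  · intro p
    simp [fh00, fh11, fh22]; ring

lemma mom_z (t : ℝ) (ht : 0 < t) : ∫ p in DD, q0 t p.1 p.2 * ((1 - p.1) ^ 2 + p.2 ^ 2) ≤ 12 * π * t ^ 2 := by
  rw [q0_mom t ht {(0, 0), (1, 0), (0, 1), (1, 1)} (fun i => if i = (0, 0) then 3 / 2 else if i = (1, 1) then 1 / 2 else -1)]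
  · have e1 : lam 1 1 * t = 2 * t + 2 * t + 2 * t + 2 * t := by norm_num [lam]; ring
    have e2 : lam 1 0 * t = 2 * t := by norm_num [lam]
    have e3 : lam 0 1 * t = 2 * t := by norm_num [lam]
    have e0 : lam 0 0 * t = 0 := by norm_num [lam]
    obtain ⟨a, b, c⟩ := one_sub_exp_sq 2 t (by norm_num) ht
    have s1 : exp (-(lam 1 1 * t)) = exp (-(2 * t)) * exp (-(2 * t)) * exp (-(2 * t)) * exp (-(2 * t)) := by
      rw [e1, ← Real.exp_add, ← Real.exp_add, ← Real.exp_add]; congr 1; ring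
    simp [e0, s1, e2, e3]
    set y := exp (-(2 * t))
    have h0 : 3 / 2 - 2 * y + 1 / 2 * (y * y * y * y) = (1 - y) ^ 2 * (3 + 2 * y + y ^ 2) / 2 := by ring
    have h1 : (3 + 2 * y + y ^ 2) ≤ 6 := by nlinarith
    have : 3 / 2 - 2 * y + 1 / 2 * (y * y * y * y) ≤ 12 * t ^ 2 := by
      rw [h0]
      have := mul_le_mul c h1 (by positivity) (by positivity)
      linarith
    have := mul_le_mul_of_nonneg_left this pi_pos.le
    norm_num at this ⊢
    linarith
  · intro p
    simp [fh00, fh11, fh10, fh01]; ring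

lemma disk_z (t : ℝ) (ht : 0 < t) (p : ℝ × ℝ) (hp : p ∈ Qt t) :
    t ^ 2 * p.2 ^ 2 ≤ 2 * π ^ 2 * ((1 - (sc t p).1) ^ 2 + (sc t p).2 ^ 2) := by
  obtain ⟨h0, h1⟩ := Qt_tle ht hp
  have hz : |t * p.2| ≤ π := by
    have a := hp.2.1
    have b := hp.2.2
    rw [← neg_div, div_lt_iff₀ ht] at a
    rw [lt_div_iff₀ ht] at b
    rw [abs_le]; constructor <;> linarith
  have hc := Real.cos_le_one_sub_mul_cos_sq hz
  have hc1 := Real.cos_le_one (t * p.2)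
  have hc2 := Real.neg_one_le_cos (t * p.2)
  have hsq := sc_sq t p.1 p.2 h1
  simp only [sc]
  set R := √(1 - t * p.1) with hR
  have hR0 : 0 ≤ R := Real.sqrt_nonneg _
  have hR2 : R ^ 2 = 1 - t * p.1 := Real.sq_sqrt (by linarith)
  have hR1 : R ≤ 1 := by nlinarith
  have e : (1 - R * cos (t * p.2)) ^ 2 + (R * sin (t * p.2)) ^ 2 = 1 - 2 * R * cos (t * p.2) + R ^ 2 := by
    linear_combination hsq - hR2
  rw [e]
  set d := 1 - cos (t * p.2) with hd
  have e2 : cos (t * p.2) = 1 - d := by rw [hd]; ring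
  rw [e2]
  have hd1 : d ≤ 2 := by linarith
  have hd0 : 0 ≤ d := by linarith
  have k1 : d / 4 ≤ 1 - 2 * R * (1 - d) + R ^ 2 := by
    nlinarith [mul_nonneg hR0 hd0, sq_nonneg (1 - R)]
  have k2 : t ^ 2 * p.2 ^ 2 ≤ π ^ 2 / 2 * d := by
    have : 2 / π ^ 2 * (t * p.2) ^ 2 ≤ d := by linarith
    have hpi : 0 < π ^ 2 := by positivity
    calc t ^ 2 * p.2 ^ 2 = π ^ 2 / 2 * (2 / π ^ 2 * (t * p.2) ^ 2) := by field_simp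
      _ ≤ _ := by gcongr
  nlinarith [sq_nonneg π]

lemma mom_bound (t : ℝ) (ht : 0 < t) : ∫ p in Qt t, PHI t p * (p.1 ^ 2 + p.2 ^ 2) ≤ 64 * π + 48 * π ^ 3 := by
  set g : ℝ × ℝ → ℝ := fun p => (1 - p.1 ^ 2 - p.2 ^ 2) ^ 2 + 2 * π ^ 2 * ((1 - p.1) ^ 2 + p.2 ^ 2) with hg
  have hgc : Continuous g := by fun_prop
  have hD : ∫ p in DD, q0 t p.1 p.2 * g p ≤ (32 * π + 24 * π ^ 3) * t ^ 2 := by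
    have i1 : IntegrableOn (fun p : ℝ × ℝ => q0 t p.1 p.2 * (1 - p.1 ^ 2 - p.2 ^ 2) ^ 2) DD :=
      ((q0_contOn t ht).mul (by fun_prop)).integrableOn_compact DD_compact
    have i2 : IntegrableOn (fun p : ℝ × ℝ => q0 t p.1 p.2 * ((1 - p.1) ^ 2 + p.2 ^ 2)) DD :=
      ((q0_contOn t ht).mul (by fun_prop)).integrableOn_compact DD_compact
    have e : ∀ p : ℝ × ℝ, q0 t p.1 p.2 * g p = q0 t p.1 p.2 * (1 - p.1 ^ 2 - p.2 ^ 2) ^ 2 +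
      2 * π ^ 2 * (q0 t p.1 p.2 * ((1 - p.1) ^ 2 + p.2 ^ 2)) := fun p => by simp only [hg]; ring
    simp_rw [e]
    rw [integral_add i1 (i2.const_mul _), integral_const_mul]
    have h1 := mom_s t ht
    have h2 := mul_le_mul_of_nonneg_left (mom_z t ht) (show 0 ≤ 2 * π ^ 2 by positivity)
    linarith
  have hs := scale_int t ht g
  have hle : ∫ p in Qt t, PHI t p * (p.1 ^ 2 + p.2 ^ 2) ≤ ∫ p in Qt t, (1 / t ^ 2) * (PHI t p * g (sc t p)) := by
    have c1 := PHI_contOn t ht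
    refine setIntegral_mono_on (Qt_integrable t ht _ (c1.mul (by fun_prop)))
      ((Qt_integrable t ht _ (c1.mul (hgc.comp (sc_cont t)).continuousOn)).const_mul _) (Qt_meas t) ?_
    intro p hp
    obtain ⟨h0, h1⟩ := Qt_tle ht hp
    have hP := PHI_nonneg t ht p h0 h1
    have h2 := disk_z t ht p hp
    have h3 := sc_sq t p.1 p.2 h1
    have h4 : p.1 ^ 2 + p.2 ^ 2 ≤ (1 / t ^ 2) * g (sc t p) := by
      rw [one_div, inv_mul_eq_div, le_div_iff₀ (by positivity)]
      simp only [hg]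
      have : (1 - (sc t p).1 ^ 2 - (sc t p).2 ^ 2) = t * p.1 := by simp only [sc]; linarith
      rw [this]
      linarith
    calc _ ≤ PHI t p * ((1 / t ^ 2) * g (sc t p)) := by gcongr
      _ = _ := by ring
  refine hle.trans ?_
  rw [integral_const_mul, hs]
  rw [one_div, inv_mul_eq_div, div_le_iff₀ (by positivity)]
  linarith

noncomputable def Aent (t : ℝ) : ℝ := (1 / 2) * ∫ p in Qt t, PHI t p * log (PHI t p)

lemma entropy_scale (t : ℝ) (ht : 0 < t) : ∫ p in DD, EE 0 t p = Aent t - 2 * π * log t := by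
  have c1 := PHI_contOn t ht
  have i1 : IntegrableOn (fun p => PHI t p * log (PHI t p)) (Qt t) :=
    Qt_integrable t ht _ (Real.continuous_mul_log.comp_continuousOn c1)
  have i2 : IntegrableOn (PHI t) (Qt t) := Qt_integrable t ht _ c1
  have h := scale_int t ht (fun p => log (q0 t p.1 p.2))
  have e : ∫ p in Qt t, PHI t p * log (q0 t (sc t p).1 (sc t p).2) =
      ∫ p in Qt t, (PHI t p * log (PHI t p) - 2 * log t * PHI t p) := by
    refine setIntegral_congr_fun (Qt_meas t) fun p hp => ?_
    have hd : PHI t p = t ^ 2 * q0 t (sc t p).1 (sc t p).2 := rfl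
    by_cases h0 : q0 t (sc t p).1 (sc t p).2 = 0
    · rw [hd, h0]; simp
    · rw [hd, Real.log_mul (by positivity) h0, Real.log_pow]; push_cast; ring
  rw [e, integral_sub i1 (i2.const_mul _), integral_const_mul, mass t ht] at h
  have e2 : ∫ p in DD, EE 0 t p = ∫ p in DD, q0 t p.1 p.2 * log (q0 t p.1 p.2) := by
    simp only [EE, zero_add]
  rw [e2, Aent]
  linarith
end

section
open Real MeasureTheory Filter

lemma ent_pt (x K s z : ℝ) (hK : 1 ≤ K) (hx : 0 ≤ x) (hs : 0 ≤ s) (hb : x ≤ K * exp (s / 2)) :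
    |x * log x| ≤ x * (log K + s + |z|) + exp (-(s + |z|)) := by
  have hlK : 0 ≤ log K := Real.log_nonneg hK
  have hz := abs_nonneg z
  rcases hx.eq_or_lt with h | h
  · subst h; simp; positivity
  rw [abs_le]
  constructor
  · have h1 := Real.log_le_sub_one_of_pos (div_pos (exp_pos (-(s + |z|))) h)
    rw [Real.log_div (exp_pos _).ne' h.ne', Real.log_exp] at h1
    have h2 := mul_le_mul_of_nonneg_left h1 h.le
    have h3 : x * (exp (-(s + |z|)) / x - 1) = exp (-(s + |z|)) - x := by field_simp
    rw [h3] at h2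
    nlinarith [mul_nonneg hx hlK]
  · have h1 := Real.log_le_log h hb
    rw [Real.log_mul (by positivity) (exp_pos _).ne', Real.log_exp] at h1
    have h2 := mul_le_mul_of_nonneg_left h1 h.le
    have := exp_pos (-(s + |z|))
    nlinarith [mul_nonneg hx hs, mul_nonneg hx hz]

lemma Jint : Integrable (fun p : ℝ × ℝ => exp (-(1 / 2) * |p.1|) * exp (-(1 / 2) * |p.2|)) := by
  have h := exp_abs_integrable (1 / 2) (by norm_num)
  exact h.mul_prod h

lemma tail_pt (R K x s z : ℝ) (hR : 1 ≤ R) (hK : 1 ≤ K) (hx : 0 ≤ x) (hs : 0 ≤ s) (hb : x ≤ K * exp (s / 2))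
    (ho : R ≤ s ∨ R ≤ |z|) :
    |x * log x| ≤ (log K + 2) / R * (x * (s ^ 2 + z ^ 2)) + 2 / R * (exp (-(1 / 2) * |s|) * exp (-(1 / 2) * |z|)) := by
  have hlK : 0 ≤ log K := Real.log_nonneg hK
  have hz := abs_nonneg z
  refine (ent_pt x K s z hK hx hs hb).trans (add_le_add ?_ ?_)
  · have h1 : log K + s + |z| ≤ (log K + 2) / R * (s ^ 2 + z ^ 2) := by
      rw [div_mul_eq_mul_div, le_div_iff₀ (by linarith), ← sq_abs z]
      have a1 : R ≤ s ^ 2 + |z| ^ 2 := by rcases ho with h | h <;> nlinarith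
      have a2 : R * (s + |z|) ≤ 2 * (s ^ 2 + |z| ^ 2) := by
        rcases ho with h | h
        · nlinarith [sq_nonneg (s - |z|), mul_le_mul_of_nonneg_right h (add_nonneg hs hz)]
        · nlinarith [sq_nonneg (s - |z|), mul_le_mul_of_nonneg_right h (add_nonneg hs hz)]
      nlinarith [mul_le_mul_of_nonneg_left a1 hlK]
    calc _ ≤ x * ((log K + 2) / R * (s ^ 2 + z ^ 2)) := by gcongr
      _ = _ := by ring
  · rw [abs_of_nonneg hs]
    have e : exp (-(s + |z|)) = exp (-((s + |z|) / 2)) * (exp (-(1 / 2) * s) * exp (-(1 / 2) * |z|)) := by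
      rw [← Real.exp_add, ← Real.exp_add]; congr 1; ring
    rw [e]
    gcongr
    have h1 : R / 2 ≤ exp ((s + |z|) / 2) := by
      have := Real.add_one_le_exp ((s + |z|) / 2)
      rcases ho with h | h <;> linarith
    rw [Real.exp_neg, ← one_div, div_le_div_iff₀ (exp_pos _) (by linarith)]
    linarith

noncomputable def SR (R : ℝ) : Set (ℝ × ℝ) := Set.Ico 0 R ×ˢ Set.Ioo (-R) R

lemma SR_sub (R t : ℝ) (hR : 1 ≤ R) (ht : 0 < t) (h : t ≤ 1 / R) : SR R ⊆ Qt t := by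
  have h1 : R ≤ 1 / t := by
    rw [le_div_iff₀ ht]; rw [le_div_iff₀ (by linarith)] at h; linarith
  have h2 : R ≤ π / t := h1.trans (by gcongr; linarith [pi_gt_three])
  exact Set.prod_mono (Set.Ico_subset_Ico_right h1) (Set.Ioo_subset_Ioo (by linarith) h2)

lemma SR_lim (R : ℝ) (hR : 1 ≤ R) : ∃ a, Tendsto (fun t => ∫ p in SR R, PHI t p * log (PHI t p))
    (nhdsWithin 0 (Set.Ioi 0)) (nhds a) := by
  obtain ⟨K, hK, hb⟩ := PHI_bound
  have hm : MeasurableSet (SR R) := measurableSet_Ico.prod measurableSet_Ioo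
  have hl : ∀ p : ℝ × ℝ, ∃ c, 0 ≤ p.1 → Tendsto (fun t => PHI t p) (nhdsWithin 0 (Set.Ioi 0)) (nhds c) := by
    intro p
    by_cases h : 0 ≤ p.1
    · obtain ⟨c, hc⟩ := PHI_lim p h
      exact ⟨c, fun _ => hc⟩
    · exact ⟨0, fun h' => absurd h' h⟩
  choose c hc using hl
  have hsmall : ∀ᶠ t : ℝ in nhdsWithin 0 (Set.Ioi 0), t < 1 / R :=
    tt0.eventually_lt_const (by positivity)
  have hsmall1 : ∀ᶠ t : ℝ in nhdsWithin 0 (Set.Ioi 0), t < 1 := tt0.eventually_lt_const (by positivity)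
  refine ⟨∫ p in SR R, c p * log (c p), ?_⟩
  have hfin : IsFiniteMeasure ((volume : Measure (ℝ × ℝ)).restrict (SR R)) := by
    refine ⟨?_⟩
    rw [Measure.restrict_apply_univ]
    refine lt_of_le_of_lt (measure_mono (Set.prod_mono Set.Ico_subset_Icc_self Set.Ioo_subset_Icc_self)) ?_
    exact (isCompact_Icc.prod isCompact_Icc).measure_lt_top
  refine tendsto_integral_filter_of_dominated_convergence (fun _ => 1 + (K * exp (R / 2)) ^ 2) ?_ ?_
    (integrable_const _) ?_
  · filter_upwards [evpos, hsmall] with t ht h1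
    exact ((Qt_integrable t ht _ (Real.continuous_mul_log.comp_continuousOn (PHI_contOn t ht))).mono_set
      (SR_sub R t hR ht h1.le)).aestronglyMeasurable
  · filter_upwards [evpos, hsmall, hsmall1] with t ht h1 h2
    refine (ae_restrict_mem hm).mono fun p hp => ?_
    obtain ⟨k0, k1⟩ := Qt_tle ht (SR_sub R t hR ht h1.le hp)
    have n0 := PHI_nonneg t ht p k0 k1
    refine (xlogx_bound _ n0).trans ?_
    gcongr
    refine (hb t ht h2.le p k0 k1).trans ?_
    gcongr
    exact hp.1.2.le
  · refine (ae_restrict_mem hm).mono fun p hp => ?_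
    exact (Real.continuous_mul_log.tendsto (c p)).comp (hc p hp.1.1)

lemma Aent_cauchy (ε : ℝ) (hε : 0 < ε) : ∃ a, ∀ᶠ t : ℝ in nhdsWithin 0 (Set.Ioi 0), |Aent t - a| ≤ ε := by
  obtain ⟨K, hK, hb⟩ := PHI_bound
  set J := ∫ p : ℝ × ℝ, exp (-(1 / 2) * |p.1|) * exp (-(1 / 2) * |p.2|) with hJ
  set D := (log K + 2) * (64 * π + 48 * π ^ 3) + 2 * J with hD
  have hlK : 0 ≤ log K := Real.log_nonneg hK
  set R := max 1 (D / ε) with hRdef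
  have hR : 1 ≤ R := le_max_left _ _
  have hDR : D / R ≤ ε := by
    rw [div_le_iff₀ (by linarith)]
    have : D / ε ≤ R := le_max_right _ _
    rw [div_le_iff₀ hε] at this
    linarith
  obtain ⟨a, ha⟩ := SR_lim R hR
  refine ⟨1 / 2 * a, ?_⟩
  have hsmall : ∀ᶠ t : ℝ in nhdsWithin 0 (Set.Ioi 0), t < 1 / R :=
    tt0.eventually_lt_const (by positivity)
  have hsmall1 : ∀ᶠ t : ℝ in nhdsWithin 0 (Set.Ioi 0), t < 1 := tt0.eventually_lt_const (by positivity)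
  have hm : MeasurableSet (SR R) := measurableSet_Ico.prod measurableSet_Ioo
  filter_upwards [evpos, hsmall, hsmall1, (Metric.tendsto_nhds.1 ha) ε hε] with t ht h1 h2 h3
  have hsub := SR_sub R t hR ht h1.le
  have c1 := PHI_contOn t ht
  have i0 : IntegrableOn (fun p => PHI t p * log (PHI t p)) (Qt t) :=
    Qt_integrable t ht _ (Real.continuous_mul_log.comp_continuousOn c1)
  have i1 : IntegrableOn (fun p => PHI t p * (p.1 ^ 2 + p.2 ^ 2)) (Qt t) :=
    Qt_integrable t ht _ (c1.mul (by fun_prop))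
  have hsplit := setIntegral_sdiff hm i0 hsub
  have ms : MeasurableSet (Qt t \ SR R) := (Qt_meas t).diff hm
  have i1' := i1.mono_set (s := Qt t \ SR R) Set.sdiff_subset
  have ij : IntegrableOn (fun p : ℝ × ℝ => exp (-(1 / 2) * |p.1|) * exp (-(1 / 2) * |p.2|)) (Qt t \ SR R) :=
    Jint.integrableOn
  have htail : |∫ p in Qt t \ SR R, PHI t p * log (PHI t p)| ≤ D / R := by
    have b1 : |∫ p in Qt t \ SR R, PHI t p * log (PHI t p)| ≤ ∫ p in Qt t \ SR R,
        ((log K + 2) / R * (PHI t p * (p.1 ^ 2 + p.2 ^ 2)) +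
          2 / R * (exp (-(1 / 2) * |p.1|) * exp (-(1 / 2) * |p.2|))) := by
      rw [← Real.norm_eq_abs]
      refine norm_integral_le_of_norm_le ((i1'.const_mul _).add (ij.const_mul _)) ?_
      refine (ae_restrict_mem ms).mono fun p hp => ?_
      obtain ⟨k0, k1⟩ := Qt_tle ht hp.1
      refine tail_pt R K (PHI t p) p.1 p.2 hR hK (PHI_nonneg t ht p k0 k1) k0 (hb t ht h2.le p k0 k1) ?_
      by_contra hcon
      push Not at hcon
      exact hp.2 ⟨⟨k0, hcon.1⟩, abs_lt.1 hcon.2⟩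
    rw [integral_add (i1'.const_mul _) (ij.const_mul _), integral_const_mul, integral_const_mul] at b1
    have b2 : ∫ p in Qt t \ SR R, PHI t p * (p.1 ^ 2 + p.2 ^ 2) ≤ 64 * π + 48 * π ^ 3 := by
      refine le_trans ?_ (mom_bound t ht)
      refine setIntegral_mono_set i1 ?_ (Filter.Eventually.of_forall fun p hp => hp.1)
      refine (ae_restrict_mem (Qt_meas t)).mono fun p hp => ?_
      obtain ⟨k0, k1⟩ := Qt_tle ht hp
      have := PHI_nonneg t ht p k0 k1
      simp only [Pi.zero_apply]
      positivity
    have b3 : ∫ p in Qt t \ SR R, exp (-(1 / 2) * |p.1|) * exp (-(1 / 2) * |p.2|) ≤ J :=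
      setIntegral_le_integral Jint (Filter.Eventually.of_forall fun p => by positivity)
    calc _ ≤ _ := b1
      _ ≤ (log K + 2) / R * (64 * π + 48 * π ^ 3) + 2 / R * J := by gcongr
      _ = D / R := by rw [hD]; ring
  rw [hsplit] at htail
  rw [Real.dist_eq] at h3
  rw [Aent, abs_le]
  rw [abs_lt] at h3
  rw [abs_le] at htail
  constructor <;> linarith [h3.1, h3.2, htail.1, htail.2]

lemma Aent_diff (l : ℝ) (hl : 0 < l) : Tendsto (fun t => Aent t - Aent (l * t)) (nhdsWithin 0 (Set.Ioi 0)) (nhds 0) := by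
  rw [Metric.tendsto_nhds]
  intro ε hε
  obtain ⟨a, ha⟩ := Aent_cauchy (ε / 3) (by positivity)
  have hs : Tendsto (fun t : ℝ => l * t) (nhdsWithin 0 (Set.Ioi 0)) (nhdsWithin 0 (Set.Ioi 0)) := by
    refine tendsto_nhdsWithin_iff.2 ⟨by simpa using tt0.const_mul l, ?_⟩
    filter_upwards [evpos] with t ht
    exact mul_pos hl ht
  filter_upwards [ha, hs.eventually ha] with t h1 h2
  rw [Real.dist_eq, sub_zero, abs_lt]
  rw [abs_le] at h1 h2
  constructor <;> linarith [h1.1, h1.2, h2.1, h2.2]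
end

section
open Real MeasureTheory Filter

lemma ii_bound (l t : ℝ) (hl : 1 < l) (ht : 0 < t) :
    (l - 1) * t * Cconst (l * t) ≤ log l + (Aent t - Aent (l * t)) / (2 * π) ∧
    log l + (Aent t - Aent (l * t)) / (2 * π) ≤ (l - 1) * t * Cconst t := by
  have hlt : 0 < l * t := by positivity
  obtain ⟨-, h1, h2⟩ := sandwich t (l * t) ht (by nlinarith)
  have e := entropy_scale t ht
  have e' := entropy_scale (l * t) hlt
  rw [Real.log_mul (by positivity) ht.ne'] at e'
  rw [e, e'] at h1 h2
  have hpi := pi_pos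
  rw [Cc t ht, Cc (l * t) hlt]
  have k : log l + (Aent t - Aent (l * t)) / (2 * π) =
    (Aent t - 2 * π * log t - (Aent (l * t) - 2 * π * (log l + log t))) / (2 * π) := by field_simp; ring
  rw [k]
  constructor
  · rw [le_div_iff₀ (by positivity)]
    refine le_trans (le_of_eq ?_) h1
    field_simp
  · rw [div_le_iff₀ (by positivity)]
    refine le_trans h2 (le_of_eq ?_)
    field_simp

lemma part_ii : Tendsto (fun t => t * Cconst t) (nhdsWithin 0 (Set.Ioi 0)) (nhds 1) := by
  rw [Metric.tendsto_nhds]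
  intro ε hε
  set δ := min (ε / 2) 1 with hδ
  have hδ0 : 0 < δ := by positivity
  have hδ1 : δ ≤ ε / 2 := min_le_left _ _
  have hδ2 : δ ≤ 1 := min_le_right _ _
  set l := 1 + δ / 2 with hl
  have hl1 : 1 < l := by linarith
  have hl0 : 0 < l := by linarith
  have hd := Aent_diff l hl0
  have hd2 : Tendsto (fun t => (Aent t - Aent (l * t)) / (2 * π)) (nhdsWithin 0 (Set.Ioi 0)) (nhds 0) := by
    simpa using hd.div_const (2 * π)
  have hη : 0 < (l - 1) * (δ / 4) := by apply mul_pos <;> linarith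
  have hev := (Metric.tendsto_nhds.1 hd2) _ hη
  have hs : Tendsto (fun t : ℝ => t / l) (nhdsWithin 0 (Set.Ioi 0)) (nhdsWithin 0 (Set.Ioi 0)) := by
    refine tendsto_nhdsWithin_iff.2 ⟨by simpa using tt0.div_const l, ?_⟩
    filter_upwards [evpos] with t ht
    exact div_pos ht hl0
  filter_upwards [evpos, hev, hs.eventually hev] with t ht h1 h2
  have g1 := (ii_bound l t hl1 ht).2
  have g2 := (ii_bound l (t / l) hl1 (div_pos ht hl0)).1
  rw [mul_div_cancel₀ _ hl0.ne'] at g2 h2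
  rw [Real.dist_eq, sub_zero, abs_lt] at h1 h2
  have u : log l ≤ l - 1 := Real.log_le_sub_one_of_pos hl0
  have v : 1 - l⁻¹ ≤ log l := Real.one_sub_inv_le_log_of_pos hl0
  have hl1' : 0 < l - 1 := by linarith
  -- lower bound
  have w : (l - 1) * (1 - δ / 2) ≤ 1 - l⁻¹ := by
    have : 1 - l⁻¹ = (l - 1) * l⁻¹ := by field_simp
    rw [this]
    gcongr
    rw [← one_div, le_div_iff₀ hl0, hl]
    nlinarith
  have lo : 1 - 3 * δ / 4 ≤ t * Cconst t := by
    have : (l - 1) * (1 - 3 * δ / 4) ≤ (l - 1) * (t * Cconst t) := by nlinarith [h1.1]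
    exact le_of_mul_le_mul_left this hl1'
  have hi : t / l * Cconst t ≤ 1 + δ / 4 := by
    have : (l - 1) * (t / l * Cconst t) ≤ (l - 1) * (1 + δ / 4) := by nlinarith [h2.2]
    exact le_of_mul_le_mul_left this hl1'
  have hi2 : t * Cconst t ≤ l * (1 + δ / 4) := by
    have := mul_le_mul_of_nonneg_left hi hl0.le
    have e : l * (t / l * Cconst t) = t * Cconst t := by field_simp
    linarith
  rw [Real.dist_eq, abs_lt]
  constructor
  · linarith
  · have : l * (1 + δ / 4) < 1 + ε := by rw [hl]; nlinarith
    linarith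
end

/-- Properties of `C(t)`: it is decreasing on `(0,∞)`, `C(t) ~ 1/t` as `t → 0⁺` and
`C(t) ~ 4 e^{-4t}` as `t → +∞`. -/
theorem stmt_19 :
    AntitoneOn Cconst (Set.Ioi 0) ∧
    Filter.Tendsto (fun t : ℝ => t * Cconst t) (nhdsWithin 0 (Set.Ioi 0)) (nhds 1) ∧
    Filter.Tendsto (fun t : ℝ => Real.exp (4 * t) * Cconst t) Filter.atTop (nhds 4) := by
  exact ⟨part_i, part_ii, part_iii⟩
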